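/- Let s₁ < s₂ < s₃ < s₄ < s₅ < s₆ < s₇ be positive integers satisfying: 2s₄ < s₇ ≤ 2s₄ + s₁; s₇ ≤ s₃ + s₅; s₇ ≤ 3s₂; 2s₃ < s₆ ≤ s₂ + s₄; and s₄ ≤ 2s₂. Then there exist a finite tile set T (whose size does not depend on m), a seed s ∈ T, a glue function G taking values in {0, s₁, s₂, s₃, s₄, s₅, s₆, s₇}, and distinguished tiles t₀, t₁ ∈ T, such that for every m ≥ 1 and every binary string b = b₀b₁⋯b_{m−1}, under the temperature sequence τ^b of length 4m−1 defined by τ_{4i} = s₄ for i = 0,…,m−1; τ_{4i+1} = s₄ if b_i = 0 and s₇ if b_i = 1; τ_{4i+2} = s₃ for i = 0,…,m−1; and τ_{4i+3} = s₆ for i = 0,…,m−2, the system ⟨T, s, G, τ^b⟩ uniquely assembles, under the multiple tile model, a 12 × 4m rectangle whose top-row tile at horizontal position 4i+1 (counting from 1 at the west end) is t₀ if b_i = 0 and t₁ if b_i = 1. -/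

import Mathlib

/-! ## The multiple temperature tile self-assembly model -/

/-- Glues are drawn from a countable alphabet; glue `0` is the distinguished `null` glue. -/
abbrev Glue := ℕ

/-- A tile is a quadruple of glues (north, east, south, west). -/
structure Tile where
  north : Glue
  east : Glue
  south : Glue
  west : Glue
deriving DecidableEq

/-- A configuration maps positions of `ℤ²` to a tile or to `none` (the empty tile). -/
abbrev Config := ℤ × ℤ → Option Tile

/-- Two abutting edges bond with strength `G x` when they carry the same glue `x`,
and with strength `0` otherwise. -/
def bond (G : Glue → ℕ) (x y : Glue) : ℕ := if x = y then G x else 0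

/-- Bonding strength between the edges of tile `t` at position `p` and tile `u`
at (neighboring) position `q`. -/
def edgeBond (G : Glue → ℕ) (t u : Tile) (p q : ℤ × ℤ) : ℕ :=
  if q = (p.1, p.2 + 1) then bond G t.north u.south
  else if q = (p.1 + 1, p.2) then bond G t.east u.west
  else if q = (p.1, p.2 - 1) then bond G t.south u.north
  else if q = (p.1 - 1, p.2) then bond G t.west u.east
  else 0

/-- The four L¹-neighbors of a position. -/
def neighbors (p : ℤ × ℤ) : List (ℤ × ℤ) :=
  [(p.1, p.2 + 1), (p.1 + 1, p.2), (p.1, p.2 - 1), (p.1 - 1, p.2)]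

/-- The shape of a configuration: its set of non-empty positions. -/
def shape (C : Config) : Set (ℤ × ℤ) := {p | C p ≠ none}

/-- Total bonding strength between a tile `t` placed at position `p` and the tiles of `C`
at the four neighboring positions. -/
def attachStrength (G : Glue → ℕ) (C : Config) (t : Tile) (p : ℤ × ℤ) : ℕ :=
  ((neighbors p).map (fun q =>
    match C q with
    | some u => edgeBond G t u p q
    | none => 0)).sum

/-- Bonding strength between the tiles of `C` at adjacent positions `p` and `q`. -/
def bondAt (G : Glue → ℕ) (C : Config) (p q : ℤ × ℤ) : ℕ :=
  match C p, C q with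
  | some t, some u => edgeBond G t u p q
  | _, _ => 0

/-- Total strength of the bonds from `p ∈ Q` leaving the set `Q` in configuration `C`. -/
def outStrength (G : Glue → ℕ) (C : Config) (Q : Finset (ℤ × ℤ)) (p : ℤ × ℤ) : ℕ :=
  (((neighbors p).filter (fun q => q ∉ Q)).map (fun q => bondAt G C p q)).sum

/-- Strength of the cut of (the adjacency graph of) `C` separating `Q` from its complement:
the sum over crossing edges of the bonding strengths of the corresponding abutting edges. -/
def cutStrength (G : Glue → ℕ) (C : Config) (Q : Finset (ℤ × ℤ)) : ℕ :=
  ∑ p ∈ Q, outStrength G C Q p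

/-- The initial configuration: the seed tile `s` at the origin. -/
def seedConfig (s : Tile) : Config := fun p => if p = (0, 0) then some s else none

/-- One step of assembly of the (standard) multiple temperature model at temperature `τ`:
either a tile of `T` attaches at an empty position with total bonding strength at least `τ`,
or the portion `Q` of the supertile on the non-seed side of a cut of strength `< τ`
is removed. -/
inductive Step (T : Finset Tile) (G : Glue → ℕ) (τ : ℕ) : Config → Config → Prop
  | attach (C : Config) (t : Tile) (p : ℤ × ℤ) :
      t ∈ T → C p = none → τ ≤ attachStrength G C t p →
      Step T G τ C (Function.update C p (some t))
  | detach (C : Config) (Q : Finset (ℤ × ℤ)) :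
      Q.Nonempty → ((0, 0) : ℤ × ℤ) ∉ Q → (↑Q : Set (ℤ × ℤ)) ⊆ shape C →
      cutStrength G C Q < τ →
      Step T G τ C (fun q => if q ∈ Q then none else C q)

/-- A configuration is terminal for a step relation if no step applies. -/
def Terminal (step : Config → Config → Prop) (C : Config) : Prop := ∀ D, ¬ step C D

/-- A phase finishes from `C`: there is no infinite sequence of steps starting at `C`. -/
def PhaseTerminates (step : Config → Config → Prop) (C : Config) : Prop :=
  ¬ ∃ f : ℕ → Config, f 0 = C ∧ ∀ n, step (f n) (f (n + 1))

/-- `MultiReach step τs C E`: starting from `C`, running each phase (one per temperature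
in `τs`) to a terminal configuration can produce `E`. -/
inductive MultiReach (step : ℕ → Config → Config → Prop) : List ℕ → Config → Config → Prop
  | nil {C : Config} : MultiReach step [] C C
  | cons {τ : ℕ} {τs : List ℕ} {C D E : Config} :
      Relation.ReflTransGen (step τ) C D → Terminal (step τ) D →
      MultiReach step τs D E → MultiReach step (τ :: τs) C E

/-- Every phase finishes, no matter which additions and removals are chosen. -/
inductive AllFinish (step : ℕ → Config → Config → Prop) : List ℕ → Config → Prop
  | nil {C : Config} : AllFinish step [] C
  | cons {τ : ℕ} {τs : List ℕ} {C : Config} :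
      PhaseTerminates (step τ) C →
      (∀ D, Relation.ReflTransGen (step τ) C D → Terminal (step τ) D → AllFinish step τs D) →
      AllFinish step (τ :: τs) C

/-- The tile system with seed `s` and temperature sequence `τs` uniquely produces the
configuration (supertile) `R`: all phases always finish, and every terminal configuration
produced after the last phase equals `R`. -/
def UniquelyProduces (step : ℕ → Config → Config → Prop) (s : Tile) (τs : List ℕ)
    (R : Config) : Prop :=
  AllFinish step τs (seedConfig s) ∧
  MultiReach step τs (seedConfig s) R ∧
  ∀ C, MultiReach step τs (seedConfig s) C → C = R

/-- Translation of a set of positions by `d`. -/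
def translateSet (d : ℤ × ℤ) (S : Set (ℤ × ℤ)) : Set (ℤ × ℤ) := (fun p => p + d) '' S

/-- The system uniquely assembles the shape `Υ` (up to translation). -/
def UniquelyAssembles (step : ℕ → Config → Config → Prop) (s : Tile) (τs : List ℕ)
    (Υ : Set (ℤ × ℤ)) : Prop :=
  ∃ R : Config, UniquelyProduces step s τs R ∧ ∃ d : ℤ × ℤ, shape R = translateSet d Υ

/-- The `n × n` square shape `{0,…,n−1} × {0,…,n−1}`. -/
def square (n : ℕ) : Set (ℤ × ℤ) :=
  {p : ℤ × ℤ | 0 ≤ p.1 ∧ p.1 < (n : ℤ) ∧ 0 ≤ p.2 ∧ p.2 < (n : ℤ)}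

/-- The `a × b` rectangle shape `{0,…,b−1} × {0,…,a−1}` (`b` columns, `a` rows). -/
def rect (a b : ℕ) : Set (ℤ × ℤ) :=
  {p : ℤ × ℤ | 0 ≤ p.1 ∧ p.1 < (b : ℤ) ∧ 0 ≤ p.2 ∧ p.2 < (a : ℤ)}
/-! ## The multiple tile model -/

/-- The configuration consisting of the single tile `t` at the origin. -/
def singleTile (t : Tile) : Config := fun p => if p = (0, 0) then some t else none

/-- Translation of a configuration by `d`. -/
def translateConfig (d : ℤ × ℤ) (C : Config) : Config := fun p => C (p - d)

/-- Union of two configurations (with `A` taking priority; intended for disjoint shapes). -/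
def unionConfig (A B : Config) : Config := fun p =>
  match A p with
  | some t => some t
  | none => B p

/-- Bonding strength between the tile of `A` at `p` and the tile of `B` at (neighboring) `q`. -/
def crossBond (G : Glue → ℕ) (A B : Config) (p q : ℤ × ℤ) : ℕ :=
  match A p, B q with
  | some t, some u => edgeBond G t u p q
  | _, _ => 0

/-- Total bonding strength over all abutting edges between configurations `A` and `B`,
where `F` is (the shape of) `A` as a finset. -/
def interStrength (G : Glue → ℕ) (A B : Config) (F : Finset (ℤ × ℤ)) : ℕ :=
  ∑ p ∈ F, ((neighbors p).map (fun q => crossBond G A B p q)).sum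

/-- The set `W(T, τ)` of addable supertiles of the multiple tile model: the smallest set
containing each tile of `T` (as a single-tile supertile, anywhere in the plane) and closed
under combining two non-overlapping members whose total abutting bonding strength is
at least `τ`. -/
inductive Addable (T : Finset Tile) (G : Glue → ℕ) (τ : ℕ) : Config → Prop
  | single {t : Tile} : t ∈ T → Addable T G τ (singleTile t)
  | translate {A : Config} (d : ℤ × ℤ) : Addable T G τ A → Addable T G τ (translateConfig d A)
  | combine {A B : Config} (F : Finset (ℤ × ℤ)) :
      Addable T G τ A → Addable T G τ B →
      (∀ p, A p = none ∨ B p = none) →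
      (↑F : Set (ℤ × ℤ)) = shape A →
      τ ≤ interStrength G A B F →
      Addable T G τ (unionConfig A B)

/-- One step of assembly in the multiple tile model at temperature `τ`: either an addable
supertile attaches to the growing seed supertile at a non-overlapping position with total
bonding strength at least `τ`, or the portion of the supertile on the non-seed side of a
cut of strength `< τ` is removed. -/
inductive MStep (T : Finset Tile) (G : Glue → ℕ) (τ : ℕ) : Config → Config → Prop
  | attach {C A : Config} (F : Finset (ℤ × ℤ)) :
      Addable T G τ A →
      (∀ p, C p = none ∨ A p = none) →
      (↑F : Set (ℤ × ℤ)) = shape A →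
      τ ≤ interStrength G A C F →
      MStep T G τ C (unionConfig C A)
  | detach {C : Config} (Q : Finset (ℤ × ℤ)) :
      Q.Nonempty → ((0, 0) : ℤ × ℤ) ∉ Q → (↑Q : Set (ℤ × ℤ)) ⊆ shape C →
      cutStrength G C Q < τ →
      MStep T G τ C (fun q => if q ∈ Q then none else C q)

/-- The temperature sequence `τ^b` of length `4m − 1`:
`τ_{4i} = s₄`; `τ_{4i+1} = s₄` if `b i = 0` and `s₇` if `b i = 1`; `τ_{4i+2} = s₃`;
`τ_{4i+3} = s₆`. -/
def tempSeq4 (s₃ s₄ s₆ s₇ : ℕ) (b : ℕ → Bool) (m : ℕ) : List ℕ :=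
  (List.range (4 * m - 1)).map fun j =>
    if j % 4 = 0 then s₄
    else if j % 4 = 1 then (if b (j / 4) then s₇ else s₄)
    else if j % 4 = 2 then s₃
    else s₆

namespace TA
def tab : List (ℕ × ℕ × ℕ × ℕ × ℕ × ℕ) := [
  (1, 3, 13, 0, 9, 112), (1, 3, 13, 0, 9, 0), (1, 4, 17, 117, 13, 0), (1, 2, 9, 109, 5, 0),
  (1, 5, 21, 121, 17, 0), (1, 1, 5, 105, 1, 0), (2, 2, 10, 110, 6, 109), (1, 6, 25, 125, 21, 0),
  (2, 5, 22, 122, 0, 121), (1, 0, 1, 101, 0, 0), (2, 1, 6, 106, 2, 105), (3, 2, 11, 111, 7, 110),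
  (1, 7, 29, 129, 25, 0), (2, 6, 26, 126, 22, 125), (3, 5, 23, 123, 19, 122), (2, 0, 2, 102, 0, 101),
  (3, 1, 7, 107, 3, 106), (4, 2, 0, 0, 8, 111), (1, 8, 33, 133, 29, 132), (2, 7, 0, 130, 26, 129),
  (3, 6, 27, 127, 23, 126), (4, 5, 24, 0, 20, 123), (3, 0, 3, 103, 0, 102), (4, 1, 8, 0, 4, 107),
  (1, 9, 37, 137, 33, 0), (3, 7, 31, 131, 27, 130), (4, 6, 28, 0, 24, 127), (4, 0, 4, 0, 0, 103),
  (1, 10, 41, 141, 37, 0), (4, 7, 32, 0, 28, 131), (2, 10, 0, 142, 0, 141), (3, 10, 0, 0, 39, 142),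
  (0, 3, 216, 112, 0, 115), (0, 4, 0, 0, 216, 119), (1, 11, 0, 145, 41, 0), (2, 11, 0, 146, 0, 145),
  (3, 11, 0, 147, 0, 146), (4, 11, 0, 0, 44, 147), (4, 10, 44, 0, 40, 0), (4, 9, 40, 0, 36, 0),
  (4, 8, 36, 132, 0, 135), (1, 11, 0, 345, 0, 0), (2, 11, 0, 346, 0, 345), (3, 11, 0, 347, 0, 346),
  (4, 11, 0, 0, 244, 347), (4, 10, 244, 0, 240, 0), (4, 9, 240, 0, 236, 139), (4, 8, 236, 132, 32, 135),
  (3, 8, 35, 135, 31, 134), (3, 9, 39, 139, 35, 138), (2, 8, 34, 134, 0, 133), (2, 9, 0, 138, 34, 137),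
  (4, 4, 20, 0, 16, 0), (4, 3, 16, 0, 0, 115), (3, 3, 15, 115, 11, 114), (3, 4, 19, 119, 15, 118),
  (2, 3, 14, 114, 10, 0), (2, 4, 0, 118, 14, 117)]
def half : List (ℤ × ℕ × ℕ × ℕ) := [
  (0, 0, 2, 7), (0, 1, 2, 7), (0, 2, 4, 7), (0, 2, 57, 2), (0, 3, 0, 7), (0, 3, 1, 7),
  (0, 3, 6, 7), (0, 4, 7, 7), (0, 4, 8, 7), (0, 5, 3, 7), (0, 5, 10, 7), (0, 6, 11, 7),
  (0, 6, 56, 2), (0, 7, 12, 7), (0, 7, 13, 7), (0, 8, 13, 7), (0, 8, 14, 7), (0, 9, 5, 7),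
  (0, 9, 15, 7), (0, 10, 6, 7), (0, 10, 16, 7), (0, 11, 17, 7), (0, 11, 54, 2), (0, 12, 18, 7),
  (0, 12, 19, 7), (0, 13, 19, 7), (0, 13, 20, 7), (0, 14, 20, 7), (0, 14, 21, 7), (0, 15, 10, 7),
  (0, 15, 22, 7), (0, 16, 11, 7), (0, 16, 23, 7), (0, 18, 24, 7), (0, 18, 50, 2), (0, 19, 25, 7),
  (0, 20, 25, 7), (0, 20, 26, 7), (0, 21, 26, 7), (0, 22, 16, 7), (0, 22, 27, 7), (0, 23, 17, 7),
  (0, 24, 28, 7), (0, 24, 51, 2), (0, 25, 29, 7), (0, 25, 48, 2), (0, 26, 29, 7), (0, 27, 23, 7),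
  (0, 28, 30, 7), (0, 28, 34, 4), (0, 29, 47, 2), (0, 30, 31, 7), (0, 32, 0, 7), (0, 32, 33, 7),
  (0, 34, 35, 7), (0, 35, 36, 7), (0, 36, 37, 7), (0, 38, 37, 7), (0, 39, 38, 7), (1, 40, 18, 2),
  (0, 40, 39, 7), (0, 41, 42, 7), (0, 42, 43, 7), (0, 43, 44, 7), (0, 45, 44, 7), (0, 46, 45, 7),
  (1, 47, 18, 2), (0, 47, 46, 7), (0, 48, 40, 2), (0, 48, 47, 2), (0, 48, 49, 2), (0, 49, 31, 2),
  (0, 49, 46, 2), (0, 50, 48, 2), (0, 50, 51, 2), (0, 51, 49, 2), (0, 52, 21, 3), (0, 53, 52, 7),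
  (1, 54, 32, 2), (0, 54, 53, 2), (0, 54, 55, 2), (0, 55, 14, 2), (1, 55, 33, 2), (0, 56, 54, 2),
  (0, 56, 57, 2), (0, 57, 55, 2)]
def l2 : List ℕ := [10, 11, 14, 15, 19, 31, 32, 34, 35, 39, 114, 115, 117, 118, 119, 132, 133, 134, 135, 137, 138, 139]
def lv (g : ℕ) : ℕ := if g = 0 then 0 else if g ∈ l2 then 2 else if g = 20 then 3 else if g = 41 then 4 else 7
def par : List ℕ := [0, 0, 0, 0, 2, 3, 3, 4, 4, 5, 5, 6, 7, 7, 8, 9, 10, 11, 12, 12, 13, 14, 15, 16, 18, 19, 20, 22, 24, 25, 28, 30]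

def row (k : ℕ) : ℕ × ℕ × ℕ × ℕ × ℕ × ℕ := tab.getD k (0, 0, 0, 0, 0, 0)
def hx (k : ℕ) : ℕ := (row k).1
def hy (k : ℕ) : ℕ := (row k).2.1
def tl (k : ℕ) : Tile := ⟨(row k).2.2.1, (row k).2.2.2.1, (row k).2.2.2.2.1, (row k).2.2.2.2.2⟩
def EL : List (ℤ × ℕ × ℕ × ℕ) := half ++ half.map (fun e => (-e.1, e.2.2.1, e.2.1, e.2.2.2))

def gl (sv : ℕ → ℕ) (g : ℕ) : ℕ := sv (lv g)

def ps (x : ℤ × ℕ) : ℤ × ℤ := (4 * x.1 + hx x.2 - 1, hy x.2 - 3)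

theorem chkV0 : (List.range 58).all (fun k => (List.range 58).all (fun k' =>
    decide ((row k).2.2.1 ≠ (row k').2.2.2.2.1) || decide (lv (row k).2.2.1 = 0) ||
    decide (((0 : ℤ), k, k', lv (row k).2.2.1) ∈ half ∧ hx k' = hx k ∧ hy k' = hy k + 1))) = true := by
  decide +kernel

theorem chkV {k k' : ℕ} (hk : k < 58) (hk' : k' < 58) (h1 : (tl k).north = (tl k').south)
    (h2 : lv (tl k).north ≠ 0) :
    ((0 : ℤ), k, k', lv (tl k).north) ∈ half ∧ hx k' = hx k ∧ hy k' = hy k + 1 := by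
  have h := List.all_eq_true.1 (List.all_eq_true.1 chkV0 k (List.mem_range.2 hk)) k' (List.mem_range.2 hk')
  simp only [Bool.or_eq_true, decide_eq_true_eq] at h
  rcases h with (h | h) | h
  · exact absurd h1 h
  · exact absurd h h2
  · exact h

theorem chkH0 : (List.range 58).all (fun k => (List.range 58).all (fun k' =>
    decide ((row k).2.2.2.1 ≠ (row k').2.2.2.2.2) || decide (lv (row k).2.2.2.1 = 0) ||
    (decide (((0 : ℤ), k, k', lv (row k).2.2.2.1) ∈ half ∧ hx k' = hx k + 1 ∧ hy k' = hy k) ||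
    decide (((1 : ℤ), k, k', lv (row k).2.2.2.1) ∈ half ∧ hx k' + 4 = hx k + 1 ∧ hy k' = hy k)))) = true := by
  decide +kernel

theorem chkH {k k' : ℕ} (hk : k < 58) (hk' : k' < 58) (h1 : (tl k).east = (tl k').west)
    (h2 : lv (tl k).east ≠ 0) :
    (((0 : ℤ), k, k', lv (tl k).east) ∈ half ∧ hx k' = hx k + 1 ∧ hy k' = hy k) ∨
    (((1 : ℤ), k, k', lv (tl k).east) ∈ half ∧ hx k' + 4 = hx k + 1 ∧ hy k' = hy k) := by
  have h := List.all_eq_true.1 (List.all_eq_true.1 chkH0 k (List.mem_range.2 hk)) k' (List.mem_range.2 hk')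
  simp only [Bool.or_eq_true, decide_eq_true_eq] at h
  rcases h with (h | h) | h
  · exact absurd h1 h
  · exact absurd h h2
  · exact h

theorem chkHalf : ∀ e ∈ half, e.2.1 < 58 ∧ e.2.2.1 < 58 ∧ 
    (((tl e.2.1).north = (tl e.2.2.1).south ∧ lv (tl e.2.1).north = e.2.2.2 ∧
      (hx e.2.2.1 : ℤ) + 4 * e.1 = hx e.2.1 ∧ hy e.2.2.1 = hy e.2.1 + 1) ∨
     ((tl e.2.1).east = (tl e.2.2.1).west ∧ lv (tl e.2.1).east = e.2.2.2 ∧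
      (hx e.2.2.1 : ℤ) + 4 * e.1 = hx e.2.1 + 1 ∧ hy e.2.2.1 = hy e.2.1)) := by
  decide +kernel

theorem bond_symm (G : Glue → ℕ) (x y : Glue) : bond G x y = bond G y x := by
  unfold bond
  by_cases h : x = y
  · rw [h]
  · rw [if_neg h, if_neg (Ne.symm h)]

theorem edgeBond_symm (G : Glue → ℕ) (t u : Tile) (p q : ℤ × ℤ) :
    edgeBond G t u p q = edgeBond G u t q p := by
  obtain ⟨a, b⟩ := p
  obtain ⟨c, d⟩ := q
  unfold edgeBond
  simp only [Prod.mk.injEq]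
  split_ifs <;> first | rfl | exact bond_symm _ _ _ | (exfalso; omega)

theorem edgeBond_shift (G : Glue → ℕ) (t u : Tile) (p q d : ℤ × ℤ) :
    edgeBond G t u (d + p) (d + q) = edgeBond G t u p q := by
  obtain ⟨a, b⟩ := p
  obtain ⟨c, e⟩ := q
  obtain ⟨f, g⟩ := d
  unfold edgeBond bond
  simp only [Prod.mk.injEq, Prod.mk_add_mk]
  congr 1
  · apply propext; constructor <;> intro <;> omega
  congr 1
  · apply propext; constructor <;> intro <;> omega
  congr 1
  · apply propext; constructor <;> intro <;> omega
  congr 1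
  · apply propext; constructor <;> intro <;> omega

theorem EL_symm {δ : ℤ} {k k' l : ℕ} (h : (δ, k, k', l) ∈ EL) : (-δ, k', k, l) ∈ EL := by
  unfold EL at *
  rw [List.mem_append, List.mem_map] at *
  rcases h with h | ⟨e, he, h⟩
  · exact Or.inr ⟨_, h, rfl⟩
  · simp only [Prod.mk.injEq] at h
    obtain ⟨h1, h2, h3, h4⟩ := h
    left
    subst h1 h2 h3 h4
    simpa using he


theorem edge_ne_half {sv : ℕ → ℕ} (h0 : sv 0 = 0) {k k' : ℕ} (hk : k < 58) (hk' : k' < 58) {p q : ℤ × ℤ}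
    (hpq : q = (p.1, p.2 + 1) ∨ q = (p.1 + 1, p.2))
    (h : edgeBond (gl sv) (tl k) (tl k') p q ≠ 0) :
    ∃ δ l, (δ, k, k', l) ∈ half ∧ edgeBond (gl sv) (tl k) (tl k') p q = sv l ∧
      q.1 - hx k' = p.1 - hx k + 4 * δ ∧ q.2 - hy k' = p.2 - hy k := by
  obtain ⟨a, b⟩ := p
  obtain ⟨c, d⟩ := q
  rcases hpq with hpq | hpq
  · have e : edgeBond (gl sv) (tl k) (tl k') (a, b) (c, d) = bond (gl sv) (tl k).north (tl k').south := by
      unfold edgeBond; rw [if_pos hpq]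
    rw [e] at h ⊢
    unfold bond at h ⊢
    split_ifs at h ⊢ with h1
    have h2 : lv (tl k).north ≠ 0 := fun h2 => h (by unfold gl; rw [h2, h0])
    obtain ⟨m, x, y⟩ := chkV hk hk' h1 h2
    simp only [Prod.mk.injEq] at hpq
    refine ⟨0, _, m, rfl, ?_, ?_⟩ <;> simp only [x, y] <;> push_cast <;> omega
    exact absurd rfl h
  · have e : edgeBond (gl sv) (tl k) (tl k') (a, b) (c, d) = bond (gl sv) (tl k).east (tl k').west := by
      unfold edgeBond; rw [if_neg, if_pos hpq]
      simp only [Prod.mk.injEq] at hpq ⊢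
      omega
    rw [e] at h ⊢
    unfold bond at h ⊢
    split_ifs at h ⊢ with h1
    have h2 : lv (tl k).east ≠ 0 := fun h2 => h (by unfold gl; rw [h2, h0])
    simp only [Prod.mk.injEq] at hpq
    rcases chkH hk hk' h1 h2 with ⟨m, x, y⟩ | ⟨m, x, y⟩
    · refine ⟨0, _, m, rfl, ?_, ?_⟩ <;> dsimp only <;> omega
    · refine ⟨1, _, m, rfl, ?_, ?_⟩ <;> dsimp only <;> omega
    exact absurd rfl h

theorem edge_ne {sv : ℕ → ℕ} (h0 : sv 0 = 0) {k k' : ℕ} (hk : k < 58) (hk' : k' < 58) {p q : ℤ × ℤ}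
    (h : edgeBond (gl sv) (tl k) (tl k') p q ≠ 0) :
    ∃ δ l, (δ, k, k', l) ∈ EL ∧ edgeBond (gl sv) (tl k) (tl k') p q = sv l ∧
      q.1 - hx k' = p.1 - hx k + 4 * δ ∧ q.2 - hy k' = p.2 - hy k := by
  by_cases hpq : q = (p.1, p.2 + 1) ∨ q = (p.1 + 1, p.2)
  · obtain ⟨δ, l, h1, h2⟩ := edge_ne_half h0 hk hk' hpq h
    exact ⟨δ, l, List.mem_append_left _ h1, h2⟩
  · have hqp : p = (q.1, q.2 + 1) ∨ p = (q.1 + 1, q.2) := by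
      by_contra hc
      apply h
      obtain ⟨a, b⟩ := p
      obtain ⟨c, d⟩ := q
      unfold edgeBond
      simp only [Prod.mk.injEq] at *
      push Not at hc hpq
      rw [if_neg, if_neg, if_neg, if_neg] <;> omega
    rw [edgeBond_symm] at h ⊢
    obtain ⟨δ, l, h1, h2, h3, h4⟩ := edge_ne_half h0 hk' hk hqp h
    refine ⟨-δ, l, EL_symm (List.mem_append_left _ h1), h2, ?_, ?_⟩ <;> omega

theorem edge_half {sv : ℕ → ℕ} {δ : ℤ} {k k' l : ℕ} (h : (δ, k, k', l) ∈ half) (j : ℤ) :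
    edgeBond (gl sv) (tl k) (tl k') (ps (j, k)) (ps (j + δ, k')) = sv l := by
  obtain ⟨-, -, h | h⟩ := chkHalf _ h
  · obtain ⟨a, b, c, d⟩ := h
    dsimp only at a b c d
    unfold edgeBond
    rw [if_pos, bond, if_pos a, gl, b]
    simp only [ps, Prod.mk.injEq]
    omega
  · obtain ⟨a, b, c, d⟩ := h
    dsimp only at a b c d
    unfold edgeBond
    rw [if_neg, if_pos, bond, if_pos a, gl, b]
    · simp only [ps, Prod.mk.injEq]
      omega
    · simp only [ps, Prod.mk.injEq]
      omega

theorem edge_EL {sv : ℕ → ℕ} {δ : ℤ} {k k' l : ℕ} (h : (δ, k, k', l) ∈ EL) (j : ℤ) :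
    edgeBond (gl sv) (tl k) (tl k') (ps (j, k)) (ps (j + δ, k')) = sv l := by
  unfold EL at h
  rw [List.mem_append, List.mem_map] at h
  rcases h with h | ⟨e, he, h⟩
  · exact edge_half h j
  · simp only [Prod.mk.injEq] at h
    obtain ⟨h1, h2, h3, h4⟩ := h
    subst h1 h2 h3 h4
    rw [edgeBond_symm]
    have := edge_half (sv := sv) (δ := e.1) (k := e.2.1) (k' := e.2.2.1) (l := e.2.2.2) he (j + -e.1)
    simpa using this
end TA

namespace TA

def wt (sv : ℕ → ℕ) (x y : ℤ × ℕ) : ℕ := edgeBond (gl sv) (tl x.2) (tl y.2) (ps x) (ps y)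

def con (sv : ℕ → ℕ) (S S' : Finset (ℤ × ℕ)) : ℕ := ∑ x ∈ S, ∑ y ∈ S', wt sv x y

def blk (j : ℤ) (U : Finset ℕ) : Finset (ℤ × ℕ) := ({j} : Finset ℤ) ×ˢ U

theorem mem_blk {j : ℤ} {U : Finset ℕ} {x : ℤ × ℕ} : x ∈ blk j U ↔ x.1 = j ∧ x.2 ∈ U := by
  unfold blk
  rw [Finset.mem_product, Finset.mem_singleton]

theorem wt_symm (sv : ℕ → ℕ) (x y : ℤ × ℕ) : wt sv x y = wt sv y x := edgeBond_symm _ _ _ _ _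

theorem con_symm (sv : ℕ → ℕ) (S S' : Finset (ℤ × ℕ)) : con sv S S' = con sv S' S := by
  unfold con
  rw [Finset.sum_comm]
  simp only [wt_symm]

theorem con_mono {sv : ℕ → ℕ} {A A' B B' : Finset (ℤ × ℕ)} (h : A ⊆ A') (h' : B ⊆ B') :
    con sv A B ≤ con sv A' B' := by
  unfold con
  refine le_trans (Finset.sum_le_sum fun x _ => Finset.sum_le_sum_of_subset h') ?_
  exact Finset.sum_le_sum_of_subset h

theorem con_blk_shift (sv : ℕ → ℕ) (j j' c : ℤ) (U U' : Finset ℕ) :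
    con sv (blk (j + c) U) (blk (j' + c) U') = con sv (blk j U) (blk j' U') := by
  unfold con blk
  rw [Finset.sum_product, Finset.sum_product]
  simp only [Finset.sum_singleton, Finset.sum_product]
  refine Finset.sum_congr rfl fun x _ => Finset.sum_congr rfl fun y _ => ?_
  unfold wt
  have e : ∀ (a : ℤ) (k : ℕ), ps (a + c, k) = (4 * c, 0) + ps (a, k) := by
    intro a k
    simp only [ps, Prod.mk_add_mk, Prod.mk.injEq]
    constructor <;> ring
  dsimp only
  rw [e, e, edgeBond_shift]

theorem wt_ne {sv : ℕ → ℕ} (h0 : sv 0 = 0) {x y : ℤ × ℕ} (hx : x.2 < 58) (hy : y.2 < 58)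
    (h : wt sv x y ≠ 0) : ∃ l, (y.1 - x.1, x.2, y.2, l) ∈ EL ∧ wt sv x y = sv l := by
  obtain ⟨δ, l, h1, h2, h3, h4⟩ := edge_ne h0 hx hy h
  refine ⟨l, ?_, h2⟩
  simp only [ps] at h3
  have : y.1 - x.1 = δ := by omega
  rw [this]; exact h1

theorem wt_EL {sv : ℕ → ℕ} {δ : ℤ} {k k' l : ℕ} (h : (δ, k, k', l) ∈ EL) (j : ℤ) :
    wt sv (j, k) (j + δ, k') = sv l := edge_EL h j

def bd (P : ℕ → Bool) (R : ℤ → ℕ → Bool) : List ℕ :=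
  (EL.filter (fun e => P e.2.1 && R e.1 e.2.2.1)).map (fun e => e.2.2.2)

theorem con_list (sv : ℕ → ℕ) (j : ℤ) (U : Finset ℕ) (S : Finset (ℤ × ℕ)) :
    ∀ L : List (ℤ × ℕ × ℕ × ℕ), ∑ x ∈ blk j U, ∑ y ∈ S, (L.map (fun e =>
      if e.1 = y.1 - x.1 ∧ e.2.1 = x.2 ∧ e.2.2.1 = y.2 then sv e.2.2.2 else 0)).sum ≤
      ((L.map (fun e => e.2.2.2)).map sv).sum := by
  intro L
  induction L with
  | nil => simp
  | cons e L ih =>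
    simp only [List.map_cons, List.sum_cons, Finset.sum_add_distrib]
    refine add_le_add ?_ ih
    have key : ∀ x ∈ blk j U, ∀ y ∈ S,
        (if e.1 = y.1 - x.1 ∧ e.2.1 = x.2 ∧ e.2.2.1 = y.2 then sv e.2.2.2 else 0) ≤
        if x = (j, e.2.1) then (if y = (j + e.1, e.2.2.1) then sv e.2.2.2 else 0) else 0 := by
      intro x hx y hy
      rw [mem_blk] at hx
      by_cases hc : e.1 = y.1 - x.1 ∧ e.2.1 = x.2 ∧ e.2.2.1 = y.2
      · rw [if_pos hc, if_pos, if_pos]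
        · obtain ⟨y1, y2⟩ := y
          simp only [Prod.mk.injEq]
          refine ⟨?_, hc.2.2.symm⟩
          have := hc.1
          dsimp only at this
          omega
        · obtain ⟨x1, x2⟩ := x
          simp only [Prod.mk.injEq]
          exact ⟨hx.1, hc.2.1.symm⟩
      · rw [if_neg hc]; exact Nat.zero_le _
    refine le_trans (Finset.sum_le_sum fun x hx => Finset.sum_le_sum fun y hy => key x hx y hy) ?_
    have h2 : ∀ x ∈ blk j U, ∑ y ∈ S, (if x = (j, e.2.1) then (if y = (j + e.1, e.2.2.1) then sv e.2.2.2 else 0) else 0) ≤ if x = (j, e.2.1) then sv e.2.2.2 else 0 := by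
      intro x _
      split_ifs
      · rw [Finset.sum_ite_eq']
        split_ifs <;> simp
      · simp
    refine le_trans (Finset.sum_le_sum h2) ?_
    rw [Finset.sum_ite_eq']
    split_ifs <;> simp

theorem con_le {sv : ℕ → ℕ} (h0 : sv 0 = 0) {j : ℤ} {U : Finset ℕ} {S : Finset (ℤ × ℕ)}
    (hU : ∀ k ∈ U, k < 58) (hS : ∀ x ∈ S, x.2 < 58) (P : ℕ → Bool) (R : ℤ → ℕ → Bool)
    (hP : ∀ k ∈ U, P k = true) (hR : ∀ x ∈ S, R (x.1 - j) x.2 = true) :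
    con sv (blk j U) S ≤ ((bd P R).map sv).sum := by
  refine le_trans ?_ (con_list sv j U S _)
  unfold con
  refine Finset.sum_le_sum fun x hx => Finset.sum_le_sum fun y hy => ?_
  by_cases hw : wt sv x y = 0
  · rw [hw]; exact Nat.zero_le _
  rw [mem_blk] at hx
  obtain ⟨l, h1, h2⟩ := wt_ne h0 (hU _ hx.2) (hS _ hy) hw
  have hm : (y.1 - x.1, x.2, y.2, l) ∈ EL.filter (fun e => P e.2.1 && R e.1 e.2.2.1) := by
    rw [List.mem_filter]
    refine ⟨h1, ?_⟩
    dsimp only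
    rw [hP _ hx.2, hx.1, hR _ hy]
    rfl
  rw [h2]
  refine List.single_le_sum (by simp) _ ?_
  rw [List.mem_map]
  refine ⟨_, hm, ?_⟩
  simp

theorem con_ge (sv : ℕ → ℕ) {V W : Finset (ℤ × ℕ)} (L : List ((ℤ × ℕ) × (ℤ × ℕ))) (hn : L.Nodup)
    (h : ∀ p ∈ L, p.1 ∈ V ∧ p.2 ∈ W) :
    (L.map (fun p => wt sv p.1 p.2)).sum ≤ con sv V W := by
  unfold con
  rw [← Finset.sum_product', ← List.sum_toFinset _ hn]
  refine Finset.sum_le_sum_of_subset ?_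
  intro p hp
  rw [List.mem_toFinset] at hp
  exact Finset.mem_product.2 (h p hp)

/-! representation of configurations -/

def Rep (d : ℤ × ℤ) (S : Finset (ℤ × ℕ)) (C : Config) : Prop :=
  ∀ p t, C p = some t ↔ ∃ x ∈ S, tl x.2 = t ∧ d + ps x = p

def Nice (S : Finset (ℤ × ℕ)) : Prop :=
  (∀ x ∈ S, x.2 < 58) ∧ ∀ x ∈ S, ∀ y ∈ S, ps x = ps y → x = y

theorem Rep.at {d : ℤ × ℤ} {S : Finset (ℤ × ℕ)} {C : Config} (h : Rep d S C) {x : ℤ × ℕ} (hx : x ∈ S) :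
    C (d + ps x) = some (tl x.2) := (h _ _).2 ⟨x, hx, rfl, rfl⟩

theorem Rep.isNone {d : ℤ × ℤ} {S : Finset (ℤ × ℕ)} {C : Config} (h : Rep d S C) {p : ℤ × ℤ} :
    C p = none ↔ ∀ x ∈ S, d + ps x ≠ p := by
  constructor
  · intro hc x hx e
    have := h.at hx
    rw [e, hc] at this
    cases this
  · intro hc
    by_contra hn
    obtain ⟨t, ht⟩ := Option.ne_none_iff_exists'.1 hn
    obtain ⟨x, hx, -, e⟩ := (h _ _).1 ht
    exact hc x hx e

theorem Rep.unique {d : ℤ × ℤ} {S : Finset (ℤ × ℕ)} {C D : Config} (h : Rep d S C) (h' : Rep d S D) :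
    C = D := by
  funext p
  ext t
  rw [h p t, h' p t]

theorem Rep.shift {d : ℤ × ℤ} {j c : ℤ} {U : Finset ℕ} {C : Config} :
    Rep (d + (4 * c, 0)) (blk j U) C ↔ Rep d (blk (j + c) U) C := by
  unfold Rep
  refine forall_congr' fun p => forall_congr' fun t => ?_
  refine iff_congr Iff.rfl ?_
  obtain ⟨d1, d2⟩ := d
  constructor
  · rintro ⟨⟨a, k⟩, hx, h1, h2⟩
    rw [mem_blk] at hx
    refine ⟨(a + c, k), mem_blk.2 ⟨by rw [← hx.1], hx.2⟩, h1, ?_⟩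
    rw [← h2]
    simp only [ps, Prod.mk_add_mk, Prod.mk.injEq]
    constructor <;> ring
  · rintro ⟨⟨a, k⟩, hx, h1, h2⟩
    rw [mem_blk] at hx
    refine ⟨(j, k), mem_blk.2 ⟨rfl, hx.2⟩, h1, ?_⟩
    rw [← h2]
    have := hx.1
    dsimp only at this
    subst this
    simp only [ps, Prod.mk_add_mk, Prod.mk.injEq]
    constructor <;> ring

theorem shape_rep {d : ℤ × ℤ} {S : Finset (ℤ × ℕ)} {C : Config} (h : Rep d S C) {p : ℤ × ℤ} :
    p ∈ shape C ↔ ∃ x ∈ S, d + ps x = p := by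
  unfold shape
  rw [Set.mem_ofPred_eq, Ne, h.isNone]
  push Not
  rfl

theorem nb_nodup (p : ℤ × ℤ) : (neighbors p).Nodup := by
  unfold neighbors
  simp only [List.nodup_cons, List.mem_cons, Prod.mk.injEq, List.not_mem_nil, List.nodup_nil]
  refine ⟨?_, ?_, ?_, ?_, trivial⟩ <;> simp <;> omega

theorem edge_not_nb (G : Glue → ℕ) (t u : Tile) {p q : ℤ × ℤ} (h : q ∉ neighbors p) :
    edgeBond G t u p q = 0 := by
  unfold neighbors at h
  simp only [List.mem_cons, List.not_mem_nil, or_false, not_or] at h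
  unfold edgeBond
  rw [if_neg h.1, if_neg h.2.1, if_neg h.2.2.1, if_neg h.2.2.2]

theorem nb_sum (G : Glue → ℕ) {d : ℤ × ℤ} {S : Finset (ℤ × ℕ)} {C : Config} (h : Rep d S C) (hS : Nice S)
    (t : Tile) (p : ℤ × ℤ) (f : ℤ × ℤ → ℕ) (hf : ∀ q u, C q = some u → f q = edgeBond G t u p q)
    (hf' : ∀ q, C q = none → f q = 0) :
    ((neighbors p).map f).sum = ∑ y ∈ S, edgeBond G t (tl y.2) p (d + ps y) := by
  rw [← List.sum_toFinset _ (nb_nodup p)]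
  have e1 : ∑ y ∈ S, edgeBond G t (tl y.2) p (d + ps y) = ∑ y ∈ S, ∑ q ∈ (neighbors p).toFinset,
      if d + ps y = q then f q else 0 := by
    refine Finset.sum_congr rfl fun y hy => ?_
    rw [Finset.sum_ite_eq]
    split_ifs with hm
    · rw [hf _ _ (h.at hy)]
    · exact edge_not_nb _ _ _ (fun hh => hm (List.mem_toFinset.2 hh))
  rw [e1, Finset.sum_comm]
  refine Finset.sum_congr rfl fun q _ => ?_
  rcases hq : C q with _ | u
  · rw [hf' q hq]
    simp
  · obtain ⟨x, hx, -, e⟩ := (h _ _).1 hq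
    rw [Finset.sum_eq_single x]
    · rw [if_pos e]
    · intro y hy hyx
      rw [if_neg]
      intro e'
      exact hyx (hS.2 y hy x hx (add_left_cancel (e'.trans e.symm)))
    · intro hn; exact absurd hx hn

theorem inter_eq (G : Glue → ℕ) {d d' : ℤ × ℤ} {S S' : Finset (ℤ × ℕ)} {A B : Config} (h : Rep d S A)
    (h' : Rep d' S' B) (hS : Nice S) (hS' : Nice S') {F : Finset (ℤ × ℤ)}
    (hF : (↑F : Set (ℤ × ℤ)) = shape A) :
    interStrength G A B F = ∑ x ∈ S, ∑ y ∈ S', edgeBond G (tl x.2) (tl y.2) (d + ps x) (d' + ps y) := by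
  have e : F = S.image (fun x => d + ps x) := by
    ext p
    rw [← Finset.mem_coe, hF, shape_rep h, Finset.mem_image]
  unfold interStrength
  rw [e, Finset.sum_image]
  · refine Finset.sum_congr rfl fun x hx => ?_
    refine nb_sum G h' hS' _ _ _ ?_ ?_
    · intro q u hq
      simp only [crossBond, h.at hx, hq]
    · intro q hq
      simp only [crossBond, h.at hx, hq]
  · intro x hx y hy hxy
    exact hS.2 x hx y hy (add_left_cancel hxy)

theorem inter_con (sv : ℕ → ℕ) {d : ℤ × ℤ} {S S' : Finset (ℤ × ℕ)} {A B : Config} (h : Rep d S A)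
    (h' : Rep d S' B) (hS : Nice S) (hS' : Nice S') {F : Finset (ℤ × ℤ)}
    (hF : (↑F : Set (ℤ × ℤ)) = shape A) :
    interStrength (gl sv) A B F = con sv S S' := by
  rw [inter_eq _ h h' hS hS' hF]
  unfold con wt
  simp only [edgeBond_shift]

theorem align {sv : ℕ → ℕ} (h0 : sv 0 = 0) {d d' : ℤ × ℤ} {S S' : Finset (ℤ × ℕ)} {A B : Config} (h : Rep d S A)
    (h' : Rep d' S' B) (hS : Nice S) (hS' : Nice S') {F : Finset (ℤ × ℤ)}
    (hF : (↑F : Set (ℤ × ℤ)) = shape A) (hp : 0 < interStrength (gl sv) A B F) :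
    ∃ c : ℤ, d' = d + (4 * c, 0) := by
  rw [inter_eq _ h h' hS hS' hF] at hp
  have : ∃ x ∈ S, ∃ y ∈ S', edgeBond (gl sv) (tl x.2) (tl y.2) (d + ps x) (d' + ps y) ≠ 0 := by
    by_contra hc
    push Not at hc
    rw [Finset.sum_eq_zero fun x hx => Finset.sum_eq_zero fun y hy => hc x hx y hy] at hp
    exact lt_irrefl _ hp
  obtain ⟨x, hx, y, hy, hn⟩ := this
  obtain ⟨δ, l, -, -, h3, h4⟩ := edge_ne h0 (hS.1 x hx) (hS'.1 y hy) hn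
  refine ⟨x.1 + δ - y.1, ?_⟩
  obtain ⟨d1, d2⟩ := d
  obtain ⟨d1', d2'⟩ := d'
  simp only [ps, Prod.mk_add_mk, Prod.mk.injEq] at *
  omega

theorem Rep.union {d : ℤ × ℤ} {S S' : Finset (ℤ × ℕ)} {A B : Config} (h : Rep d S A)
    (h' : Rep d S' B) (hd : ∀ p, A p = none ∨ B p = none) : Rep d (S ∪ S') (unionConfig A B) := by
  intro p t
  have e1 := h p t
  have e2 := h' p t
  simp only [Finset.mem_union, or_and_right, exists_or]
  rw [← e1, ← e2]
  unfold unionConfig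
  rcases hd p with hp | hp
  · rw [hp]; simp
  · rw [hp]
    cases A p <;> simp

theorem pos_disj {d : ℤ × ℤ} {S S' : Finset (ℤ × ℕ)} {A B : Config} (h : Rep d S A)
    (h' : Rep d S' B) : (∀ p, A p = none ∨ B p = none) ↔ ∀ x ∈ S, ∀ y ∈ S', ps x ≠ ps y := by
  constructor
  · intro hd x hx y hy e
    rcases hd (d + ps x) with hp | hp
    · rw [h.at hx] at hp; cases hp
    · rw [e, h'.at hy] at hp; cases hp
  · intro hd p
    by_contra hc
    push Not at hc
    obtain ⟨x, hx, e⟩ := (shape_rep h).1 hc.1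
    obtain ⟨y, hy, e'⟩ := (shape_rep h').1 hc.2
    exact hd x hx y hy (add_left_cancel (e.trans e'.symm))

theorem Nice.union {S S' : Finset (ℤ × ℕ)} (h : Nice S) (h' : Nice S')
    (hd : ∀ x ∈ S, ∀ y ∈ S', ps x ≠ ps y) : Nice (S ∪ S') := by
  constructor
  · intro x hx
    rcases Finset.mem_union.1 hx with hx | hx
    · exact h.1 x hx
    · exact h'.1 x hx
  · intro x hx y hy e
    rcases Finset.mem_union.1 hx with hx | hx <;> rcases Finset.mem_union.1 hy with hy | hy
    · exact h.2 x hx y hy e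
    · exact absurd e (hd x hx y hy)
    · exact absurd e.symm (hd y hy x hx)
    · exact h'.2 x hx y hy e

theorem Nice.sub {S S' : Finset (ℤ × ℕ)} (h : Nice S) (hs : S' ⊆ S) : Nice S' :=
  ⟨fun x hx => h.1 x (hs hx), fun x hx y hy => h.2 x (hs hx) y (hs hy)⟩

theorem Rep.remove {d : ℤ × ℤ} {S V : Finset (ℤ × ℕ)} {C : Config} (h : Rep d S C) (hS : Nice S)
    (hV : V ⊆ S) : Rep d (S \ V) (fun q => if q ∈ V.image (fun x => d + ps x) then none else C q) := by
  intro p t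
  dsimp only
  split_ifs with hp
  · rw [Finset.mem_image] at hp
    obtain ⟨v, hv, e⟩ := hp
    constructor
    · intro hh; cases hh
    · rintro ⟨y, hy, -, e'⟩
      rw [Finset.mem_sdiff] at hy
      have := hS.2 y hy.1 v (hV hv) (add_left_cancel (e'.trans e.symm))
      rw [this] at hy
      exact absurd hv hy.2
  · rw [h p t]
    constructor
    · rintro ⟨y, hy, e1, e2⟩
      refine ⟨y, Finset.mem_sdiff.2 ⟨hy, fun hv => hp (Finset.mem_image.2 ⟨y, hv, e2⟩)⟩, e1, e2⟩
    · rintro ⟨y, hy, e1, e2⟩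
      exact ⟨y, (Finset.mem_sdiff.1 hy).1, e1, e2⟩
theorem cut_con (sv : ℕ → ℕ) {d : ℤ × ℤ} {S V : Finset (ℤ × ℕ)} {C : Config} (h : Rep d S C) (hS : Nice S)
    (hV : V ⊆ S) :
    cutStrength (gl sv) C (V.image (fun x => d + ps x)) = con sv V (S \ V) := by
  unfold cutStrength
  rw [Finset.sum_image]
  · unfold con
    refine Finset.sum_congr rfl fun x hx => ?_
    unfold outStrength
    have hx' := h.at (hV hx)
    have e : (((neighbors (d + ps x)).filter (fun q => q ∉ V.image (fun x => d + ps x))).map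
        (fun q => bondAt (gl sv) C (d + ps x) q)).sum = ((neighbors (d + ps x)).map (fun q =>
          if q ∈ V.image (fun x => d + ps x) then 0 else bondAt (gl sv) C (d + ps x) q)).sum := by
      generalize neighbors (d + ps x) = L
      induction L with
      | nil => rfl
      | cons q L ih =>
        by_cases hq : q ∈ V.image (fun x => d + ps x)
        · rw [List.filter_cons_of_neg (by simpa using hq), ih]
          simp only [List.map_cons, List.sum_cons, if_pos hq, zero_add]
        · rw [List.filter_cons_of_pos (by simpa using hq)]
          simp only [List.map_cons, List.sum_cons, if_neg hq, ih]
    rw [e]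
    have hR : Rep d (S \ V) (fun q => if q ∈ V.image (fun x => d + ps x) then none else C q) := 
      h.remove hS hV
    rw [nb_sum (gl sv) hR (hS.sub Finset.sdiff_subset) (tl x.2) (d + ps x)]
    · simp only [edgeBond_shift]
      rfl
    · intro q u hq
      split_ifs at hq ⊢ with hq'
      simp only [bondAt, hx', hq]
    · intro q hq
      split_ifs at hq ⊢ with hq'
      · rfl
      · simp only [bondAt, hx', hq]
  · intro x hx y hy hxy
    exact hS.2 x (hV hx) y (hV hy) (add_left_cancel hxy)

end TA

namespace TA

structure Hyp (sv : ℕ → ℕ) : Prop where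
  z0 : sv 0 = 0
  p2 : 0 < sv 2
  a23 : sv 2 < sv 3
  a34 : sv 3 < sv 4
  a46 : sv 4 < sv 6
  a67 : sv 6 < sv 7
  b1 : sv 7 ≤ 3 * sv 2
  b2 : 2 * sv 3 < sv 6
  b3 : sv 6 ≤ sv 2 + sv 4
  b4 : sv 4 ≤ 2 * sv 2
  b5 : 2 * sv 4 < sv 7

structure AInv (sv : ℕ → ℕ) (τ : ℕ) (U : Finset ℕ) : Prop where
  ne : U.Nonempty
  lt : ∀ k ∈ U, k < 58
  inj : ∀ k ∈ U, ∀ k' ∈ U, hx k = hx k' → hy k = hy k' → k = k'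
  stb : ∀ V ⊆ U, V.Nonempty → V ≠ U → τ ≤ con sv (blk 0 V) (blk 0 (U \ V))
  cz : ∀ z ∈ U, 54 ≤ z → U = {z} ∨ 53 ∈ U
  cn1 : 33 ∈ U → U = {33} ∨ 32 ∈ U
  cn : ∀ k ∈ U, k = 32 ∨ k = 33 → (∀ k' ∈ U, k' = 32 ∨ k' = 33) ∨ 0 ∈ U
  ce : sv 4 ≤ τ → ∀ k ∈ U, 41 ≤ k → k < 48 → ∀ k' ∈ U, 41 ≤ k' ∧ k' < 48
  cy : sv 4 ≤ τ → ∀ y ∈ U, 48 ≤ y → y < 52 → U = {y} ∨ 40 ∈ U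
  cb : sv 4 ≤ τ → ∀ k ∈ U, k = 52 ∨ k = 53 → ∀ k' ∈ U, k' = 52 ∨ k' = 53
  cd : sv 6 ≤ τ → ∀ k ∈ U, 34 ≤ k → k < 41 → ∀ k' ∈ U, 34 ≤ k' ∧ k' < 41

def at0 (δ : ℤ) (R : ℕ → Bool) (d : ℤ) (k : ℕ) : Bool := decide (d = δ) && R k

theorem con2_le {sv : ℕ → ℕ} (h0 : sv 0 = 0) {δ : ℤ} {U U' : Finset ℕ}
    (hU : ∀ k ∈ U, k < 58) (hU' : ∀ k ∈ U', k < 58) (P R : ℕ → Bool) (L : List ℕ)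
    (hL : bd P (at0 δ R) = L)
    (hP : ∀ k ∈ U, P k = true) (hR : ∀ k ∈ U', R k = true) :
    con sv (blk 0 U) (blk δ U') ≤ (L.map sv).sum := by
  rw [← hL]
  refine con_le h0 hU (fun x hx => hU' _ (mem_blk.1 hx).2) P _ hP ?_
  intro x hx
  rw [mem_blk] at hx
  unfold at0
  rw [hR _ hx.2, hx.1]
  simp

theorem bd_or {sv : ℕ → ℕ} {L : List ℕ} (h : L = [] ∨ L = [2]) : (L.map sv).sum ≤ sv 2 := by
  rcases h with h | h <;> rw [h] <;> simp

theorem ck_zz : ∀ a : Fin 4, ∀ b : Fin 4, bd (fun k => decide (k = 54 + a.1)) (at0 0 fun k => decide (k = 54 + b.1)) = [] ∨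
    bd (fun k => decide (k = 54 + a.1)) (at0 0 fun k => decide (k = 54 + b.1)) = [2] := by decide +kernel
theorem ck_zo : ∀ a : Fin 4, bd (fun k => decide (k = 54 + a.1)) (at0 0 fun k => decide (k < 54 ∧ k ≠ 53)) = [2] := by decide +kernel
theorem ck_yy : ∀ a : Fin 4, ∀ b : Fin 4, bd (fun k => decide (k = 48 + a.1)) (at0 0 fun k => decide (k = 48 + b.1)) = [] ∨
    bd (fun k => decide (k = 48 + a.1)) (at0 0 fun k => decide (k = 48 + b.1)) = [2] := by decide +kernel
theorem ck_ye : ∀ a : Fin 4, bd (fun k => decide (k = 48 + a.1)) (at0 0 fun k => decide (41 ≤ k ∧ k < 48)) = [] ∨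
    bd (fun k => decide (k = 48 + a.1)) (at0 0 fun k => decide (41 ≤ k ∧ k < 48)) = [2] := by decide +kernel
theorem ck_yd : ∀ a : Fin 4, bd (fun k => decide (k = 48 + a.1)) (at0 0 fun k => decide (34 ≤ k ∧ k < 41)) = [] ∨
    bd (fun k => decide (k = 48 + a.1)) (at0 0 fun k => decide (34 ≤ k ∧ k < 41)) = [2] := by decide +kernel
theorem ck_yo : ∀ a : Fin 4, bd (fun k => decide (k = 48 + a.1)) (at0 0 fun k => decide (¬ (40 ≤ k ∧ k < 52))) = [2] := by decide +kernel
theorem ck_bz : ∀ a : Fin 4, bd (fun k => decide (k = 54 + a.1)) (at0 0 fun k => decide (k = 52 ∨ k = 53)) = [] ∨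
    bd (fun k => decide (k = 54 + a.1)) (at0 0 fun k => decide (k = 52 ∨ k = 53)) = [2] := by decide +kernel
theorem ck_z1 : ∀ a : Fin 4, bd (fun k => decide (k = 54 + a.1)) (at0 1 fun _ => true) = [] ∨
    bd (fun k => decide (k = 54 + a.1)) (at0 1 fun _ => true) = [2] := by decide +kernel

theorem fin4 {z c : ℕ} (h : c ≤ z) (h' : z < c + 4) : ∃ a : Fin 4, z = c + a.1 :=
  ⟨⟨z - c, by omega⟩, by dsimp only; omega⟩

section
variable {sv : ℕ → ℕ} {τ : ℕ} {U U' : Finset ℕ}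

theorem n_cz (H : Hyp sv) (h3 : sv 3 ≤ τ) (hA : AInv sv τ U) (hB : AInv sv τ U')
    (hc : τ ≤ con sv (blk 0 U) (blk 0 U')) : ∀ z ∈ U, 54 ≤ z → 53 ∈ U ∪ U' := by
  intro z hz h54
  by_contra hn
  rw [Finset.mem_union, not_or] at hn
  have hU := (hA.cz z hz h54).resolve_right hn.1
  obtain ⟨a, rfl⟩ := fin4 h54 (hA.lt z hz)
  have a23 := H.a23
  by_cases hz' : ∃ z' ∈ U', 54 ≤ z'
  · obtain ⟨z', hz', h'⟩ := hz'
    have hU' := (hB.cz z' hz' h').resolve_right hn.2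
    obtain ⟨b, rfl⟩ := fin4 h' (hB.lt z' hz')
    have := con2_le H.z0 (δ := 0) hA.lt hB.lt (fun k => decide (k = 54 + a.1)) (fun k => decide (k = 54 + b.1)) _ rfl
      (by rw [hU]; simp) (by rw [hU']; simp)
    have := bd_or (sv := sv) (ck_zz a b)
    omega
  · push Not at hz'
    have := con2_le H.z0 (δ := 0) hA.lt hB.lt (fun k => decide (k = 54 + a.1)) (fun k => decide (k < 54 ∧ k ≠ 53)) _ (ck_zo a)
      (by rw [hU]; simp) (by
        intro k hk
        rw [decide_eq_true_eq]
        exact ⟨hz' k hk, fun h => hn.2 (h ▸ hk)⟩)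
    simp at this
    omega

theorem n_cn1 (H : Hyp sv) (h3 : sv 3 ≤ τ) (hA : AInv sv τ U) (hB : AInv sv τ U')
    (hc : τ ≤ con sv (blk 0 U) (blk 0 U')) : 33 ∈ U → 32 ∈ U ∪ U' := by
  intro hz
  by_contra hn
  rw [Finset.mem_union, not_or] at hn
  have hU := (hA.cn1 hz).resolve_right hn.1
  have a23 := H.a23
  have := con2_le H.z0 (δ := 0) hA.lt hB.lt (fun k => decide (k = 33)) (fun k => decide (k ≠ 32)) [] (by decide +kernel)
    (by rw [hU]; simp) (by
      intro k hk
      rw [decide_eq_true_eq]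
      exact fun h => hn.2 (h ▸ hk))
  simp at this
  omega

theorem n_cn (H : Hyp sv) (h3 : sv 3 ≤ τ) (hA : AInv sv τ U) (hB : AInv sv τ U')
    (hc : τ ≤ con sv (blk 0 U) (blk 0 U')) : ∀ k ∈ U, k = 32 ∨ k = 33 →
    (∀ k' ∈ U ∪ U', k' = 32 ∨ k' = 33) ∨ 0 ∈ U ∪ U' := by
  intro z hz h32
  by_contra hn
  rw [not_or, Finset.mem_union, not_or] at hn
  obtain ⟨hn, hn0, hn1⟩ := hn
  have hU := (hA.cn z hz h32).resolve_right hn0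
  have a23 := H.a23
  by_cases hz' : ∃ z' ∈ U', z' = 32 ∨ z' = 33
  · obtain ⟨z', hz', h'⟩ := hz'
    have hU' := (hB.cn z' hz' h').resolve_right hn1
    apply hn
    intro k hk
    rcases Finset.mem_union.1 hk with hk | hk
    · exact hU k hk
    · exact hU' k hk
  · push Not at hz'
    have := con2_le H.z0 (δ := 0) hA.lt hB.lt (fun k => decide (k = 32 ∨ k = 33)) (fun k => decide (k ≠ 0 ∧ k ≠ 32 ∧ k ≠ 33)) [] (by decide +kernel)
      (by simpa using hU) (by
        intro k hk
        rw [decide_eq_true_eq]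
        exact ⟨fun h => hn1 (h ▸ hk), hz' k hk⟩)
    simp at this
    omega

theorem n_ce (H : Hyp sv) (h4 : sv 4 ≤ τ) (hA : AInv sv τ U) (hB : AInv sv τ U')
    (hd : ∀ k ∈ U, ∀ k' ∈ U', ¬ (hx k = hx k' ∧ hy k = hy k'))
    (hc : τ ≤ con sv (blk 0 U) (blk 0 U')) : ∀ k ∈ U, 41 ≤ k → k < 48 →
    (∀ k' ∈ U ∪ U', 41 ≤ k' ∧ k' < 48) := by
  intro e he he1 he2
  have hU := hA.ce h4 e he he1 he2
  have a23 := H.a23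
  have a34 := H.a34
  by_cases hz' : ∃ z' ∈ U', 41 ≤ z' ∧ z' < 48
  · obtain ⟨z', hz', h'⟩ := hz'
    have hU' := hB.ce h4 z' hz' h'.1 h'.2
    intro k hk
    rcases Finset.mem_union.1 hk with hk | hk
    · exact hU k hk
    · exact hU' k hk
  · exfalso
    push Not at hz'
    by_cases h40 : 40 ∈ U'
    · have h47 : 47 ∉ U := by
        intro h47
        exact hd _ h47 _ h40 (by decide +kernel)
      have := con2_le H.z0 (δ := 0) hA.lt hB.lt (fun k => decide (41 ≤ k ∧ k < 47)) (fun k => decide (¬ (41 ≤ k ∧ k < 48))) [2] (by decide +kernel)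
        (by
          intro k hk
          rw [decide_eq_true_eq]
          have := hU k hk
          have : k ≠ 47 := fun h => h47 (h ▸ hk)
          omega) (by
          intro k hk
          rw [decide_eq_true_eq]
          have := hz' k hk
          omega)
      simp at this
      omega
    by_cases hy : ∃ y ∈ U', 48 ≤ y ∧ y < 52
    · obtain ⟨y, hy, hy1, hy2⟩ := hy
      have hU' := (hB.cy h4 y hy hy1 hy2).resolve_right h40
      obtain ⟨a, rfl⟩ := fin4 hy1 hy2
      rw [con_symm] at hc
      have := con2_le H.z0 (δ := 0) hB.lt hA.lt (fun k => decide (k = 48 + a.1)) (fun k => decide (41 ≤ k ∧ k < 48)) _ rfl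
        (by rw [hU']; simp) (by simpa using hU)
      have := bd_or (sv := sv) (ck_ye a)
      omega
    · push Not at hy
      have := con2_le H.z0 (δ := 0) hA.lt hB.lt (fun k => decide (41 ≤ k ∧ k < 48)) (fun k => decide (¬ (41 ≤ k ∧ k < 52))) [2] (by decide +kernel)
        (by simpa using hU) (by
          intro k hk
          rw [decide_eq_true_eq]
          have := hz' k hk
          have := hy k hk
          omega)
      simp at this
      omega

theorem n_cy (H : Hyp sv) (h4 : sv 4 ≤ τ) (hA : AInv sv τ U) (hB : AInv sv τ U')
    (hc : τ ≤ con sv (blk 0 U) (blk 0 U')) : ∀ y ∈ U, 48 ≤ y → y < 52 → 40 ∈ U ∪ U' := by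
  intro y hy hy1 hy2
  by_contra hn
  rw [Finset.mem_union, not_or] at hn
  have hU := (hA.cy h4 y hy hy1 hy2).resolve_right hn.1
  obtain ⟨a, rfl⟩ := fin4 hy1 hy2
  have a23 := H.a23
  have a34 := H.a34
  by_cases hz' : ∃ z' ∈ U', 48 ≤ z' ∧ z' < 52
  · obtain ⟨z', hz', h1, h2⟩ := hz'
    have hU' := (hB.cy h4 z' hz' h1 h2).resolve_right hn.2
    obtain ⟨b, rfl⟩ := fin4 h1 h2
    have := con2_le H.z0 (δ := 0) hA.lt hB.lt (fun k => decide (k = 48 + a.1)) (fun k => decide (k = 48 + b.1)) _ rfl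
      (by rw [hU]; simp) (by rw [hU']; simp)
    have := bd_or (sv := sv) (ck_yy a b)
    omega
  by_cases he : ∃ z' ∈ U', 41 ≤ z' ∧ z' < 48
  · obtain ⟨z', hz', h1, h2⟩ := he
    have hU' := hB.ce h4 z' hz' h1 h2
    have := con2_le H.z0 (δ := 0) hA.lt hB.lt (fun k => decide (k = 48 + a.1)) (fun k => decide (41 ≤ k ∧ k < 48)) _ rfl
      (by rw [hU]; simp) (by simpa using hU')
    have := bd_or (sv := sv) (ck_ye a)
    omega
  · push Not at hz' he
    have := con2_le H.z0 (δ := 0) hA.lt hB.lt (fun k => decide (k = 48 + a.1)) (fun k => decide (¬ (40 ≤ k ∧ k < 52))) _ (ck_yo a)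
      (by rw [hU]; simp) (by
        intro k hk
        rw [decide_eq_true_eq]
        have := hz' k hk
        have := he k hk
        have : k ≠ 40 := fun h => hn.2 (h ▸ hk)
        omega)
    simp at this
    omega

theorem n_cb (H : Hyp sv) (h4 : sv 4 ≤ τ) (hA : AInv sv τ U) (hB : AInv sv τ U')
    (hc : τ ≤ con sv (blk 0 U) (blk 0 U')) : ∀ k ∈ U, k = 52 ∨ k = 53 →
    (∀ k' ∈ U ∪ U', k' = 52 ∨ k' = 53) := by
  intro e he he1
  have hU := hA.cb h4 e he he1
  have a23 := H.a23
  have a34 := H.a34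
  by_cases hz' : ∃ z' ∈ U', z' = 52 ∨ z' = 53
  · obtain ⟨z', hz', h'⟩ := hz'
    have hU' := hB.cb h4 z' hz' h'
    intro k hk
    rcases Finset.mem_union.1 hk with hk | hk
    · exact hU k hk
    · exact hU' k hk
  · exfalso
    push Not at hz'
    by_cases hy : ∃ y ∈ U', 54 ≤ y
    · obtain ⟨y, hy, hy1⟩ := hy
      have hU' := (hB.cz y hy hy1).resolve_right (fun h => (hz' _ h).2 rfl)
      obtain ⟨a, rfl⟩ := fin4 hy1 (hB.lt y hy)
      rw [con_symm] at hc
      have := con2_le H.z0 (δ := 0) hB.lt hA.lt (fun k => decide (k = 54 + a.1)) (fun k => decide (k = 52 ∨ k = 53)) _ rfl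
        (by rw [hU']; simp) (by simpa using hU)
      have := bd_or (sv := sv) (ck_bz a)
      omega
    · push Not at hy
      have := con2_le H.z0 (δ := 0) hA.lt hB.lt (fun k => decide (k = 52 ∨ k = 53)) (fun k => decide (k < 52)) [3] (by decide +kernel)
        (by simpa using hU) (by
          intro k hk
          rw [decide_eq_true_eq]
          have := hz' k hk
          have := hy k hk
          omega)
      simp at this
      omega

theorem n_cd (H : Hyp sv) (h6 : sv 6 ≤ τ) (hA : AInv sv τ U) (hB : AInv sv τ U')
    (hc : τ ≤ con sv (blk 0 U) (blk 0 U')) : ∀ k ∈ U, 34 ≤ k → k < 41 →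
    (∀ k' ∈ U ∪ U', 34 ≤ k' ∧ k' < 41) := by
  intro e he he1 he2
  have hU := hA.cd h6 e he he1 he2
  have a23 := H.a23
  have a34 := H.a34
  have a46 := H.a46
  by_cases hz' : ∃ z' ∈ U', 34 ≤ z' ∧ z' < 41
  · obtain ⟨z', hz', h'⟩ := hz'
    have hU' := hB.cd h6 z' hz' h'.1 h'.2
    intro k hk
    rcases Finset.mem_union.1 hk with hk | hk
    · exact hU k hk
    · exact hU' k hk
  · exfalso
    push Not at hz'
    by_cases hy : ∃ y ∈ U', 48 ≤ y ∧ y < 52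
    · obtain ⟨y, hy, hy1, hy2⟩ := hy
      have hU' := (hB.cy (by omega) y hy hy1 hy2).resolve_right (fun h => by have := hz' _ h (by norm_num); omega)
      obtain ⟨a, rfl⟩ := fin4 hy1 hy2
      rw [con_symm] at hc
      have := con2_le H.z0 (δ := 0) hB.lt hA.lt (fun k => decide (k = 48 + a.1)) (fun k => decide (34 ≤ k ∧ k < 41)) _ rfl
        (by rw [hU']; simp) (by simpa using hU)
      have := bd_or (sv := sv) (ck_yd a)
      omega
    · push Not at hy
      have := con2_le H.z0 (δ := 0) hA.lt hB.lt (fun k => decide (34 ≤ k ∧ k < 41)) (fun k => decide (¬ (48 ≤ k ∧ k < 52) ∧ ¬ (34 ≤ k ∧ k < 41))) [4] (by decide +kernel)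
        (by simpa using hU) (by
          intro k hk
          rw [decide_eq_true_eq]
          have := hz' k hk
          have := hy k hk
          omega)
      simp at this
      omega

theorem stb_union (hA : AInv sv τ U) (hB : AInv sv τ U')
    (hc : τ ≤ con sv (blk 0 U) (blk 0 U')) :
    ∀ V ⊆ U ∪ U', V.Nonempty → V ≠ U ∪ U' → τ ≤ con sv (blk 0 V) (blk 0 ((U ∪ U') \ V)) := by
  have bm : ∀ {A B : Finset ℕ}, A ⊆ B → blk 0 A ⊆ blk 0 B := by
    intro A B h x hx
    rw [mem_blk] at hx ⊢
    exact ⟨hx.1, h hx.2⟩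
  intro V hV hne hn
  have hp : ∀ W : Finset ℕ, AInv sv τ W → W ⊆ U ∪ U' → (∃ x ∈ W, x ∈ V) → (∃ x ∈ W, x ∉ V) →
      τ ≤ con sv (blk 0 V) (blk 0 ((U ∪ U') \ V)) := by
    rintro W hW hWU ⟨x, hx, hxV⟩ ⟨y, hy, hyV⟩
    refine le_trans (hW.stb (W ∩ V) Finset.inter_subset_left ⟨x, Finset.mem_inter.2 ⟨hx, hxV⟩⟩ ?_) ?_
    · intro h
      rw [← h] at hy
      exact hyV (Finset.mem_inter.1 hy).2
    · refine con_mono (bm Finset.inter_subset_right) (bm ?_)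
      intro z hz
      simp only [Finset.mem_sdiff, Finset.mem_inter, not_and] at hz ⊢
      exact ⟨hWU hz.1, hz.2 hz.1⟩
  by_cases h1 : (∃ x ∈ U, x ∈ V) ∧ (∃ x ∈ U, x ∉ V)
  · exact hp U hA Finset.subset_union_left h1.1 h1.2
  by_cases h2 : (∃ x ∈ U', x ∈ V) ∧ (∃ x ∈ U', x ∉ V)
  · exact hp U' hB Finset.subset_union_right h2.1 h2.2
  obtain ⟨v, hv⟩ := hne
  have hw : ∃ w ∈ U ∪ U', w ∉ V := by
    by_contra hc
    push Not at hc
    exact hn (Finset.Subset.antisymm hV hc)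
  obtain ⟨w, hw, hwV⟩ := hw
  have hq := hV hv
  push Not at h1 h2
  rw [Finset.mem_union] at hq hw
  rcases hq with hq | hq <;> rcases hw with hw | hw
  · exact absurd (h1 ⟨v, hq, hv⟩ w hw) hwV
  · refine le_trans hc (con_mono (bm fun z hz => h1 ⟨v, hq, hv⟩ z hz) (bm fun z hz => ?_))
    rw [Finset.mem_sdiff, Finset.mem_union]
    exact ⟨Or.inr hz, fun hzV => hwV (h2 ⟨z, hz, hzV⟩ w hw)⟩
  · rw [con_symm] at hc
    refine le_trans hc (con_mono (bm fun z hz => h2 ⟨v, hq, hv⟩ z hz) (bm fun z hz => ?_))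
    rw [Finset.mem_sdiff, Finset.mem_union]
    exact ⟨Or.inl hz, fun hzV => hwV (h1 ⟨z, hz, hzV⟩ w hw)⟩
  · exact absurd (h2 ⟨v, hq, hv⟩ w hw) hwV

theorem AInv.union (H : Hyp sv) (h3 : sv 3 ≤ τ) (hA : AInv sv τ U) (hB : AInv sv τ U')
    (hd : ∀ k ∈ U, ∀ k' ∈ U', ¬ (hx k = hx k' ∧ hy k = hy k'))
    (hc : τ ≤ con sv (blk 0 U) (blk 0 U')) : AInv sv τ (U ∪ U') := by
  have hc' := hc
  rw [con_symm] at hc'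
  have hd' : ∀ k ∈ U', ∀ k' ∈ U, ¬ (hx k = hx k' ∧ hy k = hy k') :=
    fun k hk k' hk' h => hd k' hk' k hk ⟨h.1.symm, h.2.symm⟩
  refine ⟨?_, ?_, ?_, stb_union hA hB hc, ?_, ?_, ?_, ?_, ?_, ?_, ?_⟩
  · obtain ⟨x, hx⟩ := hA.ne
    exact ⟨x, Finset.mem_union_left _ hx⟩
  · intro k hk
    rcases Finset.mem_union.1 hk with hk | hk
    · exact hA.lt k hk
    · exact hB.lt k hk
  · intro k hk k' hk' e1 e2
    rcases Finset.mem_union.1 hk with hk | hk <;> rcases Finset.mem_union.1 hk' with hk' | hk'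
    · exact hA.inj k hk k' hk' e1 e2
    · exact absurd ⟨e1, e2⟩ (hd k hk k' hk')
    · exact absurd ⟨e1, e2⟩ (hd' k hk k' hk')
    · exact hB.inj k hk k' hk' e1 e2
  · intro k hk h
    right
    rcases Finset.mem_union.1 hk with hk | hk
    · exact n_cz H h3 hA hB hc k hk h
    · rw [Finset.union_comm]; exact n_cz H h3 hB hA hc' k hk h
  · intro hk
    right
    rcases Finset.mem_union.1 hk with hk | hk
    · exact n_cn1 H h3 hA hB hc hk
    · rw [Finset.union_comm]; exact n_cn1 H h3 hB hA hc' hk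
  · intro k hk
    rcases Finset.mem_union.1 hk with hk | hk
    · exact n_cn H h3 hA hB hc k hk
    · rw [Finset.union_comm]; exact n_cn H h3 hB hA hc' k hk
  · intro h4 k hk
    rcases Finset.mem_union.1 hk with hk | hk
    · exact n_ce H h4 hA hB hd hc k hk
    · rw [Finset.union_comm]; exact n_ce H h4 hB hA hd' hc' k hk
  · intro h4 k hk h h'
    right
    rcases Finset.mem_union.1 hk with hk | hk
    · exact n_cy H h4 hA hB hc k hk h h'
    · rw [Finset.union_comm]; exact n_cy H h4 hB hA hc' k hk h h'
  · intro h4 k hk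
    rcases Finset.mem_union.1 hk with hk | hk
    · exact n_cb H h4 hA hB hc k hk
    · rw [Finset.union_comm]; exact n_cb H h4 hB hA hc' k hk
  · intro h4 k hk
    rcases Finset.mem_union.1 hk with hk | hk
    · exact n_cd H h4 hA hB hc k hk
    · rw [Finset.union_comm]; exact n_cd H h4 hB hA hc' k hk

theorem AInv.single {k : ℕ} (hk : k < 58) : AInv sv τ {k} := by
  refine ⟨⟨k, by simp⟩, ?_, ?_, ?_, ?_, ?_, ?_, ?_, ?_, ?_, ?_⟩
  · simpa using hk
  · simp
  · intro V hV hn hne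
    exact absurd ((Finset.subset_singleton_iff.1 hV).resolve_left hn.ne_empty) hne
  · intro z hz _
    left
    rw [Finset.mem_singleton.1 hz]
  · intro hz
    left
    rw [Finset.mem_singleton.1 hz]
  · intro z hz h
    left
    intro k' hk'
    rw [Finset.mem_singleton] at hz hk'
    omega
  · intro _ z hz h h' k' hk'
    rw [Finset.mem_singleton] at hz hk'
    omega
  · intro _ z hz _ _
    left
    rw [Finset.mem_singleton.1 hz]
  · intro _ z hz h k' hk'
    rw [Finset.mem_singleton] at hz hk'
    omega
  · intro _ z hz h h' k' hk'
    rw [Finset.mem_singleton] at hz hk'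
    omega

theorem ps_5332 (j : ℤ) : ps (j, 53) = ps (j + 1, 32) := by
  have h : hx 53 = 4 ∧ hx 32 = 0 ∧ hy 53 = hy 32 := by decide +kernel
  simp only [ps, h.1, h.2.1, h.2.2, Prod.mk.injEq]
  push_cast
  exact ⟨by ring, trivial⟩

theorem ps_5233 (j : ℤ) : ps (j, 52) = ps (j + 1, 33) := by
  have h : hx 52 = 4 ∧ hx 33 = 0 ∧ hy 52 = hy 33 := by decide +kernel
  simp only [ps, h.1, h.2.1, h.2.2, Prod.mk.injEq]
  push_cast
  exact ⟨by ring, trivial⟩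

theorem inter1 (H : Hyp sv) (hA : AInv sv τ U) (hB : AInv sv τ U')
    (hd : ∀ x ∈ blk 0 U, ∀ y ∈ blk 1 U', ps x ≠ ps y) :
    con sv (blk 0 U) (blk 1 U') ≤ sv 2 := by
  have h4047 : 40 ∉ U ∨ 47 ∉ U := by
    by_contra hc
    push Not at hc
    have := hA.inj 40 hc.1 47 hc.2 (by decide +kernel) (by decide +kernel)
    omega
  have nm : ∀ {n k : ℕ} {W : Finset ℕ}, n ∉ W → k ∈ W → k ≠ n := fun hn hk h => hn (h ▸ hk)
  by_cases hz : ∃ z ∈ U, 54 ≤ z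
  · obtain ⟨z, hz, h54⟩ := hz
    rcases hA.cz z hz h54 with hU | h53
    · obtain ⟨a, rfl⟩ := fin4 h54 (hA.lt z hz)
      have := con2_le H.z0 (δ := 1) hA.lt hB.lt (fun k => decide (k = 54 + a.1)) (fun k => true) _ rfl
        (by rw [hU]; simp) (by simp)
      exact le_trans this (bd_or (ck_z1 a))
    · have h32 : 32 ∉ U' := by
        intro h32
        refine hd (0, 53) (mem_blk.2 ⟨rfl, h53⟩) (1, 32) (mem_blk.2 ⟨rfl, h32⟩) (ps_5332 0)
      by_cases h33 : 33 ∈ U'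
      · have hU' := (hB.cn1 h33).resolve_right h32
        have := con2_le H.z0 (δ := 1) hA.lt hB.lt (fun k => true) (fun k => decide (k = 33)) [2] (by decide +kernel)
          (by simp) (by rw [hU']; simp)
        simpa using this
      · rcases h4047 with h | h
        · have := con2_le H.z0 (δ := 1) hA.lt hB.lt (fun k => decide (k ≠ 40)) (fun k => decide (k ≠ 32 ∧ k ≠ 33)) [2] (by decide +kernel)
            (fun k hk => decide_eq_true (nm h hk)) (fun k hk => decide_eq_true ⟨nm h32 hk, nm h33 hk⟩)
          simpa using this
        · have := con2_le H.z0 (δ := 1) hA.lt hB.lt (fun k => decide (k ≠ 47)) (fun k => decide (k ≠ 32 ∧ k ≠ 33)) [2] (by decide +kernel)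
            (fun k hk => decide_eq_true (nm h hk)) (fun k hk => decide_eq_true ⟨nm h32 hk, nm h33 hk⟩)
          simpa using this
  · push Not at hz
    rcases h4047 with h | h
    · have := con2_le H.z0 (δ := 1) hA.lt hB.lt (fun k => decide (k ≠ 40 ∧ k < 54)) (fun k => true) [2] (by decide +kernel)
        (fun k hk => decide_eq_true ⟨nm h hk, hz k hk⟩) (by simp)
      simpa using this
    · have := con2_le H.z0 (δ := 1) hA.lt hB.lt (fun k => decide (k ≠ 47 ∧ k < 54)) (fun k => true) [2] (by decide +kernel)
        (fun k hk => decide_eq_true ⟨nm h hk, hz k hk⟩) (by simp)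
      simpa using this

theorem EL_delta : ∀ e ∈ EL, e.1 = 0 ∨ e.1 = 1 ∨ e.1 = -1 := by decide +kernel

theorem inter_far (h0 : sv 0 = 0) {j : ℤ} {S : Finset (ℤ × ℕ)} (hU : ∀ k ∈ U, k < 58) (hS : ∀ x ∈ S, x.2 < 58)
    (h : ∀ x ∈ S, x.1 ≠ j ∧ x.1 ≠ j + 1 ∧ x.1 ≠ j - 1) : con sv (blk j U) S = 0 := by
  unfold con
  refine Finset.sum_eq_zero fun x hx => Finset.sum_eq_zero fun y hy => ?_
  by_contra hn
  rw [mem_blk] at hx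
  obtain ⟨l, h1, -⟩ := wt_ne h0 (hU _ hx.2) (hS _ hy) hn
  have := EL_delta _ h1
  have := h y hy
  have := hx.1
  dsimp only at *
  omega

theorem ps_blk0 {k k' : ℕ} {j : ℤ} : ps (j, k) = ps (j, k') ↔ hx k = hx k' ∧ hy k = hy k' := by
  simp only [ps, Prod.mk.injEq]
  omega

theorem AInv.nice (h : AInv sv τ U) (j : ℤ) : Nice (blk j U) := by
  refine ⟨fun x hx => h.lt _ (mem_blk.1 hx).2, ?_⟩
  rintro ⟨a, k⟩ hx ⟨a', k'⟩ hy e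
  rw [mem_blk] at hx hy
  obtain ⟨e1, h1⟩ := hx
  obtain ⟨e2, h2⟩ := hy
  dsimp only at *
  subst e1 e2
  obtain ⟨ea, eb⟩ := ps_blk0.1 e
  rw [h.inj k h1 k' h2 ea eb]

theorem union_blk {j : ℤ} : blk j U ∪ blk j U' = blk j (U ∪ U') := by
  ext x
  simp only [Finset.mem_union, mem_blk]
  tauto

def TS : Finset Tile := (Finset.range 58).image tl

theorem addable_inv (H : Hyp sv) (h3 : sv 3 ≤ τ) {A : Config} (h : Addable TS (gl sv) τ A) :
    ∃ d U, Rep d (blk 0 U) A ∧ AInv sv τ U := by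
  have p3 : 0 < sv 3 := lt_trans H.p2 H.a23
  induction h with
  | @single t ht =>
    rw [TS, Finset.mem_image] at ht
    obtain ⟨k, hk, rfl⟩ := ht
    rw [Finset.mem_range] at hk
    refine ⟨-ps (0, k), {k}, ?_, AInv.single hk⟩
    intro p t
    unfold singleTile
    constructor
    · intro h
      split_ifs at h with hp
      refine ⟨(0, k), mem_blk.2 ⟨rfl, by simp⟩, by simpa using h, ?_⟩
      rw [hp, neg_add_cancel]; rfl
    · rintro ⟨⟨a, k'⟩, hx, h1, h2⟩
      rw [mem_blk] at hx
      obtain ⟨ha, hk'⟩ := hx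
      dsimp only at *
      rw [Finset.mem_singleton] at hk'
      subst ha hk'
      rw [if_pos, h1]
      rw [← h2, neg_add_cancel]; rfl
  | @translate A d hA ih =>
    obtain ⟨d', U, hR, hI⟩ := ih
    refine ⟨d' + d, U, ?_, hI⟩
    intro p t
    unfold translateConfig
    rw [hR]
    refine exists_congr fun x => and_congr_right fun _ => and_congr_right fun _ => ?_
    constructor
    · intro h; rw [add_right_comm, h, sub_add_cancel]
    · intro h; rw [← h, add_right_comm, add_sub_cancel_right]
  | @combine A B F hA hB hd hF hi ihA ihB =>
    obtain ⟨d, U, hR, hI⟩ := ihA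
    obtain ⟨d', U', hR', hI'⟩ := ihB
    obtain ⟨c, rfl⟩ := align H.z0 hR hR' (hI.nice 0) (hI'.nice 0) hF (by omega)
    rw [Rep.shift, zero_add] at hR'
    rw [inter_con sv hR hR' (hI.nice 0) (hI'.nice c) hF] at hi
    have hpd := (pos_disj hR hR').1 hd
    have a23 := H.a23
    have hc : c = 0 := by
      by_contra hc
      by_cases h1 : c = 1
      · subst h1
        have := inter1 H hI hI' hpd
        omega
      by_cases h2 : c = -1
      · subst h2
        have e := con_blk_shift sv 0 1 (-1) U' U
        simp only [zero_add] at e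
        rw [show (1 : ℤ) + -1 = 0 by norm_num, con_symm] at e
        have := inter1 H hI' hI (by
          rintro ⟨a, k⟩ hx ⟨a', k'⟩ hy e
          rw [mem_blk] at hx hy
          obtain ⟨h1, h2⟩ := hx
          obtain ⟨h3, h4⟩ := hy
          dsimp only at *
          subst h1 h3
          refine hpd (0, k') (mem_blk.2 ⟨rfl, h4⟩) (-1, k) (mem_blk.2 ⟨rfl, h2⟩) ?_
          simp only [ps, Prod.mk.injEq] at *
          omega)
        omega
      · have := inter_far (sv := sv) H.z0 (j := 0) (S := blk c U') hI.lt (hI'.nice c).1 (by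
          intro x hx
          rw [mem_blk] at hx
          omega)
        omega
    subst hc
    refine ⟨d, U ∪ U', ?_, AInv.union H h3 hI hI' ?_ hi⟩
    · rw [← union_blk]
      exact hR.union hR' hd
    · intro k hk k' hk' e
      exact hpd (0, k) (mem_blk.2 ⟨rfl, hk⟩) (0, k') (mem_blk.2 ⟨rfl, hk'⟩) (ps_blk0.2 e)
end
end TA

namespace TA

def Stable (sv : ℕ → ℕ) (τ : ℕ) (S : Finset (ℤ × ℕ)) : Prop :=
  ∀ V ⊆ S, V.Nonempty → ((0 : ℤ), 1) ∉ V → τ ≤ con sv V (S \ V)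

theorem ps_seed : ps (0, 1) = (0, 0) := by decide +kernel

section
variable {sv : ℕ → ℕ} {τ : ℕ}

theorem step_cases (H : Hyp sv) (h3 : sv 3 ≤ τ) {S : Finset (ℤ × ℕ)} {C D : Config} (hR : Rep 0 S C)
    (hS : Nice S) (h : MStep TS (gl sv) τ C D) :
    (∃ j U, AInv sv τ U ∧ (∀ x ∈ S, ∀ y ∈ blk j U, ps x ≠ ps y) ∧ τ ≤ con sv (blk j U) S ∧
      Rep 0 (S ∪ blk j U) D) ∨
    (∃ V ⊆ S, V.Nonempty ∧ ((0 : ℤ), 1) ∉ V ∧ con sv V (S \ V) < τ ∧ Rep 0 (S \ V) D) := by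
  have p3 : 0 < sv 3 := lt_trans H.p2 H.a23
  cases h with
  | @attach A F hA hd hF hi =>
    left
    obtain ⟨d, U, hRA, hI⟩ := addable_inv H h3 hA
    obtain ⟨c, hc⟩ := align H.z0 hRA hR (hI.nice 0) hS hF (by omega)
    have hd0 : d = 0 + (4 * (-c), 0) := by
      obtain ⟨d1, d2⟩ := d
      have := congrArg Prod.fst hc
      have := congrArg Prod.snd hc
      simp only [Prod.mk_add_mk, Prod.fst_zero, Prod.snd_zero] at *
      simp only [zero_add, Prod.mk.injEq]
      omega
    rw [hd0, Rep.shift] at hRA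
    rw [inter_con sv hRA hR (hI.nice _) hS hF] at hi
    exact ⟨0 + -c, U, hI, (pos_disj hR hRA).1 hd, hi, hR.union hRA hd⟩
  | detach Q hne h0 hQ hcut =>
    right
    have hQV : Q = (S.filter (fun x => (0 : ℤ × ℤ) + ps x ∈ Q)).image (fun x => (0 : ℤ × ℤ) + ps x) := by
      ext p
      rw [Finset.mem_image]
      constructor
      · intro hp
        obtain ⟨x, hx, e⟩ := (shape_rep hR).1 (hQ hp)
        exact ⟨x, Finset.mem_filter.2 ⟨hx, e ▸ hp⟩, e⟩
      · rintro ⟨x, hx, e⟩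
        rw [← e]
        exact (Finset.mem_filter.1 hx).2
    refine ⟨S.filter (fun x => (0 : ℤ × ℤ) + ps x ∈ Q), Finset.filter_subset _ _, ?_, ?_, ?_, ?_⟩
    · obtain ⟨p, hp⟩ := hne
      rw [hQV, Finset.mem_image] at hp
      obtain ⟨x, hx, -⟩ := hp
      exact ⟨x, hx⟩
    · intro hm
      apply h0
      have := (Finset.mem_filter.1 hm).2
      rwa [ps_seed, zero_add] at this
    · rw [← cut_con sv hR hS (Finset.filter_subset _ _), ← hQV]
      exact hcut
    · have := hR.remove hS (Finset.filter_subset (fun x => (0 : ℤ × ℤ) + ps x ∈ Q) S)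
      rwa [← hQV] at this

theorem Stable.attach {S : Finset (ℤ × ℕ)} {j : ℤ} {U : Finset ℕ} (hS : Stable sv τ S) (hU : AInv sv τ U)
    (hc : τ ≤ con sv (blk j U) S) (hd : ∀ x ∈ S, ∀ y ∈ blk j U, ps x ≠ ps y) : Stable sv τ (S ∪ blk j U) := by
  intro V hV hne h0
  by_cases hVS : (V ∩ S).Nonempty
  · refine le_trans (hS (V ∩ S) Finset.inter_subset_right hVS (fun h => h0 (Finset.mem_inter.1 h).1)) ?_
    refine con_mono Finset.inter_subset_left ?_
    intro x hx
    simp only [Finset.mem_sdiff, Finset.mem_inter, Finset.mem_union] at *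
    tauto
  · have hVS' : ∀ x ∈ V, x ∉ S := fun x hx hs => hVS ⟨x, Finset.mem_inter.2 ⟨hx, hs⟩⟩
    have hVU : ∀ x ∈ V, x ∈ blk j U := fun x hx => (Finset.mem_union.1 (hV hx)).resolve_left (hVS' x hx)
    have hVe : V = blk j (V.image Prod.snd) := by
      ext ⟨a, k⟩
      rw [mem_blk, Finset.mem_image]
      constructor
      · intro hx
        exact ⟨(mem_blk.1 (hVU _ hx)).1, _, hx, rfl⟩
      · rintro ⟨h1, ⟨a', k'⟩, hx, h2⟩
        have := (mem_blk.1 (hVU _ hx)).1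
        dsimp only at *
        subst h1 h2 this
        exact hx
    by_cases hVV : V.image Prod.snd = U
    · rw [hVV] at hVe
      rw [hVe]
      refine le_trans hc (con_mono (Finset.Subset.refl _) ?_)
      intro x hx
      rw [Finset.mem_sdiff, Finset.mem_union]
      refine ⟨Or.inl hx, fun hm => ?_⟩
      exact hd x hx x hm rfl
    · have := hU.stb (V.image Prod.snd) (by
        intro k hk
        obtain ⟨x, hx, rfl⟩ := Finset.mem_image.1 hk
        exact (mem_blk.1 (hVU x hx)).2) (hne.image _) hVV
      rw [← con_blk_shift sv 0 0 j, zero_add, ← hVe] at this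
      refine le_trans this (con_mono (Finset.Subset.refl _) ?_)
      intro x hx
      rw [mem_blk, Finset.mem_sdiff] at hx
      rw [Finset.mem_sdiff, Finset.mem_union]
      refine ⟨Or.inr (mem_blk.2 ⟨hx.1, hx.2.1⟩), fun hm => hx.2.2 (Finset.mem_image.2 ⟨x, hm, rfl⟩)⟩

theorem Stable.layer {S W R : Finset (ℤ × ℕ)} (hS : Stable sv τ S) (hR : ∀ x, x ∈ R ↔ x ∈ S ∨ x ∈ W)
    (hW : ∀ V ⊆ W, V.Nonempty → (∀ x ∈ V, x ∉ S) → ((0 : ℤ), 1) ∉ V → τ ≤ con sv V (R \ V)) : Stable sv τ R := by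
  intro V hV hne h0
  by_cases hVS : (V ∩ S).Nonempty
  · refine le_trans (hS (V ∩ S) Finset.inter_subset_right hVS (fun h => h0 (Finset.mem_inter.1 h).1)) ?_
    refine con_mono Finset.inter_subset_left ?_
    intro x hx
    simp only [Finset.mem_sdiff, Finset.mem_inter, hR] at *
    tauto
  · have hVS' : ∀ x ∈ V, x ∉ S := fun x hx hs => hVS ⟨x, Finset.mem_inter.2 ⟨hx, hs⟩⟩
    exact hW V (fun x hx => ((hR x).1 (hV hx)).resolve_left (hVS' x hx)) hne hVS' h0

/-! phases -/

def PhOK (sv : ℕ → ℕ) (τ : ℕ) (S R : Finset (ℤ × ℕ)) : Prop :=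
  ∀ C, Rep 0 S C → PhaseTerminates (MStep TS (gl sv) τ) C ∧
    (∃ D, Relation.ReflTransGen (MStep TS (gl sv) τ) C D ∧ Terminal (MStep TS (gl sv) τ) D) ∧
    ∀ D, Relation.ReflTransGen (MStep TS (gl sv) τ) C D → Terminal (MStep TS (gl sv) τ) D → Rep 0 R D

def CanStep (sv : ℕ → ℕ) (τ : ℕ) (S : Finset (ℤ × ℕ)) : Prop :=
  ∀ C, Rep 0 S C → ∃ D, MStep TS (gl sv) τ C D

theorem phase (H : Hyp sv) (h3 : sv 3 ≤ τ) (J : Finset (ℤ × ℕ) → Prop) (μ : Finset (ℤ × ℕ) → ℕ)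
    (R : Finset (ℤ × ℕ)) (hN : ∀ S, J S → Nice S)
    (hatt : ∀ S j U, J S → AInv sv τ U → (∀ x ∈ S, ∀ y ∈ blk j U, ps x ≠ ps y) →
      τ ≤ con sv (blk j U) S → J (S ∪ blk j U) ∧ μ (S ∪ blk j U) < μ S)
    (hdet : ∀ S V, J S → V ⊆ S → V.Nonempty → ((0 : ℤ), 1) ∉ V → con sv V (S \ V) < τ →
      J (S \ V) ∧ μ (S \ V) < μ S)
    (hprog : ∀ S, J S → S ≠ R → CanStep sv τ S) {S0 : Finset (ℤ × ℕ)} (hJ0 : J S0) : PhOK sv τ S0 R := by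
  intro C0 hC0
  have hstep : ∀ S C D, J S → Rep 0 S C → MStep TS (gl sv) τ C D → ∃ S', J S' ∧ Rep 0 S' D ∧ μ S' < μ S := by
    intro S C D hJ hR hs
    rcases step_cases H h3 hR (hN S hJ) hs with ⟨j, U, h1, h2, h3, h4⟩ | ⟨V, h1, h2, h3, h4, h5⟩
    · obtain ⟨a, b⟩ := hatt S j U hJ h1 h2 h3
      exact ⟨_, a, h4, b⟩
    · obtain ⟨a, b⟩ := hdet S V hJ h1 h2 h3 h4
      exact ⟨_, a, h5, b⟩
  refine ⟨?_, ?_, ?_⟩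
  · rintro ⟨f, hf0, hf⟩
    have key : ∀ n, ∃ S, J S ∧ Rep 0 S (f n) ∧ μ S + n ≤ μ S0 := by
      intro n
      induction n with
      | zero => exact ⟨S0, hJ0, hf0 ▸ hC0, le_refl _⟩
      | succ n ih =>
        obtain ⟨S, h1, h2, h3⟩ := ih
        obtain ⟨S', h4, h5, h6⟩ := hstep S _ _ h1 h2 (hf n)
        exact ⟨S', h4, h5, by omega⟩
    obtain ⟨S, -, -, h⟩ := key (μ S0 + 1)
    omega
  · have key : ∀ n S C, μ S ≤ n → J S → Rep 0 S C →
        ∃ D, Relation.ReflTransGen (MStep TS (gl sv) τ) C D ∧ Terminal (MStep TS (gl sv) τ) D := by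
      intro n
      induction n with
      | zero =>
        intro S C hn hJ hR
        refine ⟨C, Relation.ReflTransGen.refl, fun D hs => ?_⟩
        obtain ⟨S', -, -, h⟩ := hstep S C D hJ hR hs
        omega
      | succ n ih =>
        intro S C hn hJ hR
        by_cases ht : Terminal (MStep TS (gl sv) τ) C
        · exact ⟨C, Relation.ReflTransGen.refl, ht⟩
        · unfold Terminal at ht
          push Not at ht
          obtain ⟨D, hs⟩ := ht
          obtain ⟨S', h1, h2, h⟩ := hstep S C D hJ hR hs
          obtain ⟨E, h4, h5⟩ := ih S' D (by omega) h1 h2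
          exact ⟨E, Relation.ReflTransGen.head hs h4, h5⟩
    exact key _ S0 C0 (le_refl _) hJ0 hC0
  · intro D hD hT
    have key : ∃ S, J S ∧ Rep 0 S D := by
      clear hT
      induction hD with
      | refl => exact ⟨S0, hJ0, hC0⟩
      | tail _ hs ih =>
        obtain ⟨S, h1, h2⟩ := ih
        obtain ⟨S', h3, h4, -⟩ := hstep S _ _ h1 h2 hs
        exact ⟨S', h3, h4⟩
    obtain ⟨S, h1, h2⟩ := key
    by_cases hSR : S = R
    · rw [← hSR]; exact h2
    · obtain ⟨E, hE⟩ := hprog S h1 hSR D h2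
      exact absurd hE (hT E)

theorem run (f : ℕ → ℕ) (st : ℕ → Finset (ℤ × ℕ)) : ∀ n a : ℕ, (∀ i < n, PhOK sv (f (a + i)) (st (a + i)) (st (a + i + 1))) →
    ∀ C, Rep 0 (st a) C → AllFinish (MStep TS (gl sv)) ((List.range' a n).map f) C ∧
      (∃ E, MultiReach (MStep TS (gl sv)) ((List.range' a n).map f) C E) ∧
      ∀ E, MultiReach (MStep TS (gl sv)) ((List.range' a n).map f) C E → Rep 0 (st (a + n)) E := by
  intro n
  induction n with
  | zero =>
    intro a _ C hC
    refine ⟨AllFinish.nil, ⟨C, MultiReach.nil⟩, ?_⟩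
    intro E hE
    simp only [List.range'_zero, List.map_nil] at hE
    cases hE
    exact hC
  | succ n ih =>
    intro a hP C hC
    rw [List.range'_succ, List.map_cons]
    obtain ⟨h1, ⟨D, h2, h3⟩, h4⟩ := hP 0 (Nat.succ_pos _) C hC
    simp only [Nat.add_zero] at h1 h2 h3 h4
    have ih' := ih (a + 1) (fun i hi => by
      have := hP (i + 1) (by omega)
      rwa [show a + (i + 1) = a + 1 + i by omega] at this)
    rw [show a + 1 + n = a + (n + 1) by omega] at ih'
    refine ⟨AllFinish.cons h1 fun D hD hT => (ih' D (h4 D hD hT)).1, ?_, ?_⟩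
    · obtain ⟨E, hE⟩ := (ih' D (h4 D h2 h3)).2.1
      exact ⟨E, MultiReach.cons h2 h3 hE⟩
    · intro E hE
      cases hE with
      | @cons _ _ _ D' _ hr ht hm => exact (ih' D' (h4 D' hr ht)).2.2 E hm

/-! progress -/

theorem can_detach {S V : Finset (ℤ × ℕ)} (hS : Nice S) (hV : V ⊆ S) (hne : V.Nonempty)
    (h0 : ∀ x ∈ V, ps x ≠ (0, 0)) (hc : con sv V (S \ V) < τ) : CanStep sv τ S := by
  intro C hR
  refine ⟨_, MStep.detach (V.image (fun x => (0 : ℤ × ℤ) + ps x)) (hne.image _) ?_ ?_ ?_⟩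
  · rw [Finset.mem_image]
    rintro ⟨x, hx, e⟩
    rw [zero_add] at e
    exact h0 x hx e
  · intro p hp
    rw [Finset.mem_coe, Finset.mem_image] at hp
    obtain ⟨x, hx, e⟩ := hp
    exact (shape_rep hR).2 ⟨x, hV hx, e⟩
  · rw [cut_con sv hR hS hV]
    exact hc

def chOK : List ℕ → Bool
  | [] => true
  | [k] => decide (k < 58)
  | k :: k' :: L => decide (k < 58 ∧ ((0 : ℤ), k, k', 7) ∈ EL ∧ ∀ x ∈ k' :: L, ¬ (hx k = hx x ∧ hy k = hy x)) && chOK (k' :: L)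

theorem blk_single_rep {j : ℤ} {k : ℕ} (hk : k < 58) : ∃ A, Addable TS (gl sv) τ A ∧ Rep 0 (blk j {k}) A := by
  refine ⟨translateConfig (ps (j, k)) (singleTile (tl k)), Addable.translate _ (Addable.single ?_), ?_⟩
  · exact Finset.mem_image.2 ⟨k, Finset.mem_range.2 hk, rfl⟩
  · intro p t
    unfold translateConfig singleTile
    constructor
    · intro h
      split_ifs at h with hp
      refine ⟨(j, k), mem_blk.2 ⟨rfl, by simp⟩, by simpa using h, ?_⟩
      have hp' : p - ps (j, k) = 0 := hp
      rw [zero_add]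
      exact (sub_eq_zero.1 hp').symm
    · rintro ⟨⟨a, k'⟩, hx, h1, h2⟩
      rw [mem_blk] at hx
      obtain ⟨ha, hk'⟩ := hx
      dsimp only at *
      rw [Finset.mem_singleton] at hk'
      subst ha hk'
      rw [if_pos, h1]
      rw [← h2, zero_add, sub_self]; rfl

theorem fin_shape {S : Finset (ℤ × ℕ)} {C : Config} (h : Rep 0 S C) :
    (↑(S.image (fun x => (0 : ℤ × ℤ) + ps x)) : Set (ℤ × ℤ)) = shape C := by
  ext p
  rw [shape_rep h, Finset.mem_coe, Finset.mem_image]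

theorem chain_rep (h7 : τ ≤ sv 7) (j : ℤ) : ∀ L : List ℕ, L ≠ [] → chOK L = true →
    ∃ A, Addable TS (gl sv) τ A ∧ Rep 0 (blk j L.toFinset) A ∧ Nice (blk j L.toFinset) := by
  have sn : ∀ k, k < 58 → Nice (blk j {k}) := fun k hk => (AInv.single (sv := sv) (τ := τ) hk).nice j
  intro L
  induction L with
  | nil => intro h; exact absurd rfl h
  | cons k L ih =>
    intro _ hL
    cases L with
    | nil =>
      have hk : k < 58 := by simpa [chOK] using hL
      obtain ⟨A, h1, h2⟩ := blk_single_rep (sv := sv) (τ := τ) (j := j) hk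
      exact ⟨A, h1, by simpa using h2, by simpa using sn k hk⟩
    | cons k' L =>
      unfold chOK at hL
      rw [Bool.and_eq_true, decide_eq_true_eq] at hL
      obtain ⟨⟨hk, he, hx⟩, hL⟩ := hL
      obtain ⟨A, h1, h2, h3⟩ := ih (by simp) hL
      obtain ⟨B, h4, h5⟩ := blk_single_rep (sv := sv) (τ := τ) (j := j) hk
      have e : blk j (k :: k' :: L).toFinset = blk j {k} ∪ blk j (k' :: L).toFinset := by
        rw [union_blk, List.toFinset_cons, Finset.insert_eq]
      have hd : ∀ x ∈ blk j {k}, ∀ y ∈ blk j (k' :: L).toFinset, ps x ≠ ps y := by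
        rintro ⟨a, b⟩ h ⟨c, d⟩ h' e9
        rw [mem_blk] at h h'
        obtain ⟨h, hh⟩ := h
        obtain ⟨h', hh'⟩ := h'
        rw [Finset.mem_singleton] at hh
        rw [List.mem_toFinset] at hh'
        dsimp only at *
        subst h hh h'
        exact hx _ hh' (ps_blk0.1 e9)
      rw [e]
      have hd' := (pos_disj h5 h2).2 hd
      refine ⟨unionConfig B A, Addable.combine _ h4 h1 hd' (fin_shape h5) ?_, h5.union h2 hd', (sn k hk).union h3 hd⟩
      rw [inter_con sv h5 h2 (sn k hk) h3 (fin_shape h5)]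
      have := con_ge sv (V := blk j {k}) (W := blk j (k' :: L).toFinset) [((j, k), (j, k'))] (by simp) (by
        simp [mem_blk])
      have e2 := wt_EL (sv := sv) he j
      simp only [add_zero] at e2
      simp only [List.map_cons, List.map_nil, List.sum_cons, List.sum_nil, e2] at this
      omega

theorem can_attach (h7 : τ ≤ sv 7) {S : Finset (ℤ × ℕ)} (hS : Nice S) (j : ℤ) (L : List ℕ) (hL : L ≠ [])
    (hok : chOK L = true) (hd : ∀ x ∈ S, ∀ k ∈ L, ps x ≠ ps (j, k))
    (hc : τ ≤ con sv (blk j L.toFinset) S) : CanStep sv τ S := by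
  intro C hR
  obtain ⟨A, h1, h2, h3⟩ := chain_rep h7 j L hL hok
  refine ⟨_, MStep.attach _ h1 ((pos_disj hR h2).2 ?_) (fin_shape h2) ?_⟩
  · rintro x hx ⟨a, b⟩ hy
    rw [mem_blk, List.mem_toFinset] at hy
    obtain ⟨h, hy⟩ := hy
    dsimp only at *
    subst h
    exact hd x hx b hy
  · rw [inter_con sv h2 hR h3 hS (fin_shape h2)]
    exact hc
end
end TA

namespace TA

def inS (j : ℤ) (k : ℕ) : Prop := (2 ≤ k ∧ k < 32) ∨ (j = 0 ∧ k = 1) ∨ (0 < j ∧ (k = 0 ∨ k = 32 ∨ k = 33))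

def full (c : ℤ → ℕ) (j : ℤ) (k : ℕ) : Prop :=
  inS j k ∨ (48 ≤ k ∧ k < 52) ∨ (54 ≤ k ∧ k < 58) ∨ (34 + 7 * c j ≤ k ∧ k < 41 + 7 * c j)

open Classical in
noncomputable def stt (c : ℤ → ℕ) (i : ℤ) (Q : ℕ → Prop) : Finset (ℤ × ℕ) :=
  ((Finset.Ico 0 i ×ˢ Finset.range 58).filter (fun x => full c x.1 x.2)) ∪ blk i ((Finset.range 58).filter Q)

theorem mem_stt {c : ℤ → ℕ} (hc : ∀ j, c j ≤ 1) {i : ℤ} {Q : ℕ → Prop} {j : ℤ} {k : ℕ} :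
    (j, k) ∈ stt c i Q ↔ (0 ≤ j ∧ j < i ∧ full c j k) ∨ (j = i ∧ k < 58 ∧ Q k) := by
  unfold stt
  simp only [Finset.mem_union, Finset.mem_filter, Finset.mem_product, Finset.mem_Ico, Finset.mem_range, mem_blk]
  have : full c j k → k < 58 := by
    unfold full inS
    have := hc j
    omega
  tauto

def rr (D : ℤ) (R : ℕ → Bool) (δ : ℤ) (k : ℕ) : Bool := decide (δ ≤ D) && (decide (δ ≠ D) || R k)

theorem ckDE : ∀ a : Fin 7, hx (34 + a.1) = hx (34 + a.1 + 7) ∧ hy (34 + a.1) = hy (34 + a.1 + 7) := by decide +kernel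

theorem psDE {j : ℤ} {k : ℕ} (h : 34 ≤ k) (h' : k < 41) : ps (j, k) = ps (j, k + 7) := by
  have := ckDE ⟨k - 34, by omega⟩
  rw [show 34 + (⟨k - 34, by omega⟩ : Fin 7).1 = k by dsimp only; omega] at this
  exact ps_blk0.2 this

theorem ps01 {j : ℤ} : ps (j, 0) = ps (j, 1) := ps_blk0.2 (by decide +kernel)

def Disj (S : Finset (ℤ × ℕ)) (j : ℤ) (U : Finset ℕ) : Prop := ∀ x ∈ S, ∀ y ∈ blk j U, ps x ≠ ps y

section
variable {sv : ℕ → ℕ} {τ : ℕ} {U : Finset ℕ} {S : Finset (ℤ × ℕ)} {c : ℤ → ℕ} {i j : ℤ}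

theorem Disj.not (h : Disj S j U) {x : ℤ × ℕ} {k : ℕ} (hx : x ∈ S) (e : ps x = ps (j, k)) : k ∉ U :=
  fun hk => h x hx (j, k) (mem_blk.2 ⟨rfl, hk⟩) e

theorem con_rr (h0 : sv 0 = 0) (hU : ∀ k ∈ U, k < 58) (hS : ∀ x ∈ S, x.2 < 58) (D : ℤ) (P R : ℕ → Bool) (L : List ℕ)
    (hL : bd P (rr D R) = L) (hP : ∀ k ∈ U, P k = true) (hle : ∀ a k, (a, k) ∈ S → a ≤ j + D)
    (hR : ∀ k, (j + D, k) ∈ S → R k = true) : con sv (blk j U) S ≤ (L.map sv).sum := by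
  rw [← hL]
  refine con_le h0 hU hS P _ hP ?_
  rintro ⟨a, k⟩ hx
  unfold rr
  have h1 := hle a k hx
  dsimp only
  rw [decide_eq_true (show a - j ≤ D by omega), Bool.true_and]
  by_cases h : a - j = D
  · rw [hR k (by rw [← h]; simpa using hx)]
    simp
  · simp [h]

/-- blocks of the `n` cells next to block zero -/
theorem n_block0 (h0 : sv 0 = 0) (hτ : 0 < τ) (hA : AInv sv τ U) (hS : ∀ x ∈ S, x.2 < 58) (hseed : ((0 : ℤ), 1) ∈ S)
    (hneg : ∀ a k, (a, k) ∈ S → 0 ≤ a) (hz : ∀ k, ((0 : ℤ), k) ∈ S → k ≠ 0 ∧ k ≠ 32 ∧ k ≠ 33)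
    (hd : Disj S 0 U) (hc : τ ≤ con sv (blk 0 U) S) : ∀ k ∈ U, k ≠ 0 ∧ k ≠ 1 ∧ k ≠ 32 ∧ k ≠ 33 := by
  have n0 : 0 ∉ U := hd.not hseed ps01.symm
  have n1 : 1 ∉ U := hd.not hseed rfl
  intro k hk
  have a0 : k ≠ 0 := fun h => n0 (h ▸ hk)
  have a1 : k ≠ 1 := fun h => n1 (h ▸ hk)
  by_contra hn
  have hU := (hA.cn k hk (by omega)).resolve_right n0
  have := con_le (sv := sv) h0 (j := 0) hA.lt hS (fun k => decide (k = 32 ∨ k = 33))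
    (fun d k => decide (0 ≤ d) && (decide (d ≠ 0) || decide (k ≠ 0 ∧ k ≠ 32 ∧ k ≠ 33))) (by simpa using hU) (by
      rintro ⟨a, k⟩ hx
      have := hneg a k hx
      by_cases ha : a = 0
      · subst ha
        simpa using hz k hx
      · simp [this, ha])
  have e : bd (fun k => decide (k = 32 ∨ k = 33))
    (fun d k => decide (0 ≤ d) && (decide (d ≠ 0) || decide (k ≠ 0 ∧ k ≠ 32 ∧ k ≠ 33))) = [] := by decide +kernel
  rw [e] at this
  simp at this
  omega

theorem low_block (hcc : ∀ j, c j ≤ 1) (hA : AInv sv τ U) (hlo : stt c i (inS i) ⊆ S) (hj : 0 ≤ j) (hji : j < i)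
    (hn : j = 0 → ∀ k ∈ U, k ≠ 0 ∧ k ≠ 1 ∧ k ≠ 32 ∧ k ≠ 33) (hd : Disj S j U) : False := by
  obtain ⟨k, hk⟩ := hA.ne
  have h58 := hA.lt k hk
  have key : ∀ (a : ℤ) (k' : ℕ), (0 ≤ a ∧ a < i ∧ full c a k') ∨ (a = i ∧ k' < 58 ∧ inS i k') → ps (a, k') = ps (j, k) → False :=
    fun a k' h e => hd.not (hlo ((mem_stt hcc).2 h)) e hk
  have hcj := hcc j
  have hn' : j = 0 → k ≠ 0 ∧ k ≠ 1 ∧ k ≠ 32 ∧ k ≠ 33 := fun h => hn h k hk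
  by_cases h1 : k = 1
  · subst h1
    exact key j 0 (Or.inl ⟨hj, hji, by unfold full inS; omega⟩) ps01
  by_cases h2 : k < 34
  · exact key j k (Or.inl ⟨hj, hji, by unfold full inS; omega⟩) rfl
  by_cases h3 : k < 48
  · by_cases h4 : 34 + 7 * c j ≤ k ∧ k < 41 + 7 * c j
    · exact key j k (Or.inl ⟨hj, hji, by unfold full; omega⟩) rfl
    · by_cases h5 : k < 41
      · exact key j (k + 7) (Or.inl ⟨hj, hji, by unfold full; omega⟩) (psDE (by omega) h5).symm
      · refine key j (k - 7) (Or.inl ⟨hj, hji, by unfold full; omega⟩) ?_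
        have := psDE (j := j) (k := k - 7) (by omega) (by omega)
        rwa [show k - 7 + 7 = k by omega] at this
  by_cases h4 : k = 52
  · subst h4
    refine key (j + 1) 33 ?_ (ps_5233 j).symm
    by_cases h : j + 1 = i
    · exact Or.inr ⟨h, by norm_num, by unfold inS; omega⟩
    · exact Or.inl ⟨by omega, by omega, by unfold full inS; omega⟩
  by_cases h4 : k = 53
  · subst h4
    refine key (j + 1) 32 ?_ (ps_5332 j).symm
    by_cases h : j + 1 = i
    · exact Or.inr ⟨h, by norm_num, by unfold inS; omega⟩
    · exact Or.inl ⟨by omega, by omega, by unfold full inS; omega⟩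
  exact key j k (Or.inl ⟨hj, hji, by unfold full; omega⟩) rfl

theorem neg_block (H : Hyp sv) (h3 : sv 3 ≤ τ) (hA : AInv sv τ U) (hS : ∀ x ∈ S, x.2 < 58)
    (hneg : ∀ a k, (a, k) ∈ S → 0 ≤ a) (hz : ∀ k, ((0 : ℤ), k) ∈ S → k ≠ 0 ∧ k ≠ 32 ∧ k ≠ 33)
    (hj : j < 0) (hc : τ ≤ con sv (blk j U) S) : False := by
  have a23 := H.a23
  by_cases hj1 : j = -1
  · subst hj1
    have h4047 : 40 ∉ U ∨ 47 ∉ U := by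
      by_contra hc
      push Not at hc
      have := hA.inj 40 hc.1 47 hc.2 (by decide +kernel) (by decide +kernel)
      omega
    have hR : ∀ x ∈ S, (fun (d : ℤ) (k : ℕ) => decide (1 ≤ d) && (decide (d ≠ 1) || decide (k ≠ 32 ∧ k ≠ 33))) (x.1 - -1) x.2 = true := by
      rintro ⟨a, k⟩ hx
      have := hneg a k hx
      by_cases ha : a = 0
      · subst ha
        simpa using (hz k hx).2
      · simp [this, ha]
    rcases h4047 with h | h
    · have e : bd (fun k => decide (k ≠ 40)) (fun (d : ℤ) (k : ℕ) => decide (1 ≤ d) && (decide (d ≠ 1) || decide (k ≠ 32 ∧ k ≠ 33))) = [2] := by decide +kernel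
      have := con_le (j := -1) H.z0 hA.lt hS (fun k => decide (k ≠ 40)) (fun (d : ℤ) (k : ℕ) => decide (1 ≤ d) && (decide (d ≠ 1) || decide (k ≠ 32 ∧ k ≠ 33))) (fun k hk => decide_eq_true fun e => h (e ▸ hk)) hR
      rw [e] at this
      simp at this
      omega
    · have e : bd (fun k => decide (k ≠ 47)) (fun (d : ℤ) (k : ℕ) => decide (1 ≤ d) && (decide (d ≠ 1) || decide (k ≠ 32 ∧ k ≠ 33))) = [2] := by decide +kernel
      have := con_le (j := -1) H.z0 hA.lt hS (fun k => decide (k ≠ 47)) (fun (d : ℤ) (k : ℕ) => decide (1 ≤ d) && (decide (d ≠ 1) || decide (k ≠ 32 ∧ k ≠ 33))) (fun k hk => decide_eq_true fun e => h (e ▸ hk)) hR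
      rw [e] at this
      simp at this
      omega
  · have := inter_far (sv := sv) H.z0 (j := j) hA.lt hS (by
      rintro ⟨a, k⟩ hx
      have := hneg a k hx
      dsimp only
      omega)
    omega

theorem far_block (H : Hyp sv) (h3 : sv 3 ≤ τ) (hA : AInv sv τ U) (hS : ∀ x ∈ S, x.2 < 58)
    (hneg : ∀ a k, (a, k) ∈ S → a + 1 < j) (hc : τ ≤ con sv (blk j U) S) : False := by
  have a23 := H.a23
  have := inter_far (sv := sv) H.z0 (j := j) hA.lt hS (by
    rintro ⟨a, k⟩ hx
    have := hneg a k hx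
    dsimp only
    omega)
  omega

def Q4 (i : ℤ) (k : ℕ) : Prop := inS i k ∨ (34 ≤ k ∧ k < 41) ∨ (48 ≤ k ∧ k < 52)
def Q1 (c : ℤ → ℕ) (i : ℤ) (k : ℕ) : Prop := inS i k ∨ (34 + 7 * c i ≤ k ∧ k < 41 + 7 * c i) ∨ (48 ≤ k ∧ k < 52)
def Q2 (c : ℤ → ℕ) (i : ℤ) (k : ℕ) : Prop := full c i k ∨ k = 52 ∨ k = 53
def QY (i : ℤ) (k : ℕ) : Prop := inS i k ∨ (48 ≤ k ∧ k < 52)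
def QE (i : ℤ) (k : ℕ) : Prop := inS i k ∨ (41 ≤ k ∧ k < 52)

theorem z_single (H : Hyp sv) (h4 : sv 4 ≤ τ) (hA : AInv sv τ U) {z : ℕ} (hz : z ∈ U) (h : 54 ≤ z) : U = {z} :=
  (hA.cz z hz h).resolve_right fun h53 => by
    have := hA.cb h4 53 h53 (by norm_num) z hz
    omega

theorem ck4z : ∀ a : Fin 4, bd (fun k => decide (k = 54 + a.1)) (rr 0 (fun k => decide (k < 53))) = [2] := by decide +kernel
theorem ck4y : ∀ a : Fin 4, bd (fun k => decide (k = 48 + a.1)) (rr 0 (fun k => decide (k < 40))) = [2] := by decide +kernel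

/-- contact of pieces of type `B` or `Z` in block `i` -/
theorem noBZ (H : Hyp sv) (h4 : sv 4 ≤ τ) (hA : AInv sv τ U) (hS : ∀ x ∈ S, x.2 < 58)
    (hle : ∀ a k, (a, k) ∈ S → a ≤ i) (hR : ∀ k, (i, k) ∈ S → k < 52)
    (hc : τ ≤ con sv (blk i U) S) : ∀ k ∈ U, k < 52 := by
  have a23 := H.a23
  have a34 := H.a34
  intro k hk
  by_contra hn
  have h58 := hA.lt k hk
  by_cases hB : k = 52 ∨ k = 53
  · have hU := hA.cb h4 k hk hB
    have := con_rr H.z0 hA.lt hS (j := i) 0 (fun k => decide (k = 52 ∨ k = 53)) (fun k => decide (k < 52)) [3] (by decide +kernel)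
      (by simpa using hU) (by simpa using hle) (by simpa using hR)
    simp at this
    omega
  · have hU := z_single H h4 hA hk (by omega)
    obtain ⟨a, rfl⟩ := fin4 (c := 54) (by omega) h58
    have := con_rr H.z0 hA.lt hS (j := i) 0 (fun k => decide (k = 54 + a.1)) (fun k => decide (k < 53)) [2] (ck4z a)
      (by rw [hU]; simp) (by simpa using hle) (by
        intro k hk
        rw [add_zero] at hk
        have := hR k hk
        simp; omega)
    simp at this
    omega

theorem base_facts (hcc : ∀ j, c j ≤ 1) (hi : 0 ≤ i) {Q : ℕ → Prop} (hup : S ⊆ stt c i Q)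
    (hQ : i = 0 → ∀ k, Q k → k ≠ 0 ∧ k ≠ 32 ∧ k ≠ 33) :
    (∀ x ∈ S, x.2 < 58) ∧ (∀ a k, (a, k) ∈ S → 0 ≤ a ∧ a ≤ i) ∧
    (∀ k, ((0 : ℤ), k) ∈ S → k ≠ 0 ∧ k ≠ 32 ∧ k ≠ 33) ∧ (∀ k, (i, k) ∈ S → Q k) := by
  refine ⟨?_, ?_, ?_, ?_⟩
  · rintro ⟨a, k⟩ hx
    have := hcc a
    rcases (mem_stt hcc).1 (hup hx) with h | h
    · have := h.2.2
      unfold full inS at this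
      dsimp only
      omega
    · exact h.2.1
  · intro a k hx
    rcases (mem_stt hcc).1 (hup hx) with h | h <;> omega
  · intro k hx
    have := hcc 0
    rcases (mem_stt hcc).1 (hup hx) with h | h
    · have := h.2.2
      unfold full inS at this
      omega
    · exact hQ h.1.symm k h.2.2
  · intro k hx
    rcases (mem_stt hcc).1 (hup hx) with h | h
    · omega
    · exact h.2.2

theorem skel_out (hcc : ∀ j, c j ≤ 1) (hi : 0 ≤ i) (hlo : 0 < i → stt c i (inS i) ⊆ S)
    (hn : i = 0 → ∀ k ∈ U, k ≠ 0 ∧ k ≠ 1 ∧ k ≠ 32 ∧ k ≠ 33) (hd : Disj S i U) :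
    ∀ k ∈ U, k ≠ 0 ∧ k ≠ 1 ∧ k ≠ 32 ∧ k ≠ 33 := by
  by_cases h0 : i = 0
  · exact hn h0
  · have hp : 0 < i := by omega
    have m : ∀ k, k < 58 → inS i k → (i, k) ∈ S := fun k h h' => hlo hp ((mem_stt hcc).2 (Or.inr ⟨rfl, h, h'⟩))
    intro k hk
    refine ⟨?_, ?_, ?_, ?_⟩
    · rintro rfl
      exact hd.not (m 0 (by norm_num) (by unfold inS; omega)) rfl hk
    · rintro rfl
      exact hd.not (m 0 (by norm_num) (by unfold inS; omega)) ps01 hk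
    · rintro rfl
      exact hd.not (m 32 (by norm_num) (by unfold inS; omega)) rfl hk
    · rintro rfl
      exact hd.not (m 33 (by norm_num) (by unfold inS; omega)) rfl hk

theorem att4 (H : Hyp sv) (hcc : ∀ j, c j ≤ 1) (hi : 0 ≤ i) (h4 : sv 4 ≤ τ) (hA : AInv sv τ U)
    (hlo : 0 < i → stt c i (inS i) ⊆ S) (hseed : ((0 : ℤ), 1) ∈ S) (hup : S ⊆ stt c i (Q4 i))
    (hy : ∀ y, 48 ≤ y → y < 52 → (i, y) ∈ S → (i, 40) ∈ S) (hd : Disj S j U)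
    (hc : τ ≤ con sv (blk j U) S) :
    j = i ∧ (∀ k ∈ U, Q4 i k) ∧ ((∃ y ∈ U, 48 ≤ y ∧ y < 52) → 40 ∈ U ∨ (i, 40) ∈ S) := by
  have a23 := H.a23
  have a34 := H.a34
  have p2 := H.p2
  obtain ⟨hS, hrg, hz, hQ⟩ := base_facts hcc hi hup (by intro h k hk; unfold Q4 inS at hk; omega)
  have hn : j = 0 → ∀ k ∈ U, k ≠ 0 ∧ k ≠ 1 ∧ k ≠ 32 ∧ k ≠ 33 := by
    rintro rfl
    exact n_block0 H.z0 (by omega) hA hS hseed (fun a k h => (hrg a k h).1) hz hd hc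
  have hQ' : ∀ k, (i, k) ∈ S → k < 41 ∨ (48 ≤ k ∧ k < 52) := by
    intro k hk
    have := hQ k hk
    unfold Q4 inS at this
    omega
  have hj0 : ¬ j < 0 := fun h => neg_block H (by omega) hA hS (fun a k h => (hrg a k h).1) hz h hc
  have hji : ¬ j < i := fun h => low_block hcc hA (hlo (by omega)) (by omega) h hn hd
  have hj2 : ¬ i + 1 < j := fun h => far_block H (by omega) hA hS (fun a k h => by have := hrg a k h; omega) hc
  have hj1 : j ≠ i + 1 := by
    rintro rfl
    have := con_rr H.z0 hA.lt hS (j := i + 1) (-1) (fun _ => true) (fun k => decide (k < 41 ∨ (48 ≤ k ∧ k < 52))) [2] (by decide +kernel)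
      (by simp) (fun a k h => by have := hrg a k h; omega) (by
        intro k hk
        rw [show i + 1 + -1 = i by ring] at hk
        simpa using hQ' k hk)
    simp at this
    omega
  have hj : j = i := by omega
  subst hj
  have hle : ∀ a k, (a, k) ∈ S → a ≤ j + 0 := fun a k h => by have := hrg a k h; omega
  have n1 := skel_out hcc hi hlo hn hd
  have n2 := noBZ H h4 hA hS (fun a k h => (hrg a k h).2) (fun k hk => by have := hQ' k hk; omega) hc
  refine ⟨rfl, ?_, ?_⟩
  · intro k hk
    have h1 := n1 k hk
    have h2 := n2 k hk
    have hE : ¬ (41 ≤ k ∧ k < 48) := by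
      intro hk'
      have hU := hA.ce h4 k hk hk'.1 hk'.2
      by_cases h40 : (j, 40) ∈ S
      · have h47 : 47 ∉ U := hd.not h40 (psDE (k := 40) (by norm_num) (by norm_num))
        have := con_rr H.z0 hA.lt hS (j := j) 0 (fun k => decide (41 ≤ k ∧ k < 47)) (fun k => decide (k < 41 ∨ (48 ≤ k ∧ k < 52))) [2] (by decide +kernel)
          (by
            intro k hk
            have := hU k hk
            have : k ≠ 47 := fun h => h47 (h ▸ hk)
            simp; omega) hle (by
            intro k hk
            rw [add_zero] at hk
            simpa using hQ' k hk)
        simp at this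
        omega
      · have := con_rr H.z0 hA.lt hS (j := j) 0 (fun k => decide (41 ≤ k ∧ k < 48)) (fun k => decide (k < 41)) [2] (by decide +kernel)
          (by simpa using hU) hle (by
            intro k hk
            rw [add_zero] at hk
            have := hQ' k hk
            have := hy k
            simp only [decide_eq_true_eq]
            by_contra hcon
            exact h40 (hy k (by omega) (by omega) hk))
        simp at this
        omega
    unfold Q4 inS
    omega
  · rintro ⟨y, hyU, hy1, hy2⟩
    by_contra hcon
    rw [not_or] at hcon
    have hU := (hA.cy h4 y hyU hy1 hy2).resolve_right hcon.1
    obtain ⟨a, rfl⟩ := fin4 hy1 hy2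
    have := con_rr H.z0 hA.lt hS (j := j) 0 (fun k => decide (k = 48 + a.1)) (fun k => decide (k < 40)) [2] (ck4y a)
      (by rw [hU]; simp) hle (by
        intro k hk
        rw [add_zero] at hk
        have h1 := hQ' k hk
        have h2 : k ≠ 40 := fun h => hcon.2 (h ▸ hk)
        simp only [decide_eq_true_eq]
        by_contra hcc
        exact hcon.2 (hy k (by omega) (by omega) hk))
    simp at this
    omega

theorem att3 (H : Hyp sv) (hcc : ∀ j, c j ≤ 1) (hi : 0 ≤ i) (h3 : sv 3 ≤ τ) (hA : AInv sv τ U)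
    (hlo : stt c i (Q1 c i) ⊆ S) (hseed : ((0 : ℤ), 1) ∈ S) (hup : S ⊆ stt c i (Q2 c i))
    (hzz : ∀ z, 54 ≤ z → (i, z) ∈ S → (i, 53) ∈ S) (hd : Disj S j U)
    (hc : τ ≤ con sv (blk j U) S) :
    j = i ∧ (∀ k ∈ U, 52 ≤ k) ∧ ((∃ z ∈ U, 54 ≤ z) → 53 ∈ U ∨ (i, 53) ∈ S) := by
  have a23 := H.a23
  have p2 := H.p2
  have hci := hcc i
  obtain ⟨hS, hrg, hz, hQ⟩ := base_facts hcc hi hup (by intro h k hk; unfold Q2 full inS at hk; omega)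
  have hn : j = 0 → ∀ k ∈ U, k ≠ 0 ∧ k ≠ 1 ∧ k ≠ 32 ∧ k ≠ 33 := by
    rintro rfl
    exact n_block0 H.z0 (by omega) hA hS hseed (fun a k h => (hrg a k h).1) hz hd hc
  have hlo' : stt c i (inS i) ⊆ S := by
    rintro ⟨a, k⟩ hx
    refine hlo ?_
    rw [mem_stt hcc] at hx ⊢
    rcases hx with hx | hx
    · exact Or.inl hx
    · exact Or.inr ⟨hx.1, hx.2.1, Or.inl hx.2.2⟩
  have hj0 : ¬ j < 0 := fun h => neg_block H (by omega) hA hS (fun a k h => (hrg a k h).1) hz h hc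
  have hji : ¬ j < i := fun h => low_block hcc hA hlo' (by omega) h hn hd
  have hj2 : ¬ i + 1 < j := fun h => far_block H (by omega) hA hS (fun a k h => by have := hrg a k h; omega) hc
  have hj1 : j ≠ i + 1 := by
    rintro rfl
    have hle : ∀ a k, (a, k) ∈ S → a ≤ i + 1 + -1 := fun a k h => by have := hrg a k h; omega
    have hc01 : (∀ k, (i, k) ∈ S → k ≠ 40) ∨ (∀ k, (i, k) ∈ S → k ≠ 47) := by
      by_cases h : c i = 0
      · right
        intro k hk
        have := hQ k hk
        unfold Q2 full inS at this
        omega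
      · left
        intro k hk
        have := hQ k hk
        unfold Q2 full inS at this
        omega
    by_cases hzS : ∃ z, 54 ≤ z ∧ (i, z) ∈ S
    · obtain ⟨z, hz1, hz2⟩ := hzS
      have h32 : 32 ∉ U := hd.not (hzz z hz1 hz2) (ps_5332 i)
      by_cases h33 : 33 ∈ U
      · have hU := (hA.cn1 h33).resolve_right h32
        have := con_rr H.z0 hA.lt hS (j := i + 1) (-1) (fun k => decide (k = 33)) (fun _ => true) [2] (by decide +kernel)
          (by rw [hU]; simp) hle (by simp)
        simp at this
        omega
      · rcases hc01 with h | h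
        · have := con_rr H.z0 hA.lt hS (j := i + 1) (-1) (fun k => decide (k ≠ 32 ∧ k ≠ 33)) (fun k => decide (k ≠ 40)) [2] (by decide +kernel)
            (fun k hk => decide_eq_true ⟨fun e => h32 (e ▸ hk), fun e => h33 (e ▸ hk)⟩) hle (by
              intro k hk
              rw [show i + 1 + -1 = i by ring] at hk
              exact decide_eq_true (h k hk))
          simp at this
          omega
        · have := con_rr H.z0 hA.lt hS (j := i + 1) (-1) (fun k => decide (k ≠ 32 ∧ k ≠ 33)) (fun k => decide (k ≠ 47)) [2] (by decide +kernel)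
            (fun k hk => decide_eq_true ⟨fun e => h32 (e ▸ hk), fun e => h33 (e ▸ hk)⟩) hle (by
              intro k hk
              rw [show i + 1 + -1 = i by ring] at hk
              exact decide_eq_true (h k hk))
          simp at this
          omega
    · have hzS' : ∀ z, (i, z) ∈ S → z < 54 := by
        intro z hz
        by_contra hcon
        exact hzS ⟨z, by omega, hz⟩
      rcases hc01 with h | h
      · have := con_rr H.z0 hA.lt hS (j := i + 1) (-1) (fun _ => true) (fun k => decide (k ≠ 40 ∧ k < 54)) [2] (by decide +kernel)
          (by simp) hle (by
            intro k hk
            rw [show i + 1 + -1 = i by ring] at hk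
            exact decide_eq_true ⟨h k hk, hzS' k hk⟩)
        simp at this
        omega
      · have := con_rr H.z0 hA.lt hS (j := i + 1) (-1) (fun _ => true) (fun k => decide (k ≠ 47 ∧ k < 54)) [2] (by decide +kernel)
          (by simp) hle (by
            intro k hk
            rw [show i + 1 + -1 = i by ring] at hk
            exact decide_eq_true ⟨h k hk, hzS' k hk⟩)
        simp at this
        omega
  have hj : j = i := by omega
  subst hj
  have hle : ∀ a k, (a, k) ∈ S → a ≤ j + 0 := fun a k h => by have := hrg a k h; omega
  have n1 := skel_out hcc hi (fun _ => hlo') hn hd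
  have m : ∀ k, k < 58 → Q1 c j k → (j, k) ∈ S := fun k h h' => hlo ((mem_stt hcc).2 (Or.inr ⟨rfl, h, h'⟩))
  refine ⟨rfl, ?_, ?_⟩
  · intro k hk
    have h1 := n1 k hk
    have h2 := hA.lt k hk
    by_contra hcon
    by_cases h4 : (34 + 7 * c j ≤ k ∧ k < 41 + 7 * c j) ∨ k < 34 ∨ 48 ≤ k
    · exact hd.not (m k h2 (by unfold Q1 inS; omega)) rfl hk
    · by_cases h5 : k < 41
      · exact hd.not (m (k + 7) (by omega) (by unfold Q1; omega)) (psDE (by omega) h5).symm hk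
      · refine hd.not (m (k - 7) (by omega) (by unfold Q1; omega)) ?_ hk
        have := psDE (j := j) (k := k - 7) (by omega) (by omega)
        rwa [show k - 7 + 7 = k by omega] at this
  · rintro ⟨y, hyU, hy1⟩
    by_contra hcon
    rw [not_or] at hcon
    have hU := (hA.cz y hyU hy1).resolve_right hcon.1
    obtain ⟨a, rfl⟩ := fin4 hy1 (hA.lt _ hyU)
    have := con_rr H.z0 hA.lt hS (j := j) 0 (fun k => decide (k = 54 + a.1)) (fun k => decide (k < 53)) [2] (ck4z a)
      (by rw [hU]; simp) hle (by
        intro k hk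
        rw [add_zero] at hk
        have h2 : k ≠ 53 := fun h => hcon.2 (h ▸ hk)
        simp only [decide_eq_true_eq]
        by_contra hcc
        exact hcon.2 (hzz k (by omega) hk))
    simp at this
    omega

theorem att7 (H : Hyp sv) (hcc : ∀ j, c j ≤ 1) (hi : 0 ≤ i) (h7 : sv 7 ≤ τ) (hA : AInv sv τ U)
    (hlo : stt c i (QY i) ⊆ S) (hseed : ((0 : ℤ), 1) ∈ S) (hup : S ⊆ stt c i (QE i)) (hd : Disj S j U)
    (hc : τ ≤ con sv (blk j U) S) :
    j = i ∧ (∀ k ∈ U, 41 ≤ k ∧ k < 48) := by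
  have a23 := H.a23
  have a34 := H.a34
  have a46 := H.a46
  have a67 := H.a67
  have b5 := H.b5
  have p2 := H.p2
  obtain ⟨hS, hrg, hz, hQ⟩ := base_facts hcc hi hup (by intro h k hk; unfold QE inS at hk; omega)
  have hn : j = 0 → ∀ k ∈ U, k ≠ 0 ∧ k ≠ 1 ∧ k ≠ 32 ∧ k ≠ 33 := by
    rintro rfl
    exact n_block0 H.z0 (by omega) hA hS hseed (fun a k h => (hrg a k h).1) hz hd hc
  have hlo' : stt c i (inS i) ⊆ S := by
    rintro ⟨a, k⟩ hx
    refine hlo ?_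
    rw [mem_stt hcc] at hx ⊢
    rcases hx with hx | hx
    · exact Or.inl hx
    · exact Or.inr ⟨hx.1, hx.2.1, Or.inl hx.2.2⟩
  have hQ' : ∀ k, (i, k) ∈ S → k < 34 ∨ (41 ≤ k ∧ k < 52) := by
    intro k hk
    have := hQ k hk
    unfold QE inS at this
    omega
  have hj0 : ¬ j < 0 := fun h => neg_block H (by omega) hA hS (fun a k h => (hrg a k h).1) hz h hc
  have hji : ¬ j < i := fun h => low_block hcc hA hlo' (by omega) h hn hd
  have hj2 : ¬ i + 1 < j := fun h => far_block H (by omega) hA hS (fun a k h => by have := hrg a k h; omega) hc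
  have hj1 : j ≠ i + 1 := by
    rintro rfl
    have := con_rr H.z0 hA.lt hS (j := i + 1) (-1) (fun _ => true) (fun k => decide (k < 34 ∨ (41 ≤ k ∧ k < 52))) [2] (by decide +kernel)
      (by simp) (fun a k h => by have := hrg a k h; omega) (by
        intro k hk
        rw [show i + 1 + -1 = i by ring] at hk
        simpa using hQ' k hk)
    simp at this
    omega
  have hj : j = i := by omega
  subst hj
  have hle : ∀ a k, (a, k) ∈ S → a ≤ j + 0 := fun a k h => by have := hrg a k h; omega
  have n1 := skel_out hcc hi (fun _ => hlo') hn hd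
  have n2 := noBZ H (by omega) hA hS (fun a k h => (hrg a k h).2) (fun k hk => by have := hQ' k hk; omega) hc
  have m : ∀ k, k < 58 → QY j k → (j, k) ∈ S := fun k h h' => hlo ((mem_stt hcc).2 (Or.inr ⟨rfl, h, h'⟩))
  refine ⟨rfl, ?_⟩
  intro k hk
  have h1 := n1 k hk
  have h2 := n2 k hk
  by_contra hcon
  by_cases hD : 34 ≤ k ∧ k < 41
  · have hU := hA.cd (by omega) k hk hD.1 hD.2
    have := con_rr H.z0 hA.lt hS (j := j) 0 (fun k => decide (34 ≤ k ∧ k < 41)) (fun k => decide (k < 34 ∨ (41 ≤ k ∧ k < 52))) [4, 2] (by decide +kernel)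
      (by simpa using hU) hle (by
        intro k hk
        rw [add_zero] at hk
        simpa using hQ' k hk)
    simp at this
    omega
  · exact hd.not (m k (by omega) (by unfold QY inS; omega)) rfl hk

theorem att6 (H : Hyp sv) (hcc : ∀ j, c j ≤ 1) (hi : 0 ≤ i) (h6 : sv 6 ≤ τ) (hA : AInv sv τ U)
    (hlo : stt c i (full c i) ⊆ S) (hseed : ((0 : ℤ), 1) ∈ S) (hup : S ⊆ stt c (i + 1) (inS (i + 1)))
    (hroot : ∀ k, (i + 1, k) ∈ S → (i + 1, 0) ∈ S) (hd : Disj S j U)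
    (hc : τ ≤ con sv (blk j U) S) :
    j = i + 1 ∧ (∀ k ∈ U, inS (i + 1) k) ∧ (0 ∈ U ∨ (i + 1, 0) ∈ S) := by
  have a23 := H.a23
  have a34 := H.a34
  have a46 := H.a46
  have b2 := H.b2
  have p2 := H.p2
  have hci := hcc i
  obtain ⟨hS, hrg, hz, hQ⟩ := base_facts hcc (by omega) hup (by intro h k hk; omega)
  have hn : j = 0 → ∀ k ∈ U, k ≠ 0 ∧ k ≠ 1 ∧ k ≠ 32 ∧ k ≠ 33 := by
    rintro rfl
    exact n_block0 H.z0 (by omega) hA hS hseed (fun a k h => (hrg a k h).1) hz hd hc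
  have hlo' : stt c i (inS i) ⊆ S := by
    rintro ⟨a, k⟩ hx
    refine hlo ?_
    rw [mem_stt hcc] at hx ⊢
    rcases hx with hx | hx
    · exact Or.inl hx
    · exact Or.inr ⟨hx.1, hx.2.1, Or.inl hx.2.2⟩
  have hQ' : ∀ k, (i + 1, k) ∈ S → k < 34 := by
    intro k hk
    have := hQ k hk
    unfold inS at this
    omega
  have hfi : ∀ k, (i, k) ∈ S → full c i k := by
    intro k hk
    rcases (mem_stt hcc).1 (hup hk) with h | h
    · exact h.2.2
    · omega
  have hj0 : ¬ j < 0 := fun h => neg_block H (by omega) hA hS (fun a k h => (hrg a k h).1) hz h hc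
  have hji : ¬ j < i := fun h => low_block hcc hA hlo' (by omega) h hn hd
  have hj2 : ¬ i + 2 < j := fun h => far_block H (by omega) hA hS (fun a k h => by have := hrg a k h; omega) hc
  have hj1 : j ≠ i + 2 := by
    rintro rfl
    have := con_rr H.z0 hA.lt hS (j := i + 2) (-1) (fun _ => true) (fun k => decide (k < 34)) [] (by decide +kernel)
      (by simp) (fun a k h => by have := hrg a k h; omega) (by
        intro k hk
        rw [show i + 2 + -1 = i + 1 by ring] at hk
        simpa using hQ' k hk)
    simp at this
    omega
  have hji' : j ≠ i := by
    rintro rfl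
    have n1 := skel_out hcc hi (fun _ => hlo') hn hd
    have m : ∀ k, k < 58 → full c j k → (j, k) ∈ S := fun k h h' => hlo ((mem_stt hcc).2 (Or.inr ⟨rfl, h, h'⟩))
    have hB : ∀ k ∈ U, k = 52 ∨ k = 53 := by
      intro k hk
      have h1 := n1 k hk
      have h2 := hA.lt k hk
      by_contra hcon
      by_cases h4 : (34 + 7 * c j ≤ k ∧ k < 41 + 7 * c j) ∨ k < 34 ∨ 48 ≤ k
      · exact hd.not (m k h2 (by unfold full inS; omega)) rfl hk
      · by_cases h5 : k < 41
        · exact hd.not (m (k + 7) (by omega) (by unfold full; omega)) (psDE (by omega) h5).symm hk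
        · refine hd.not (m (k - 7) (by omega) (by unfold full; omega)) ?_ hk
          have := psDE (j := j) (k := k - 7) (by omega) (by omega)
          rwa [show k - 7 + 7 = k by omega] at this
    have := con_le H.z0 hA.lt hS (j := j) (fun k => decide (k = 52 ∨ k = 53)) (fun δ k => decide (δ ≠ 0 ∨ (k ≠ 52 ∧ k ≠ 53)))
      (by simpa using hB) (by
        rintro ⟨a, k⟩ hx
        rw [decide_eq_true_eq]
        dsimp only
        by_cases ha : a = j
        · right
          subst ha
          have := hfi k hx
          unfold full inS at this
          omega
        · left; omega)
    have e : bd (fun k => decide (k = 52 ∨ k = 53)) (fun δ k => decide (δ ≠ 0 ∨ (k ≠ 52 ∧ k ≠ 53))) = [3, 2] := by decide +kernel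
    rw [e] at this
    simp at this
    omega
  have hj : j = i + 1 := by omega
  subst hj
  have hle : ∀ a k, (a, k) ∈ S → a ≤ i + 1 + 0 := fun a k h => by have := hrg a k h; omega
  have hQ0 : ∀ k, (i + 1 + 0, k) ∈ S → k < 34 := by simpa using hQ'
  have n2 := noBZ H (by omega) hA hS (fun a k h => (hrg a k h).2) (fun k hk => by have := hQ' k hk; omega) hc
  have hg : 0 ∈ U ∨ (i + 1, 0) ∈ S := by
    by_cases he : ∃ k, (i + 1, k) ∈ S
    · obtain ⟨k, hk⟩ := he
      exact Or.inr (hroot k hk)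
    · left
      have hle' : ∀ a k, (a, k) ∈ S → a ≤ i + 1 + -1 := by
        intro a k h
        have := hrg a k h
        have : a ≠ i + 1 := fun e => he ⟨k, e ▸ h⟩
        omega
      have h32 : 32 ∈ U := by
        by_contra h32
        have hc01 : (∀ k, (i, k) ∈ S → k ≠ 40) ∨ (∀ k, (i, k) ∈ S → k ≠ 47) := by
          by_cases h : c i = 0
          · right
            intro k hk
            have := hfi k hk
            unfold full inS at this
            omega
          · left
            intro k hk
            have := hfi k hk
            unfold full inS at this
            omega
        rcases hc01 with h | h
        · have := con_rr H.z0 hA.lt hS (j := i + 1) (-1) (fun k => decide (k ≠ 32)) (fun k => decide (k ≠ 40)) [2, 2] (by decide +kernel)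
            (fun k hk => decide_eq_true (fun e => h32 (e ▸ hk))) hle' (by
              intro k hk
              rw [show i + 1 + -1 = i by ring] at hk
              exact decide_eq_true (h k hk))
          simp at this
          omega
        · have := con_rr H.z0 hA.lt hS (j := i + 1) (-1) (fun k => decide (k ≠ 32)) (fun k => decide (k ≠ 47)) [2, 2] (by decide +kernel)
            (fun k hk => decide_eq_true (fun e => h32 (e ▸ hk))) hle' (by
              intro k hk
              rw [show i + 1 + -1 = i by ring] at hk
              exact decide_eq_true (h k hk))
          simp at this
          omega
      refine (hA.cn 32 h32 (Or.inl rfl)).resolve_left fun hU => ?_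
      have := con_rr H.z0 hA.lt hS (j := i + 1) (-1) (fun k => decide (k = 32 ∨ k = 33)) (fun _ => true) [2, 2] (by decide +kernel)
        (by simpa using hU) hle' (by simp)
      simp at this
      omega
  refine ⟨rfl, ?_, hg⟩
  intro k hk
  have h2 := n2 k hk
  have k1 : k ≠ 1 := by
    rintro rfl
    rcases hg with h | h
    · have := hA.inj 0 h 1 hk (by decide +kernel) (by decide +kernel)
      omega
    · exact hd.not h ps01 hk
  have kE : ¬ (41 ≤ k ∧ k < 48) := by
    intro hk'
    have hU := hA.ce (by omega) k hk hk'.1 hk'.2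
    have := con_rr H.z0 hA.lt hS (j := i + 1) 0 (fun k => decide (41 ≤ k ∧ k < 48)) (fun k => decide (k < 34)) [2] (by decide +kernel)
      (by simpa using hU) hle (by simpa using hQ0)
    simp at this
    omega
  have kD : ¬ (34 ≤ k ∧ k < 41) := by
    intro hk'
    have hU := hA.cd (by omega) k hk hk'.1 hk'.2
    have := con_rr H.z0 hA.lt hS (j := i + 1) 0 (fun k => decide (34 ≤ k ∧ k < 41)) (fun k => decide (k < 34)) [4] (by decide +kernel)
      (by simpa using hU) hle (by simpa using hQ0)
    simp at this
    omega
  have kY : ¬ (48 ≤ k ∧ k < 52) := by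
    rintro ⟨hy1, hy2⟩
    have hU := (hA.cy (by omega) k hk hy1 hy2).resolve_right (fun h40 => by
      have := hA.cd h6 40 h40 (by norm_num) (by norm_num) k hk
      omega)
    obtain ⟨a, rfl⟩ := fin4 hy1 hy2
    have := con_rr H.z0 hA.lt hS (j := i + 1) 0 (fun k => decide (k = 48 + a.1)) (fun k => decide (k < 40)) [2] (ck4y a)
      (by rw [hU]; simp) hle (by
        intro k hk
        have := hQ0 k hk
        simp; omega)
    simp at this
    omega
  unfold inS
  omega
end
end TA

namespace TA

theorem sum_filt {α : Type} (p : α → Prop) [DecidablePred p] (f : α → ℕ) : ∀ L : List α,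
    (L.map (fun e => if p e then f e else 0)).sum = ((L.filter (fun e => decide (p e))).map f).sum := by
  intro L
  induction L with
  | nil => rfl
  | cons a L ih =>
    by_cases h : p a
    · simp [h, ih]
    · simp [h, ih]

section
variable {sv : ℕ → ℕ} {τ : ℕ} {c : ℤ → ℕ} {i : ℤ}

theorem cutF (sv : ℕ → ℕ) (V W : Finset (ℤ × ℕ)) (i : ℤ) (L : List (ℤ × ℤ × ℕ × ℕ × ℕ)) (hL : ∀ e ∈ L, e.2 ∈ EL)
    (hn : (L.map (fun e => (e.1, e.2.1, e.2.2.1, e.2.2.2.1))).Nodup) :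
    (L.map (fun e => if (i + e.1, e.2.2.1) ∈ V ∧ (i + e.1 + e.2.1, e.2.2.2.1) ∈ W then sv e.2.2.2.2 else 0)).sum
      ≤ con sv V W := by
  rw [sum_filt]
  set L' := L.filter (fun e => decide ((i + e.1, e.2.2.1) ∈ V ∧ (i + e.1 + e.2.1, e.2.2.2.1) ∈ W)) with hL'
  have hsub : ∀ e ∈ L', e ∈ L ∧ (i + e.1, e.2.2.1) ∈ V ∧ (i + e.1 + e.2.1, e.2.2.2.1) ∈ W := by
    intro e he
    rw [hL', List.mem_filter, decide_eq_true_eq] at he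
    exact he
  have hnd : (L'.map (fun e => ((i + e.1, e.2.2.1), (i + e.1 + e.2.1, e.2.2.2.1)))).Nodup := by
    have h1 : (L'.map (fun e => (e.1, e.2.1, e.2.2.1, e.2.2.2.1))).Nodup :=
      hn.sublist (List.filter_sublist.map _)
    have := h1.map (f := fun q : ℤ × ℤ × ℕ × ℕ => ((i + q.1, q.2.2.1), (i + q.1 + q.2.1, q.2.2.2))) (by
      rintro ⟨a, b, k, l⟩ ⟨a', b', k', l'⟩ h
      simp only [Prod.mk.injEq] at h ⊢
      omega)
    rw [List.map_map] at this
    exact this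
  refine le_trans (le_of_eq ?_) (con_ge sv _ hnd ?_)
  · rw [List.map_map]
    congr 1
    refine List.map_congr_left fun e he => ?_
    exact (wt_EL (hL e (hsub e he).1) (i + e.1)).symm
  · intro p hp
    rw [List.mem_map] at hp
    obtain ⟨e, he, rfl⟩ := hp
    exact (hsub e he).2

theorem s7_iff {V R : Finset (ℤ × ℕ)} (h7 : τ ≤ sv 7) (hcut : con sv V (R \ V) < τ) {k k' : ℕ} {j : ℤ}
    (h : ((0 : ℤ), k, k', 7) ∈ EL) (h' : ((0 : ℤ), k', k, 7) ∈ EL) (h1 : (j, k) ∈ R) (h2 : (j, k') ∈ R) :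
    (j, k) ∈ V ↔ (j, k') ∈ V := by
  constructor
  · intro hv
    by_contra hn
    have := cutF sv V (R \ V) j [(0, 0, k, k', 7)] (by simpa using h) (by simp)
    simp [hv, hn, h2] at this
    omega
  · intro hv
    by_contra hn
    have := cutF sv V (R \ V) j [(0, 0, k', k, 7)] (by simpa using h') (by simp)
    simp [hv, hn, h1] at this
    omega

def root (j : ℤ) : ℕ := if j = 0 then 1 else 0

theorem par_chk1 : ∀ k ∈ List.range 32, 2 ≤ k → par.getD k 0 < k ∧ par.getD k 0 ≠ 1 ∧
    ((0 : ℤ), par.getD k 0, k, 7) ∈ EL ∧ ((0 : ℤ), k, par.getD k 0, 7) ∈ EL := by decide +kernel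

theorem par_chk2 : ∀ k ∈ List.range 32, 2 ≤ k → 
    par.getD k 0 = 0 → ((0 : ℤ), 1, k, 7) ∈ EL ∧ ((0 : ℤ), k, 1, 7) ∈ EL := by decide +kernel

theorem par_chk (k : ℕ) (h : k ∈ List.range 32) (h2 : 2 ≤ k) : par.getD k 0 < k ∧ par.getD k 0 ≠ 1 ∧
    ((0 : ℤ), par.getD k 0, k, 7) ∈ EL ∧ ((0 : ℤ), k, par.getD k 0, 7) ∈ EL ∧
    (par.getD k 0 = 0 → ((0 : ℤ), 1, k, 7) ∈ EL ∧ ((0 : ℤ), k, 1, 7) ∈ EL) := by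
  obtain ⟨a, b, d, e⟩ := par_chk1 k h h2
  exact ⟨a, b, d, e, par_chk2 k h h2⟩

theorem skel {V R : Finset (ℤ × ℕ)} (h7 : τ ≤ sv 7) (hcut : con sv V (R \ V) < τ) {j : ℤ} (hj : 0 ≤ j)
    (hR : ∀ k, inS j k → (j, k) ∈ R) : ∀ k, inS j k → ((j, k) ∈ V ↔ (j, root j) ∈ V) := by
  have hr : (j, root j) ∈ R := hR _ (by unfold inS root; split_ifs <;> omega)
  have h1 : ∀ k, 2 ≤ k → k < 32 → ((j, k) ∈ V ↔ (j, root j) ∈ V) := by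
    intro k
    induction k using Nat.strong_induction_on with
    | _ k ih =>
      intro h2 h32
      obtain ⟨a, b, e1, e2, e3⟩ := par_chk k (List.mem_range.2 h32) h2
      have hk : (j, k) ∈ R := hR k (Or.inl ⟨h2, h32⟩)
      by_cases h0 : par.getD k 0 = 0
      · obtain ⟨e4, e5⟩ := e3 h0
        rw [h0] at e1 e2
        refine s7_iff h7 hcut ?_ ?_ hk hr
        · unfold root; split_ifs <;> assumption
        · unfold root; split_ifs <;> assumption
      · have hp : (j, par.getD k 0) ∈ R := hR _ (Or.inl (by omega))
        rw [← ih _ a (by omega) (by omega)]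
        exact s7_iff h7 hcut e2 e1 hk hp
  intro k hk
  by_cases h : 2 ≤ k ∧ k < 32
  · exact h1 k h.1 h.2
  by_cases hj0 : j = 0
  · have : k = 1 := by unfold inS at hk; omega
    rw [this]; unfold root; rw [if_pos hj0]
  · have e : root j = 0 := if_neg hj0
    rw [e]
    rw [e] at hr
    have m2 : (j, 32) ∈ R := hR _ (by unfold inS; omega)
    have m3 : (j, 33) ∈ R := hR _ (by unfold inS; omega)
    have i2 := s7_iff h7 hcut (k := 32) (k' := 0) (by decide +kernel) (by decide +kernel) m2 hr
    have i3 := s7_iff h7 hcut (k := 33) (k' := 32) (by decide +kernel) (by decide +kernel) m3 m2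
    have : k = 0 ∨ k = 32 ∨ k = 33 := by unfold inS at hk; omega
    rcases this with rfl | rfl | rfl
    · exact Iff.rfl
    · exact i2
    · exact i3.trans i2

theorem DE_chk : ∀ b ∈ List.range 2, ∀ k ∈ List.range 6, ((0 : ℤ), 34 + 7 * b + k, 34 + 7 * b + k + 1, 7) ∈ EL ∧
    ((0 : ℤ), 34 + 7 * b + k + 1, 34 + 7 * b + k, 7) ∈ EL := by decide +kernel

theorem chainDE {V R : Finset (ℤ × ℕ)} (h7 : τ ≤ sv 7) (hcut : con sv V (R \ V) < τ) {j : ℤ} {b : ℕ} (hb : b ≤ 1)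
    (hR : ∀ k, 34 + 7 * b ≤ k → k < 41 + 7 * b → (j, k) ∈ R) :
    ∀ k, 34 + 7 * b ≤ k → k < 41 + 7 * b → ((j, k) ∈ V ↔ (j, 34 + 7 * b) ∈ V) := by
  have : ∀ n, n < 7 → ((j, 34 + 7 * b + n) ∈ V ↔ (j, 34 + 7 * b) ∈ V) := by
    intro n
    induction n with
    | zero => intro _; exact Iff.rfl
    | succ n ih =>
      intro hn
      rw [← ih (by omega)]
      obtain ⟨e1, e2⟩ := DE_chk b (List.mem_range.2 (by omega)) n (List.mem_range.2 (by omega))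
      exact s7_iff h7 hcut e2 e1 (hR _ (by omega) (by omega)) (hR _ (by omega) (by omega))
  intro k h1 h2
  have := this (k - (34 + 7 * b)) (by omega)
  rwa [show 34 + 7 * b + (k - (34 + 7 * b)) = k by omega] at this

theorem Stable.le {τ' : ℕ} {S : Finset (ℤ × ℕ)} (h : Stable sv τ S) (hl : τ' ≤ τ) : Stable sv τ' S :=
  fun V hV hn h0 => le_trans hl (h V hV hn h0)

theorem stab0 (hcc : ∀ j, c j ≤ 1) : Stable sv (sv 7) (stt c 0 (inS 0)) := by
  intro V hV hne h0
  by_contra hc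
  push Not at hc
  obtain ⟨⟨j, k⟩, hx⟩ := hne
  have hm := (mem_stt hcc).1 (hV hx)
  have hj : j = 0 := by omega
  subst hj
  have hk : inS 0 k := by
    rcases hm with h | h
    · omega
    · exact h.2.2
  have := (skel le_rfl hc le_rfl (fun k hk => (mem_stt hcc).2 (Or.inr ⟨rfl, by unfold inS at hk; omega, hk⟩)) k hk).1 hx
  exact h0 this

/-- layers inside the top block -/
theorem stt_layer (hcc : ∀ j, c j ≤ 1) {Q Q' : ℕ → Prop} (hS : Stable sv τ (stt c i Q)) (hQ : ∀ k, Q k → Q' k)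
    (hW : ∀ V : Finset (ℤ × ℕ), V ⊆ stt c i Q' → V.Nonempty → (∀ x ∈ V, x.1 = i ∧ ¬ Q x.2 ∧ Q' x.2) →
      ((0 : ℤ), 1) ∉ V → τ ≤ con sv V (stt c i Q' \ V)) : Stable sv τ (stt c i Q') := by
  refine hS.layer (W := stt c i Q' \ stt c i Q) ?_ ?_
  · rintro ⟨j, k⟩
    rw [Finset.mem_sdiff, mem_stt hcc, mem_stt hcc]
    have := hQ k
    tauto
  · intro V hV hne hn h0
    refine hW V (fun x hx => (Finset.mem_sdiff.1 (hV hx)).1) hne ?_ h0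
    rintro ⟨j, k⟩ hx
    have h1 := (mem_stt hcc).1 (Finset.mem_sdiff.1 (hV hx)).1
    have h2 := hn _ hx
    rw [mem_stt hcc] at h2
    dsimp only
    tauto

theorem stabY (H : Hyp sv) (hcc : ∀ j, c j ≤ 1) (hS : Stable sv (sv 7) (stt c i (inS i))) :
    Stable sv (sv 7) (stt c i (QY i)) := by
  refine stt_layer hcc hS (fun k h => Or.inl h) ?_
  intro V hV hne hm h0
  have b1 := H.b1
  have hi : ∀ k, QY i k → (i, k) ∈ stt c i (QY i) := fun k hk =>
    (mem_stt hcc).2 (Or.inr ⟨rfl, by unfold QY inS at hk; omega, hk⟩)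
  have hns : ∀ k, inS i k → (i, k) ∉ V := fun k hk hv => (hm _ hv).2.1 hk
  have g25 := hns 25 (by unfold inS; omega)
  have g31 := hns 31 (by unfold inS; omega)
  have g18 := hns 18 (by unfold inS; omega)
  have g24 := hns 24 (by unfold inS; omega)
  have f25 := hi 25 (by unfold QY inS; omega)
  have f31 := hi 31 (by unfold QY inS; omega)
  have f18 := hi 18 (by unfold QY inS; omega)
  have f24 := hi 24 (by unfold QY inS; omega)
  have f48 := hi 48 (by unfold QY inS; omega)
  have f49 := hi 49 (by unfold QY inS; omega)
  have f50 := hi 50 (by unfold QY inS; omega)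
  have f51 := hi 51 (by unfold QY inS; omega)
  have hone : (i, 48) ∈ V ∨ (i, 49) ∈ V ∨ (i, 50) ∈ V ∨ (i, 51) ∈ V := by
    obtain ⟨⟨j, k⟩, hx⟩ := hne
    obtain ⟨a, b, d⟩ := hm _ hx
    dsimp only at a b d
    subst a
    have : k = 48 ∨ k = 49 ∨ k = 50 ∨ k = 51 := by unfold QY at d; have := d.resolve_left b; omega
    rcases this with rfl | rfl | rfl | rfl <;> simp [hx]
  have := cutF sv V (stt c i (QY i) \ V) i [(0, 0, 48, 25, 2), (0, 0, 49, 31, 2), (0, 0, 50, 18, 2), (0, 0, 51, 24, 2),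
    (0, 0, 48, 49, 2), (0, 0, 49, 48, 2), (0, 0, 48, 50, 2), (0, 0, 50, 48, 2), (0, 0, 49, 51, 2), (0, 0, 51, 49, 2),
    (0, 0, 50, 51, 2), (0, 0, 51, 50, 2)] (by decide +kernel) (by decide +kernel)
  refine le_trans ?_ this
  by_cases a : (i, 48) ∈ V <;> by_cases b : (i, 49) ∈ V <;> by_cases d : (i, 50) ∈ V <;> by_cases e : (i, 51) ∈ V <;>
    simp [a, b, d, e] at hone <;> 
    simp [a, b, d, e, g25, g31, g18, g24, f25, f31, f18, f24, f48, f49, f50, f51] <;> omega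

def QYZ (i : ℤ) (k : ℕ) : Prop := QY i k ∨ (54 ≤ k ∧ k < 58)

theorem stabZ (H : Hyp sv) (hcc : ∀ j, c j ≤ 1) (hS : Stable sv (sv 7) (stt c i (QY i))) :
    Stable sv (sv 7) (stt c i (QYZ i)) := by
  refine stt_layer hcc hS (fun k h => Or.inl h) ?_
  intro V hV hne hm h0
  have b1 := H.b1
  have hi : ∀ k, QYZ i k → (i, k) ∈ stt c i (QYZ i) := fun k hk =>
    (mem_stt hcc).2 (Or.inr ⟨rfl, by unfold QYZ QY inS at hk; omega, hk⟩)
  have hns : ∀ k, inS i k → (i, k) ∉ V := fun k hk hv => (hm _ hv).2.1 (Or.inl hk)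
  have g25 := hns 11 (by unfold inS; omega)
  have g31 := hns 14 (by unfold inS; omega)
  have g18 := hns 6 (by unfold inS; omega)
  have g24 := hns 2 (by unfold inS; omega)
  have f25 := hi 11 (by unfold QYZ QY inS; omega)
  have f31 := hi 14 (by unfold QYZ QY inS; omega)
  have f18 := hi 6 (by unfold QYZ QY inS; omega)
  have f24 := hi 2 (by unfold QYZ QY inS; omega)
  have f48 := hi 54 (by unfold QYZ QY inS; omega)
  have f49 := hi 55 (by unfold QYZ QY inS; omega)
  have f50 := hi 56 (by unfold QYZ QY inS; omega)
  have f51 := hi 57 (by unfold QYZ QY inS; omega)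
  have hone : (i, 54) ∈ V ∨ (i, 55) ∈ V ∨ (i, 56) ∈ V ∨ (i, 57) ∈ V := by
    obtain ⟨⟨j, k⟩, hx⟩ := hne
    obtain ⟨a, b, d⟩ := hm _ hx
    dsimp only at a b d
    subst a
    have : k = 54 ∨ k = 55 ∨ k = 56 ∨ k = 57 := by unfold QYZ at d; have := d.resolve_left b; omega
    rcases this with rfl | rfl | rfl | rfl <;> simp [hx]
  have := cutF sv V (stt c i (QYZ i) \ V) i [(0, 0, 54, 11, 2), (0, 0, 55, 14, 2), (0, 0, 56, 6, 2), (0, 0, 57, 2, 2),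
    (0, 0, 54, 55, 2), (0, 0, 55, 54, 2), (0, 0, 54, 56, 2), (0, 0, 56, 54, 2), (0, 0, 55, 57, 2), (0, 0, 57, 55, 2),
    (0, 0, 56, 57, 2), (0, 0, 57, 56, 2)] (by decide +kernel) (by decide +kernel)
  refine le_trans ?_ this
  by_cases a : (i, 54) ∈ V <;> by_cases b : (i, 55) ∈ V <;> by_cases d : (i, 56) ∈ V <;> by_cases e : (i, 57) ∈ V <;>
    simp [a, b, d, e] at hone <;> 
    simp [a, b, d, e, g25, g31, g18, g24, f25, f31, f18, f24, f48, f49, f50, f51] <;> omega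

theorem stabDE (H : Hyp sv) (hcc : ∀ j, c j ≤ 1) {Q Q' : ℕ → Prop} {b : ℕ} (hb : (b = 0 ∧ τ ≤ sv 6) ∨ (b = 1 ∧ τ ≤ sv 7))
    (hS : Stable sv τ (stt c i Q)) (hQY : ∀ k, QY i k → Q k)
    (hQ' : ∀ k, Q' k ↔ Q k ∨ (34 + 7 * b ≤ k ∧ k < 41 + 7 * b)) :
    Stable sv τ (stt c i Q') := by
  have a67 := H.a67
  have b1 := H.b1
  have b3 := H.b3
  refine stt_layer hcc hS (fun k h => (hQ' k).2 (Or.inl h)) ?_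
  intro V hV hne hm h0
  by_contra hcut
  push Not at hcut
  have hi : ∀ k, k < 58 → Q' k → (i, k) ∈ stt c i Q' := fun k h58 hk =>
    (mem_stt hcc).2 (Or.inr ⟨rfl, h58, hk⟩)
  have hch := chainDE (by omega) hcut (b := b) (j := i) (by omega)
    (fun k h1 h2 => hi k (by omega) ((hQ' k).2 (Or.inr ⟨h1, h2⟩)))
  have hall : ∀ k, 34 + 7 * b ≤ k → k < 41 + 7 * b → (i, k) ∈ V := by
    obtain ⟨⟨j, k⟩, hx⟩ := hne
    obtain ⟨e1, e2, e3⟩ := hm _ hx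
    dsimp only at e1 e2 e3
    subst e1
    have e4 := ((hQ' k).1 e3).resolve_left e2
    have := (hch k e4.1 e4.2).1 hx
    intro k' h1 h2
    exact (hch k' h1 h2).2 this
  have hns : ∀ k, QY i k → (i, k) ∉ V ∧ (i, k) ∈ stt c i Q' := fun k hk =>
    ⟨fun hv => (hm _ hv).2.1 (hQY k hk), hi k (by unfold QY inS at hk; omega) ((hQ' k).2 (Or.inl (hQY k hk)))⟩
  have g28 := hns 28 (by unfold QY inS; omega)
  have g29 := hns 29 (by unfold QY inS; omega)
  have g48 := hns 48 (by unfold QY inS; omega)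
  have g49 := hns 49 (by unfold QY inS; omega)
  rcases hb with ⟨rfl, hτ⟩ | ⟨rfl, hτ⟩
  · have := cutF sv V (stt c i Q' \ V) i [(0, 0, 34, 28, 4), (0, 0, 40, 48, 2)] (by decide +kernel) (by decide +kernel)
    have m1 := hall 34 (by omega) (by omega)
    have m2 := hall 40 (by omega) (by omega)
    simp [g28, g48, m1, m2] at this
    omega
  · have := cutF sv V (stt c i Q' \ V) i [(0, 0, 47, 29, 2), (0, 0, 47, 48, 2), (0, 0, 46, 49, 2)] (by decide +kernel) (by decide +kernel)
    have m1 := hall 47 (by omega) (by omega)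
    have m2 := hall 46 (by omega) (by omega)
    simp [g29, g48, g49, m1, m2] at this
    omega

set_option maxHeartbeats 1000000 in
theorem stab_next (H : Hyp sv) (hcc : ∀ j, c j ≤ 1) (hi : 0 ≤ i) (hS : Stable sv (sv 7) (stt c i (QYZ i))) :
    Stable sv (sv 7) (stt c (i + 1) (inS (i + 1))) := by
  have b1 := H.b1
  have b4 := H.b4
  have a34 := H.a34
  have a23 := H.a23
  have hci := hcc i
  have hful : ∀ k, full c i k ↔ QYZ i k ∨ (34 + 7 * c i ≤ k ∧ k < 41 + 7 * c i) := by
    intro k; unfold full QYZ QY; tauto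
  have hmem : ∀ j k, (j, k) ∈ stt c (i + 1) (inS (i + 1)) ↔
      (j, k) ∈ stt c i (QYZ i) ∨ (j = i ∧ 34 + 7 * c i ≤ k ∧ k < 41 + 7 * c i) ∨ (j = i + 1 ∧ inS (i + 1) k) := by
    intro j k
    rw [mem_stt hcc, mem_stt hcc]
    have e1 : inS (i + 1) k → k < 58 := by unfold inS; omega
    have e2 : QYZ i k → k < 58 := by unfold QYZ QY inS; omega
    by_cases hj : j = i
    · subst hj
      rw [hful]
      constructor
      · rintro (h | h)
        · tauto
        · omega
      · rintro (h | h | h)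
        · refine Or.inl ⟨hi, by omega, ?_⟩
          rcases h with h | h
          · omega
          · tauto
        · exact Or.inl ⟨hi, by omega, Or.inr h.2⟩
        · omega
    · constructor
      · rintro (h | h)
        · exact Or.inl (Or.inl ⟨h.1, by omega, h.2.2⟩)
        · tauto
      · rintro (h | h | h)
        · rcases h with h | h
          · exact Or.inl ⟨h.1, by omega, h.2.2⟩
          · omega
        · omega
        · tauto
  set R := stt c (i + 1) (inS (i + 1)) with hRdef
  refine hS.layer (W := R \ stt c i (QYZ i)) ?_ ?_
  · rintro ⟨j, k⟩
    rw [Finset.mem_sdiff, hmem]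
    tauto
  intro V hV hne hn h0
  by_contra hcut
  push Not at hcut
  have hVR : V ⊆ R := fun x hx => (Finset.mem_sdiff.1 (hV hx)).1
  have hD := chainDE le_rfl hcut (b := c i) (j := i) hci (fun k h1 h2 => (hmem i k).2 (Or.inr (Or.inl ⟨rfl, h1, h2⟩)))
  have hK := skel le_rfl hcut (j := i + 1) (by omega) (fun k hk => (hmem _ k).2 (Or.inr (Or.inr ⟨rfl, hk⟩)))
  have r0 : root (i + 1) = 0 := if_neg (by omega)
  rw [r0] at hK
  have hns : ∀ k, QYZ i k → (i, k) ∉ V ∧ (i, k) ∈ R := fun k hk => by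
    have : (i, k) ∈ stt c i (QYZ i) := (mem_stt hcc).2 (Or.inr ⟨rfl, by unfold QYZ QY inS at hk; omega, hk⟩)
    exact ⟨fun hv => hn _ hv this, (hmem _ _).2 (Or.inl this)⟩
  have g28 := hns 28 (by unfold QYZ QY inS; omega)
  have g29 := hns 29 (by unfold QYZ QY inS; omega)
  have g48 := hns 48 (by unfold QYZ QY inS; omega)
  have g49 := hns 49 (by unfold QYZ QY inS; omega)
  have g54 := hns 54 (by unfold QYZ QY inS; omega)
  have g55 := hns 55 (by unfold QYZ QY inS; omega)
  have k18 := hK 18 (by unfold inS; omega)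
  have k32 := hK 32 (by unfold inS; omega)
  have k33 := hK 33 (by unfold inS; omega)
  have m18 : (i + 1, 18) ∈ R := (hmem _ _).2 (Or.inr (Or.inr ⟨rfl, by unfold inS; omega⟩))
  have hone : (i, 34 + 7 * c i) ∈ V ∨ (i + 1, 0) ∈ V := by
    obtain ⟨⟨j, k⟩, hx⟩ := hne
    rcases ((hmem j k).1 (hVR hx)).resolve_left (hn _ hx) with ⟨rfl, h1, h2⟩ | ⟨rfl, h1⟩
    · exact Or.inl ((hD k h1 h2).1 hx)
    · exact Or.inr ((hK k h1).1 hx)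
  have hcc2 : c i = 0 ∨ c i = 1 := by omega
  have mR : ∀ k, 34 + 7 * c i ≤ k → k < 41 + 7 * c i → (i, k) ∈ R := fun k h1 h2 => (hmem i k).2 (Or.inr (Or.inl ⟨rfl, h1, h2⟩))
  rcases hcc2 with h | h <;> rw [h] at hD hone mR
  · have d40 := hD 40 (by omega) (by omega)
    have m40 := mR 40 (by omega) (by omega)
    have := cutF sv V (R \ V) i [(0, 0, 34, 28, 4), (0, 0, 40, 48, 2), (0, 1, 40, 18, 2), (1, -1, 18, 40, 2),
      (1, -1, 32, 54, 2), (1, -1, 33, 55, 2)] (by decide +kernel) (by decide +kernel)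
    simp only [mul_zero, add_zero] at *
    by_cases e1 : (i, 34) ∈ V <;> by_cases e2 : (i + 1, 0) ∈ V <;>
    simp [e1, e2, g28, g48, g54, g55, m18, m40, k18, k32, k33, d40] at this hone <;> omega
  · have d46 := hD 46 (by omega) (by omega)
    have d47 := hD 47 (by omega) (by omega)
    have m47 := mR 47 (by omega) (by omega)
    have := cutF sv V (R \ V) i [(0, 0, 47, 29, 2), (0, 0, 47, 48, 2), (0, 0, 46, 49, 2), (1, -1, 18, 47, 2),
      (1, -1, 32, 54, 2), (1, -1, 33, 55, 2)] (by decide +kernel) (by decide +kernel)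
    simp only [mul_one, Nat.reduceAdd] at *
    by_cases e1 : (i, 41) ∈ V <;> by_cases e2 : (i + 1, 0) ∈ V <;>
    simp [e1, e2, g29, g48, g49, g54, g55, m47, k18, k32, k33, d46, d47] at this hone <;> omega

theorem stabA (H : Hyp sv) (hcc : ∀ j, c j ≤ 1) : ∀ n : ℕ, Stable sv (sv 7) (stt c n (inS n)) := by
  intro n
  induction n with
  | zero => exact stab0 hcc
  | succ n ih =>
    push_cast
    exact stab_next H hcc (by omega) (stabZ H hcc (stabY H hcc ih))

theorem stabs (H : Hyp sv) (hcc : ∀ j, c j ≤ 1) (hi : 0 ≤ i) :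
    Stable sv (sv 7) (stt c i (inS i)) ∧ Stable sv (sv 7) (stt c i (QY i)) ∧ Stable sv (sv 6) (stt c i (Q1 c i)) ∧
    Stable sv (sv 6) (stt c i (full c i)) := by
  have a67 := H.a67
  have hA : Stable sv (sv 7) (stt c i (inS i)) := by
    have := stabA H hcc i.toNat
    rwa [Int.toNat_of_nonneg hi] at this
  have hY := stabY H hcc hA
  have hZ := stabZ H hcc hY
  have hci := hcc i
  refine ⟨hA, hY, ?_, ?_⟩
  · refine stabDE H hcc (b := c i) (by omega) (hY.le (by omega)) (fun k h => h) ?_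
    intro k; unfold Q1 QY; tauto
  · refine stabDE H hcc (b := c i) (by omega) (hZ.le (by omega)) (fun k h => Or.inl h) ?_
    intro k; unfold full QYZ QY; tauto
end
end TA

namespace TA

theorem hxy_chk : (List.range 58).all (fun k => decide (hx k ≤ 4) && (List.range 58).all (fun k' =>
    decide (hy k ≠ hy k') || ((decide (hx k ≠ hx k') || (decide (k = k') || (decide (k + k' = 1) ||
      (decide (34 ≤ k ∧ k < 41 ∧ k' = k + 7) || decide (34 ≤ k' ∧ k' < 41 ∧ k = k' + 7))))) &&
      (decide (hx k ≠ hx k' + 4) || (decide (k = 52 ∧ k' = 33) || decide (k = 53 ∧ k' = 32)))))) = true := by decide +kernel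

theorem hxy {k k' : ℕ} (hk : k < 58) (hk' : k' < 58) : hx k ≤ 4 ∧ (hy k = hy k' →
    (hx k = hx k' → k = k' ∨ k + k' = 1 ∨ (34 ≤ k ∧ k < 41 ∧ k' = k + 7) ∨ (34 ≤ k' ∧ k' < 41 ∧ k = k' + 7)) ∧
    (hx k = hx k' + 4 → (k = 52 ∧ k' = 33) ∨ (k = 53 ∧ k' = 32))) := by
  have h := List.all_eq_true.1 hxy_chk k (List.mem_range.2 hk)
  rw [Bool.and_eq_true] at h
  have h2 := List.all_eq_true.1 h.2 k' (List.mem_range.2 hk')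
  have h1 := h.1
  simp only [Bool.or_eq_true, Bool.and_eq_true, decide_eq_true_eq] at h1 h2
  refine ⟨h1, fun e => ?_⟩
  have h3 := h2.resolve_left (fun hn => hn e)
  exact ⟨fun e' => h3.1.resolve_left (fun hn => hn e'), fun e' => h3.2.resolve_left (fun hn => hn e')⟩

theorem ps_eq {k k' : ℕ} {j j' : ℤ} (hk : k < 58) (hk' : k' < 58) (h : ps (j, k) = ps (j', k')) :
    (j = j' ∧ (k = k' ∨ k + k' = 1 ∨ (34 ≤ k ∧ k < 41 ∧ k' = k + 7) ∨ (34 ≤ k' ∧ k' < 41 ∧ k = k' + 7))) ∨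
    (j' = j + 1 ∧ ((k = 52 ∧ k' = 33) ∨ (k = 53 ∧ k' = 32))) ∨
    (j = j' + 1 ∧ ((k' = 52 ∧ k = 33) ∨ (k' = 53 ∧ k = 32))) := by
  simp only [ps, Prod.mk.injEq] at h
  obtain ⟨a1, a2⟩ := hxy hk hk'
  obtain ⟨b1, b2⟩ := hxy hk' hk
  have ey : hy k = hy k' := by omega
  have a3 := a2 ey
  have b3 := b2 ey.symm
  have : j = j' ∨ j' = j + 1 ∨ j = j' + 1 := by omega
  rcases this with e | e | e
  · exact Or.inl ⟨e, a3.1 (by omega)⟩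
  · exact Or.inr (Or.inl ⟨e, a3.2 (by omega)⟩)
  · exact Or.inr (Or.inr ⟨e, b3.2 (by omega)⟩)

section
variable {sv : ℕ → ℕ} {τ : ℕ} {c : ℤ → ℕ} {i : ℤ}

theorem nice_stt (hcc : ∀ j, c j ≤ 1) {Q : ℕ → Prop} (h01 : ¬ (Q 0 ∧ Q 1))
    (hDE : ∀ k, 34 ≤ k → k < 41 → ¬ (Q k ∧ Q (k + 7))) : Nice (stt c i Q) := by
  have h58 : ∀ j k, (j, k) ∈ stt c i Q → k < 58 := by
    intro j k h
    rcases (mem_stt hcc).1 h with h | h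
    · have := hcc j
      have := h.2.2
      unfold full inS at this
      omega
    · exact h.2.1
  refine ⟨fun x hx => h58 x.1 x.2 hx, ?_⟩
  rintro ⟨j, k⟩ h1 ⟨j', k'⟩ h2 e
  have e1 := h58 _ _ h1
  have e2 := h58 _ _ h2
  have hc1 := hcc j
  have hc2 := hcc j'
  rw [mem_stt hcc] at h1 h2
  rcases ps_eq e1 e2 e with ⟨rfl, h⟩ | ⟨rfl, h⟩ | ⟨rfl, h⟩
  · rcases h with rfl | h | ⟨d1, d2, rfl⟩ | ⟨d1, d2, rfl⟩
    · rfl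
    · exfalso
      rcases h1 with h1 | h1 <;> rcases h2 with h2 | h2 <;> try omega
      · have := h1.2.2
        have := h2.2.2
        unfold full inS at *
        omega
      · have : (k = 0 ∧ k' = 1) ∨ (k = 1 ∧ k' = 0) := by omega
        rcases this with ⟨rfl, rfl⟩ | ⟨rfl, rfl⟩
        · exact h01 ⟨h1.2.2, h2.2.2⟩
        · exact h01 ⟨h2.2.2, h1.2.2⟩
    · exfalso
      rcases h1 with h1 | h1 <;> rcases h2 with h2 | h2 <;> try omega
      · have := h1.2.2
        have := h2.2.2
        unfold full inS at *
        omega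
      · exact hDE _ d1 d2 ⟨h1.2.2, h2.2.2⟩
    · exfalso
      rcases h1 with h1 | h1 <;> rcases h2 with h2 | h2 <;> try omega
      · have := h1.2.2
        have := h2.2.2
        unfold full inS at *
        omega
      · exact hDE _ d1 d2 ⟨h2.2.2, h1.2.2⟩
  · exfalso
    rcases h1 with h1 | h1
    · have := h1.2.2
      unfold full inS at this
      omega
    · omega
  · exfalso
    rcases h2 with h2 | h2
    · have := h2.2.2
      unfold full inS at this
      omega
    · omega

def GJ (sv : ℕ → ℕ) (τ : ℕ) (lo R : Finset (ℤ × ℕ)) (P : Finset (ℤ × ℕ) → Prop) (S : Finset (ℤ × ℕ)) : Prop :=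
  lo ⊆ S ∧ S ⊆ R ∧ ((0 : ℤ), 1) ∈ S ∧ Stable sv τ S ∧ P S

open Classical in
theorem grow (H : Hyp sv) (h3 : sv 3 ≤ τ) {lo R S0 : Finset (ℤ × ℕ)} {P : Finset (ℤ × ℕ) → Prop} (hR : Nice R)
    (hatt : ∀ S j U, GJ sv τ lo R P S → AInv sv τ U → Disj S j U → τ ≤ con sv (blk j U) S →
      blk j U ⊆ R ∧ P (S ∪ blk j U))
    (hprog : ∀ S, GJ sv τ lo R P S → S ≠ R → CanStep sv τ S)
    (hst : GJ sv τ lo R P S0 ∨ (Nice S0 ∧ (∀ j U, AInv sv τ U → Disj S0 j U → τ ≤ con sv (blk j U) S0 → False) ∧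
      (∀ V ⊆ S0, V.Nonempty → ((0 : ℤ), 1) ∉ V → con sv V (S0 \ V) < τ → GJ sv τ lo R P (S0 \ V)) ∧
      CanStep sv τ S0)) : PhOK sv τ S0 R := by
  by_cases hG : GJ sv τ lo R P S0
  · have key : ∀ S j U, GJ sv τ lo R P S → AInv sv τ U → Disj S j U → τ ≤ con sv (blk j U) S →
        GJ sv τ lo R P (S ∪ blk j U) ∧ (R \ (S ∪ blk j U)).card < (R \ S).card := by
      intro S j U hJ hA hd hc
      obtain ⟨h1, h2⟩ := hatt S j U hJ hA hd hc
      refine ⟨⟨hJ.1.trans Finset.subset_union_left, Finset.union_subset hJ.2.1 h1,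
        Finset.mem_union_left _ hJ.2.2.1, hJ.2.2.2.1.attach hA hc hd, h2⟩, ?_⟩
      refine Finset.card_lt_card ⟨Finset.sdiff_subset_sdiff le_rfl Finset.subset_union_left, ?_⟩
      intro hsub
      obtain ⟨k, hk⟩ := hA.ne
      have hm : (j, k) ∈ blk j U := mem_blk.2 ⟨rfl, hk⟩
      have : (j, k) ∈ R \ S := Finset.mem_sdiff.2 ⟨h1 hm, fun hs => hd _ hs _ hm rfl⟩
      exact (Finset.mem_sdiff.1 (hsub this)).2 (Finset.mem_union_right _ hm)
    refine phase H h3 (GJ sv τ lo R P) (fun S => (R \ S).card) R (fun S hS => hR.sub hS.2.1) key ?_ hprog hG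
    intro S V hJ hV hne h0 hc
    exact absurd (hJ.2.2.2.1 V hV hne h0) (not_le.2 hc)
  · obtain ⟨q1, q2, q3, q4⟩ := hst.resolve_left hG
    refine phase H h3 (fun S => GJ sv τ lo R P S ∨ S = S0)
      (fun S => if GJ sv τ lo R P S then (R \ S).card else R.card + 1) R ?_ ?_ ?_ ?_ (Or.inr rfl)
    · rintro S (h | rfl)
      · exact hR.sub h.2.1
      · exact q1
    · rintro S j U (hJ | rfl) hA hd hc
      · obtain ⟨h1, h2⟩ := hatt S j U hJ hA hd hc
        have hn : GJ sv τ lo R P (S ∪ blk j U) := ⟨hJ.1.trans Finset.subset_union_left, Finset.union_subset hJ.2.1 h1,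
          Finset.mem_union_left _ hJ.2.2.1, hJ.2.2.2.1.attach hA hc hd, h2⟩
        refine ⟨Or.inl hn, ?_⟩
        rw [if_pos hn, if_pos hJ]
        refine Finset.card_lt_card ⟨Finset.sdiff_subset_sdiff le_rfl Finset.subset_union_left, ?_⟩
        intro hsub
        obtain ⟨k, hk⟩ := hA.ne
        have hm : (j, k) ∈ blk j U := mem_blk.2 ⟨rfl, hk⟩
        have : (j, k) ∈ R \ S := Finset.mem_sdiff.2 ⟨h1 hm, fun hs => hd _ hs _ hm rfl⟩
        exact (Finset.mem_sdiff.1 (hsub this)).2 (Finset.mem_union_right _ hm)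
      · exact (q2 j U hA hd hc).elim
    · rintro S V (hJ | rfl) hV hne h0 hc
      · exact absurd (hJ.2.2.2.1 V hV hne h0) (not_le.2 hc)
      · have := q3 V hV hne h0 hc
        refine ⟨Or.inl this, ?_⟩
        rw [if_pos this, if_neg hG]
        exact Nat.lt_succ_of_le (Finset.card_le_card Finset.sdiff_subset)
    · rintro S (hJ | rfl) hne
      · exact hprog S hJ hne
      · exact q4

theorem free {S R : Finset (ℤ × ℕ)} (hR : Nice R) (hS : S ⊆ R) {x : ℤ × ℕ} (hx : x ∈ R) (hn : x ∉ S) :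
    ∀ y ∈ S, ps y ≠ ps x := fun y hy e => hn (hR.2 y (hS hy) x hx e ▸ hy)

theorem sup1 (h7 : τ ≤ sv 7) {S R : Finset (ℤ × ℕ)} (hR : Nice R) (hS : S ⊆ R) {j : ℤ} {k : ℕ} (hx : (j, k) ∈ R) (hn : (j, k) ∉ S)
    {k' l : ℕ} (he : ((0 : ℤ), k, k', l) ∈ EL) (hk' : (j, k') ∈ S) (hl : τ ≤ sv l) : CanStep sv τ S := by
  refine can_attach h7 (hR.sub hS) j [k] (by simp) (by simpa [chOK] using hR.1 _ hx) ?_ ?_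
  · intro x hxS k2 hk2
    rw [List.mem_singleton] at hk2
    subst hk2
    exact free hR hS hx hn x hxS
  · have := cutF sv (blk j [k].toFinset) S j [(0, 0, k, k', l)] (by simpa using he) (by simp)
    simp [mem_blk, hk'] at this
    simpa using hl.trans this

theorem sup2 (h7 : τ ≤ sv 7) {S R : Finset (ℤ × ℕ)} (hR : Nice R) (hS : S ⊆ R) {j : ℤ} {k : ℕ} (hx : (j, k) ∈ R) (hn : (j, k) ∉ S)
    {k' l k2 l2 : ℕ} (he : ((0 : ℤ), k, k', l) ∈ EL) (he2 : ((0 : ℤ), k, k2, l2) ∈ EL) (hne : k' ≠ k2) (hk' : (j, k') ∈ S)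
    (hk2 : (j, k2) ∈ S) (hl : τ ≤ sv l + sv l2) : CanStep sv τ S := by
  refine can_attach h7 (hR.sub hS) j [k] (by simp) (by simpa [chOK] using hR.1 _ hx) ?_ ?_
  · intro x hxS k2 hk2
    rw [List.mem_singleton] at hk2
    subst hk2
    exact free hR hS hx hn x hxS
  · have := cutF sv (blk j [k].toFinset) S j [(0, 0, k, k', l), (0, 0, k, k2, l2)] (by simp [he, he2]) (by simp [hne])
    simp [mem_blk, hk', hk2] at this
    simpa using hl.trans this

theorem skel_prog (h7 : τ ≤ sv 7) {S R : Finset (ℤ × ℕ)} (hR : Nice R) (hS : S ⊆ R) {j : ℤ} (hj : 0 ≤ j)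
    (hin : ∀ k, inS j k → (j, k) ∈ R) (hroot : (j, root j) ∈ S) (hno : ¬ CanStep sv τ S) :
    ∀ k, inS j k → (j, k) ∈ S := by
  have h1 : ∀ k, 2 ≤ k → k < 32 → (j, k) ∈ S := by
    intro k
    induction k using Nat.strong_induction_on with
    | _ k ih =>
      intro h2 h32
      obtain ⟨a, b, e1, e2, e3⟩ := par_chk k (List.mem_range.2 h32) h2
      have hk : (j, k) ∈ R := hin k (Or.inl ⟨h2, h32⟩)
      by_contra hn
      by_cases h0 : par.getD k 0 = 0
      · obtain ⟨e4, e5⟩ := e3 h0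
        rw [h0] at e1 e2
        refine hno (sup1 h7 hR hS hk hn (l := 7) ?_ hroot h7)
        unfold root; split_ifs <;> assumption
      · exact hno (sup1 h7 hR hS hk hn e2 (ih _ a (by omega) (by omega)) h7)
  intro k hk
  by_cases h : 2 ≤ k ∧ k < 32
  · exact h1 k h.1 h.2
  by_cases hj0 : j = 0
  · have : k = 1 := by unfold inS at hk; omega
    rw [this]
    unfold root at hroot
    rwa [if_pos hj0] at hroot
  · have e : root j = 0 := if_neg hj0
    rw [e] at hroot
    have m2 : (j, 32) ∈ S := by
      by_contra hn
      exact hno (sup1 h7 hR hS (hin 32 (by unfold inS; omega)) hn (k' := 0) (l := 7) (by decide +kernel) hroot h7)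
    have m3 : (j, 33) ∈ S := by
      by_contra hn
      exact hno (sup1 h7 hR hS (hin 33 (by unfold inS; omega)) hn (k' := 32) (l := 7) (by decide +kernel) m2 h7)
    have : k = 0 ∨ k = 32 ∨ k = 33 := by unfold inS at hk; omega
    rcases this with rfl | rfl | rfl <;> assumption

theorem stt_mono (hcc : ∀ j, c j ≤ 1) {Q Q' : ℕ → Prop} (h : ∀ k, Q k → Q' k) : stt c i Q ⊆ stt c i Q' := by
  rintro ⟨j, k⟩ hx
  rw [mem_stt hcc] at *
  have := h k
  tauto

theorem seed_stt (hcc : ∀ j, c j ≤ 1) (hi : 0 ≤ i) {Q : ℕ → Prop} (h : ∀ k, inS i k → Q k) : ((0 : ℤ), 1) ∈ stt c i Q := by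
  rw [mem_stt hcc]
  by_cases h0 : i = 0
  · exact Or.inr ⟨h0.symm, by norm_num, h 1 (by unfold inS; omega)⟩
  · exact Or.inl ⟨le_rfl, by omega, by unfold full inS; omega⟩

theorem nice4 (hcc : ∀ j, c j ≤ 1) : Nice (stt c i (Q4 i)) := by
  refine nice_stt hcc ?_ ?_
  · unfold Q4 inS; omega
  · intro k; unfold Q4 inS; omega

theorem nice2 (hcc : ∀ j, c j ≤ 1) : Nice (stt c i (Q2 c i)) := by
  have := hcc i
  refine nice_stt hcc ?_ ?_
  · unfold Q2 full inS; omega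
  · intro k; unfold Q2 full inS; omega

theorem niceE (hcc : ∀ j, c j ≤ 1) : Nice (stt c i (QE i)) := by
  refine nice_stt hcc ?_ ?_
  · unfold QE inS; omega
  · intro k; unfold QE inS; omega

theorem niceS (hcc : ∀ j, c j ≤ 1) : Nice (stt c i (inS i)) := by
  refine nice_stt hcc ?_ ?_
  · unfold inS; omega
  · intro k; unfold inS; omega

theorem ext_stt (hcc : ∀ j, c j ≤ 1) {Q Q' : ℕ → Prop} {S : Finset (ℤ × ℕ)} (hlo : stt c i Q ⊆ S) (hup : S ⊆ stt c i Q')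
    (h : ∀ k, k < 58 → Q' k → ¬ Q k → (i, k) ∈ S) : S = stt c i Q' := by
  refine Finset.Subset.antisymm hup ?_
  rintro ⟨j, k⟩ hx
  rcases (mem_stt hcc).1 hx with h1 | ⟨rfl, h1, h2⟩
  · exact hlo ((mem_stt hcc).2 (Or.inl h1))
  · by_cases hq : Q k
    · exact hlo ((mem_stt hcc).2 (Or.inr ⟨rfl, h1, hq⟩))
    · exact h k h1 h2 hq

theorem DE_chk2 : ∀ k ∈ List.range 47, 34 ≤ k → k ≠ 40 → ((0 : ℤ), k, k + 1, 7) ∈ EL ∧ ((0 : ℤ), k + 1, k, 7) ∈ EL := by decide +kernel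

/-- phase `4 i` -/
theorem phase4 (H : Hyp sv) (hcc : ∀ j, c j ≤ 1) (hi : 0 ≤ i) {S0 : Finset (ℤ × ℕ)}
    (hS0 : (i = 0 ∧ S0 = {((0 : ℤ), 1)}) ∨ S0 = stt c i (inS i) ∨ (c i = 0 ∧ S0 = stt c i (Q4 i))) :
    PhOK sv (sv 4) S0 (stt c i (Q4 i)) := by
  have a23 := H.a23
  have a34 := H.a34
  have a46 := H.a46
  have a67 := H.a67
  have b4 := H.b4
  have hN : Nice (stt c i (Q4 i)) := nice4 hcc
  have hsub : stt c i (inS i) ⊆ stt c i (Q4 i) := stt_mono hcc (fun k h => Or.inl h)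
  obtain ⟨t1, t2, t3, t4⟩ := stabs H hcc hi
  refine grow H (by omega) (lo := if i = 0 then {((0 : ℤ), 1)} else stt c i (inS i))
    (P := fun S => ∀ y, 48 ≤ y → y < 52 → (i, y) ∈ S → (i, 40) ∈ S) hN ?_ ?_ (Or.inl ?_)
  · rintro S j U ⟨h1, h2, h3, h4, h5⟩ hA hd hc
    obtain ⟨rfl, g2, g3⟩ := att4 H hcc hi le_rfl hA (fun h => by rwa [if_neg (by omega)] at h1) h3 h2 h5 hd hc
    constructor
    · rintro ⟨a, k⟩ hx
      obtain ⟨rfl, hk⟩ := mem_blk.1 hx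
      exact (mem_stt hcc).2 (Or.inr ⟨rfl, hA.lt k hk, g2 k hk⟩)
    · intro y y1 y2 hy
      rcases Finset.mem_union.1 hy with hy | hy
      · exact Finset.mem_union_left _ (h5 y y1 y2 hy)
      · rcases g3 ⟨y, (mem_blk.1 hy).2, y1, y2⟩ with h | h
        · exact Finset.mem_union_right _ (mem_blk.2 ⟨rfl, h⟩)
        · exact Finset.mem_union_left _ h
  · rintro S ⟨h1, h2, h3, h4, h5⟩ hne
    by_contra hno
    apply hne
    have hroot : (i, root i) ∈ S := by
      by_cases h0 : i = 0
      · subst h0; exact h3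
      · rw [if_neg h0] at h1
        exact h1 ((mem_stt hcc).2 (Or.inr ⟨rfl, by unfold root; rw [if_neg h0]; norm_num, by unfold root inS; rw [if_neg h0]; omega⟩))
    have hin : ∀ k, Q4 i k → (i, k) ∈ stt c i (Q4 i) := fun k hk =>
      (mem_stt hcc).2 (Or.inr ⟨rfl, by unfold Q4 inS at hk; omega, hk⟩)
    have hsk := skel_prog (by omega) hN h2 hi (fun k hk => hin k (Or.inl hk)) hroot hno
    have h7 : sv 4 ≤ sv 7 := by omega
    have hch : ∀ n, n < 7 → (i, 34 + n) ∈ S := by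
      intro n
      induction n with
      | zero =>
        intro _
        by_contra hn
        exact hno (sup1 h7 hN h2 (hin _ (by unfold Q4; omega)) hn (k' := 28) (l := 4) (by decide +kernel) (hsk 28 (by unfold inS; omega)) le_rfl)
      | succ n ih =>
        intro hlt
        by_contra hn
        have := (DE_chk2 (34 + n) (List.mem_range.2 (by omega)) (by omega) (by omega)).2
        exact hno (sup1 h7 hN h2 (hin (34 + (n + 1)) (by unfold Q4; omega)) hn (l := 7) this (ih (by omega)) h7)
    have m40 := hch 6 (by omega)
    have m48 : (i, 48) ∈ S := by
      by_contra hn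
      exact hno (sup2 h7 hN h2 (hin _ (by unfold Q4; omega)) hn (k' := 40) (k2 := 25) (l := 2) (l2 := 2) (by decide +kernel) (by decide +kernel)
        (by decide) m40 (hsk 25 (by unfold inS; omega)) (by omega))
    have m49 : (i, 49) ∈ S := by
      by_contra hn
      exact hno (sup2 h7 hN h2 (hin _ (by unfold Q4; omega)) hn (k' := 48) (k2 := 31) (l := 2) (l2 := 2) (by decide +kernel) (by decide +kernel)
        (by decide) m48 (hsk 31 (by unfold inS; omega)) (by omega))
    have m50 : (i, 50) ∈ S := by
      by_contra hn
      exact hno (sup2 h7 hN h2 (hin _ (by unfold Q4; omega)) hn (k' := 48) (k2 := 18) (l := 2) (l2 := 2) (by decide +kernel) (by decide +kernel)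
        (by decide) m48 (hsk 18 (by unfold inS; omega)) (by omega))
    have m51 : (i, 51) ∈ S := by
      by_contra hn
      exact hno (sup2 h7 hN h2 (hin _ (by unfold Q4; omega)) hn (k' := 49) (k2 := 24) (l := 2) (l2 := 2) (by decide +kernel) (by decide +kernel)
        (by decide) m49 (hsk 24 (by unfold inS; omega)) (by omega))
    have hlo : stt c i (inS i) ⊆ S := by
      by_cases h0 : i = 0
      · rintro ⟨j, k⟩ hx
        rcases (mem_stt hcc).1 hx with h | ⟨rfl, -, h⟩
        · omega
        · exact hsk k h
      · rwa [if_neg h0] at h1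
    refine ext_stt hcc hlo h2 ?_
    intro k hk hq hnq
    have : (34 ≤ k ∧ k < 41) ∨ k = 48 ∨ k = 49 ∨ k = 50 ∨ k = 51 := by
      have := hq.resolve_left hnq
      omega
    rcases this with h | rfl | rfl | rfl | rfl
    · have := hch (k - 34) (by omega)
      rwa [show 34 + (k - 34) = k by omega] at this
    all_goals assumption
  · have hlo : ∀ Q : ℕ → Prop, (∀ k, inS i k → Q k) → (if i = 0 then {((0 : ℤ), 1)} else stt c i (inS i)) ⊆ stt c i Q := by
      intro Q hQ
      split_ifs with h0
      · rw [Finset.singleton_subset_iff]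
        exact seed_stt hcc hi hQ
      · exact stt_mono hcc hQ
    rcases hS0 with ⟨rfl, rfl⟩ | rfl | ⟨h0, rfl⟩
    · refine ⟨by rw [if_pos rfl], ?_, by simp, ?_, ?_⟩
      · rw [Finset.singleton_subset_iff]
        exact seed_stt hcc hi (fun k h => Or.inl h)
      · intro V hV hne h0
        obtain ⟨x, hx⟩ := hne
        have := Finset.mem_singleton.1 (hV hx)
        exact absurd (this ▸ hx) h0
      · intro y y1 y2 hy
        rw [Finset.mem_singleton, Prod.mk.injEq] at hy
        omega
    · refine ⟨hlo _ (fun k h => h), hsub, seed_stt hcc hi (fun k h => h), t1.le (by omega), ?_⟩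
      intro y y1 y2 hy
      rcases (mem_stt hcc).1 hy with h | h
      · omega
      · have := h.2.2
        unfold inS at this
        omega
    · refine ⟨hlo _ (fun k h => Or.inl h), le_rfl, seed_stt hcc hi (fun k h => Or.inl h), ?_, ?_⟩
      · have e : Q1 c i = Q4 i := by
          funext k
          unfold Q1 Q4
          rw [h0]
        rw [e] at t3
        exact t3.le (by omega)
      · intro y y1 y2 hy
        exact (mem_stt hcc).2 (Or.inr ⟨rfl, by norm_num, by unfold Q4; omega⟩)

/-- phase `4 i + 2` -/
theorem phase3 (H : Hyp sv) (hcc : ∀ j, c j ≤ 1) (hi : 0 ≤ i) :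
    PhOK sv (sv 3) (stt c i (Q1 c i)) (stt c i (Q2 c i)) := by
  have a23 := H.a23
  have a34 := H.a34
  have a46 := H.a46
  have a67 := H.a67
  have b4 := H.b4
  have hci := hcc i
  have hN : Nice (stt c i (Q2 c i)) := nice2 hcc
  have hsub : stt c i (Q1 c i) ⊆ stt c i (Q2 c i) := stt_mono hcc (fun k h => by unfold Q1 at h; unfold Q2 full; tauto)
  obtain ⟨t1, t2, t3, t4⟩ := stabs H hcc hi
  refine grow H le_rfl (lo := stt c i (Q1 c i))
    (P := fun S => ∀ z, 54 ≤ z → (i, z) ∈ S → (i, 53) ∈ S) hN ?_ ?_ (Or.inl ?_)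
  · rintro S j U ⟨h1, h2, h3, h4, h5⟩ hA hd hc
    obtain ⟨rfl, g2, g3⟩ := att3 H hcc hi le_rfl hA h1 h3 h2 h5 hd hc
    constructor
    · rintro ⟨a, k⟩ hx
      obtain ⟨rfl, hk⟩ := mem_blk.1 hx
      dsimp only at hk ⊢
      have e1 := hA.lt k hk
      have e2 := g2 k hk
      exact (mem_stt hcc).2 (Or.inr ⟨rfl, e1, by unfold Q2 full; omega⟩)
    · intro y y1 hy
      rcases Finset.mem_union.1 hy with hy | hy
      · exact Finset.mem_union_left _ (h5 y y1 hy)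
      · rcases g3 ⟨y, (mem_blk.1 hy).2, y1⟩ with h | h
        · exact Finset.mem_union_right _ (mem_blk.2 ⟨rfl, h⟩)
        · exact Finset.mem_union_left _ h
  · rintro S ⟨h1, h2, h3, h4, h5⟩ hne
    by_contra hno
    apply hne
    have hin : ∀ k, 52 ≤ k → k < 58 → (i, k) ∈ stt c i (Q2 c i) := fun k hk hk2 =>
      (mem_stt hcc).2 (Or.inr ⟨rfl, hk2, by unfold Q2 full; omega⟩)
    have hsk : ∀ k, 2 ≤ k → k < 32 → (i, k) ∈ S := fun k hk hk2 =>
      h1 ((mem_stt hcc).2 (Or.inr ⟨rfl, by omega, Or.inl (Or.inl ⟨hk, hk2⟩)⟩))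
    have h7 : sv 3 ≤ sv 7 := by omega
    have m52 : (i, 52) ∈ S := by
      by_contra hn
      exact hno (sup1 h7 hN h2 (hin _ (by omega) (by omega)) hn (k' := 21) (l := 3) (by decide +kernel) (hsk 21 (by omega) (by omega)) le_rfl)
    have m53 : (i, 53) ∈ S := by
      by_contra hn
      exact hno (sup1 h7 hN h2 (hin _ (by omega) (by omega)) hn (k' := 52) (l := 7) (by decide +kernel) m52 h7)
    have m54 : (i, 54) ∈ S := by
      by_contra hn
      exact hno (sup2 h7 hN h2 (hin _ (by omega) (by omega)) hn (k' := 53) (k2 := 11) (l := 2) (l2 := 2) (by decide +kernel) (by decide +kernel)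
        (by decide) m53 (hsk 11 (by omega) (by omega)) (by omega))
    have m55 : (i, 55) ∈ S := by
      by_contra hn
      exact hno (sup2 h7 hN h2 (hin _ (by omega) (by omega)) hn (k' := 54) (k2 := 14) (l := 2) (l2 := 2) (by decide +kernel) (by decide +kernel)
        (by decide) m54 (hsk 14 (by omega) (by omega)) (by omega))
    have m56 : (i, 56) ∈ S := by
      by_contra hn
      exact hno (sup2 h7 hN h2 (hin _ (by omega) (by omega)) hn (k' := 54) (k2 := 6) (l := 2) (l2 := 2) (by decide +kernel) (by decide +kernel)
        (by decide) m54 (hsk 6 (by omega) (by omega)) (by omega))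
    have m57 : (i, 57) ∈ S := by
      by_contra hn
      exact hno (sup2 h7 hN h2 (hin _ (by omega) (by omega)) hn (k' := 55) (k2 := 2) (l := 2) (l2 := 2) (by decide +kernel) (by decide +kernel)
        (by decide) m55 (hsk 2 (by omega) (by omega)) (by omega))
    refine ext_stt hcc h1 h2 ?_
    intro k hk hq hnq
    have : k = 52 ∨ k = 53 ∨ k = 54 ∨ k = 55 ∨ k = 56 ∨ k = 57 := by
      unfold Q1 inS at hnq
      unfold Q2 full inS at hq
      omega
    rcases this with rfl | rfl | rfl | rfl | rfl | rfl <;> assumption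
  · refine ⟨le_rfl, hsub, seed_stt hcc hi (fun k h => Or.inl h), t3.le (by omega), ?_⟩
    intro y y1 hy
    rcases (mem_stt hcc).1 hy with h | h
    · omega
    · have := h.2.2
      unfold Q1 inS at this
      omega

theorem det_layer (hcc : ∀ j, c j ≤ 1) {Q Q' : ℕ → Prop} (hS : Stable sv τ (stt c i Q)) (hQ : ∀ k, Q k → Q' k)
    {V : Finset (ℤ × ℕ)} (hV : V ⊆ stt c i Q') (h0 : ((0 : ℤ), 1) ∉ V)
    (hc : con sv V (stt c i Q' \ V) < τ) : ∀ x ∈ V, x.1 = i ∧ ¬ Q x.2 ∧ Q' x.2 := by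
  have hemp : ¬ (V ∩ stt c i Q).Nonempty := by
    intro hne
    have := hS (V ∩ stt c i Q) Finset.inter_subset_right hne (fun h => h0 (Finset.mem_inter.1 h).1)
    refine absurd (this.trans (con_mono Finset.inter_subset_left ?_)) (not_le.2 hc)
    intro x hx
    have : x ∈ stt c i Q → x ∈ stt c i Q' := fun h => stt_mono hcc hQ h
    simp only [Finset.mem_sdiff, Finset.mem_inter] at *
    tauto
  rintro ⟨j, k⟩ hx
  have h1 := (mem_stt hcc).1 (hV hx)
  have h2 : (j, k) ∉ stt c i Q := fun h => hemp ⟨_, Finset.mem_inter.2 ⟨hx, h⟩⟩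
  rw [mem_stt hcc] at h2
  dsimp only
  tauto

theorem sdiff_stt (hcc : ∀ j, c j ≤ 1) {Q Q' : ℕ → Prop} {V : Finset (ℤ × ℕ)} (hQ : ∀ k, Q k → Q' k)
    (h1 : ∀ x ∈ V, x.1 = i ∧ ¬ Q x.2 ∧ Q' x.2) (h2 : ∀ k, Q' k → ¬ Q k → (i, k) ∈ V) :
    stt c i Q' \ V = stt c i Q := by
  ext ⟨j, k⟩
  rw [Finset.mem_sdiff, mem_stt hcc, mem_stt hcc]
  constructor
  · rintro ⟨h | ⟨rfl, h, h'⟩, hv⟩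
    · exact Or.inl h
    · refine Or.inr ⟨rfl, h, ?_⟩
      by_contra hq
      exact hv (h2 k h' hq)
  · rintro (h | ⟨rfl, h, h'⟩)
    · refine ⟨Or.inl h, fun hv => ?_⟩
      have := (h1 _ hv).1
      dsimp only at this
      omega
    · exact ⟨Or.inr ⟨rfl, h, hQ k h'⟩, fun hv => (h1 _ hv).2.1 h'⟩

theorem ck7 : bd (fun k => decide (34 ≤ k ∧ k < 41)) (rr 0 (fun k => decide (k < 34 ∨ 41 ≤ k))) = [4, 2] := by decide +kernel
theorem ck6 : bd (fun k => decide (k = 52 ∨ k = 53)) (rr 0 (fun k => decide (k ≠ 52 ∧ k ≠ 53))) = [3, 2] := by decide +kernel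

/-- phase `4 i + 1` when the bit is one -/
theorem phase7 (H : Hyp sv) (hcc : ∀ j, c j ≤ 1) (hi : 0 ≤ i) :
    PhOK sv (sv 7) (stt c i (Q4 i)) (stt c i (QE i)) := by
  have a23 := H.a23
  have a34 := H.a34
  have a46 := H.a46
  have a67 := H.a67
  have b1 := H.b1
  have b5 := H.b5
  have hN : Nice (stt c i (QE i)) := niceE hcc
  have hN4 : Nice (stt c i (Q4 i)) := nice4 hcc
  obtain ⟨t1, t2, t3, t4⟩ := stabs H hcc hi
  have hin4 : ∀ k, Q4 i k → (i, k) ∈ stt c i (Q4 i) := fun k hk =>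
    (mem_stt hcc).2 (Or.inr ⟨rfl, by unfold Q4 inS at hk; omega, hk⟩)
  have hinE : ∀ k, QE i k → (i, k) ∈ stt c i (QE i) := fun k hk =>
    (mem_stt hcc).2 (Or.inr ⟨rfl, by unfold QE inS at hk; omega, hk⟩)
  refine grow H (by omega) (lo := stt c i (QY i)) (P := fun _ => True) hN ?_ ?_ (Or.inr ⟨hN4, ?_, ?_, ?_⟩)
  · rintro S j U ⟨h1, h2, h3, h4, h5⟩ hA hd hc
    obtain ⟨rfl, g2⟩ := att7 H hcc hi le_rfl hA h1 h3 h2 hd hc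
    refine ⟨?_, trivial⟩
    rintro ⟨a, k⟩ hx
    obtain ⟨rfl, hk⟩ := mem_blk.1 hx
    have := g2 k hk
    exact hinE k (by unfold QE; omega)
  · rintro S ⟨h1, h2, h3, h4, h5⟩ hne
    by_contra hno
    apply hne
    have hadj : ∀ n, n < 7 → ((i, 41 + n) ∈ S ↔ (i, 41) ∈ S) := by
      intro n
      induction n with
      | zero => intro _; exact Iff.rfl
      | succ n ih =>
        intro hn
        rw [← ih (by omega)]
        obtain ⟨e1, e2⟩ := DE_chk2 (41 + n) (List.mem_range.2 (by omega)) (by omega) (by omega)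
        constructor
        · intro h
          by_contra hx
          exact hno (sup1 le_rfl hN h2 (hinE (41 + n) (by unfold QE; omega)) hx e1 h le_rfl)
        · intro h
          by_contra hx
          exact hno (sup1 le_rfl hN h2 (hinE (41 + n + 1) (by unfold QE; omega)) hx e2 h le_rfl)
    have h41 : (i, 41) ∈ S := by
      by_contra hn
      have hnn : ∀ k, 41 ≤ k → k < 48 → (i, k) ∉ S := by
        intro k k1 k2 hk
        refine hn ((hadj (k - 41) (by omega)).1 ?_)
        rwa [show 41 + (k - 41) = k by omega]
      have hY : ∀ k, QY i k → (i, k) ∈ S := fun k hk => h1 ((mem_stt hcc).2 (Or.inr ⟨rfl, by unfold QY inS at hk; omega, hk⟩))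
      have g29 := hY 29 (by unfold QY inS; omega)
      have g48 := hY 48 (by unfold QY inS; omega)
      have g49 := hY 49 (by unfold QY inS; omega)
      refine hno (can_attach le_rfl (hN.sub h2) i [41, 42, 43, 44, 45, 46, 47] (by simp) (by decide +kernel) ?_ ?_)
      · intro x hx k hk
        have hk' : 41 ≤ k ∧ k < 48 := by
          simp only [List.mem_cons, List.not_mem_nil, or_false] at hk
          omega
        exact free hN h2 (hinE k (by unfold QE; omega)) (hnn k hk'.1 hk'.2) x hx
      · have := cutF sv (blk i [41, 42, 43, 44, 45, 46, 47].toFinset) S i [(0, 0, 47, 29, 2), (0, 0, 47, 48, 2), (0, 0, 46, 49, 2)]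
          (by decide +kernel) (by decide +kernel)
        simp only [mem_blk, List.map_cons, List.map_nil, add_zero, List.mem_toFinset] at this
        simp [g29, g48, g49] at this
        simp
        omega
    refine ext_stt hcc h1 h2 ?_
    intro k hk hq hnq
    have : 41 ≤ k ∧ k < 48 := by
      unfold QY inS at hnq
      unfold QE inS at hq
      omega
    have := (hadj (k - 41) (by omega)).2 h41
    rwa [show 41 + (k - 41) = k by omega] at this
  · intro j U hA hd hc
    obtain ⟨rfl, g2, g3⟩ := att4 H hcc hi (by omega) hA (fun _ => stt_mono hcc (fun k h => Or.inl h))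
      (seed_stt hcc hi (fun k h => Or.inl h)) le_rfl (fun y _ _ _ => hin4 40 (by unfold Q4; omega)) hd hc
    obtain ⟨k, hk⟩ := hA.ne
    exact hd _ (hin4 k (g2 k hk)) _ (mem_blk.2 ⟨rfl, hk⟩) rfl
  · intro V hV hne h0 hc
    have hQ : ∀ k, QY i k → Q4 i k := by intro k; unfold QY Q4; tauto
    have h1 := det_layer hcc t2 hQ hV h0 hc
    have hch := chainDE le_rfl hc (b := 0) (j := i) (by omega) (fun k k1 k2 => hin4 k (by unfold Q4; omega))
    have hD : ∀ k, Q4 i k → ¬ QY i k → 34 ≤ k ∧ k < 41 := by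
      intro k k1 k2
      unfold Q4 at k1
      unfold QY at k2
      tauto
    have h34 : (i, 34) ∈ V := by
      obtain ⟨⟨j, k⟩, hx⟩ := hne
      obtain ⟨e1, e2, e3⟩ := h1 _ hx
      dsimp only at e1 e2 e3
      subst e1
      have := hD k e3 e2
      exact (hch k (by omega) (by omega)).1 hx
    rw [sdiff_stt hcc hQ h1 (fun k k1 k2 => (hch k (by have := hD k k1 k2; omega) (by have := hD k k1 k2; omega)).2 h34)]
    refine ⟨le_rfl, stt_mono hcc (by intro k; unfold QY QE inS; omega), seed_stt hcc hi (fun k h => Or.inl h), t2, trivial⟩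
  · refine can_detach hN4 (V := blk i (Finset.Ico 34 41)) ?_ ?_ ?_ ?_
    · rintro ⟨a, k⟩ hx
      obtain ⟨rfl, hk⟩ := mem_blk.1 hx
      rw [Finset.mem_Ico] at hk
      exact hin4 k (by unfold Q4; exact Or.inr (Or.inl hk))
    · exact ⟨(i, 34), mem_blk.2 ⟨rfl, by simp⟩⟩
    · rintro ⟨a, k⟩ hx e
      obtain ⟨rfl, hk⟩ := mem_blk.1 hx
      rw [Finset.mem_Ico] at hk
      dsimp only at hk e
      rw [← ps_seed] at e
      have := ps_eq (by omega) (by omega) e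
      omega
    · have := con_rr (sv := sv) (U := Finset.Ico 34 41) (S := stt c i (Q4 i) \ blk i (Finset.Ico 34 41)) (j := i) H.z0
        (fun k hk => by rw [Finset.mem_Ico] at hk; omega) (fun x hx => hN4.1 x (Finset.mem_sdiff.1 hx).1) 0 _ _ _ ck7
        (fun k hk => by rw [Finset.mem_Ico] at hk; simpa using hk) (fun a k hx => by
          have := (mem_stt hcc).1 (Finset.mem_sdiff.1 hx).1; omega) (fun k hx => by
          have := (Finset.mem_sdiff.1 hx).2
          rw [mem_blk, Finset.mem_Ico] at this
          simp only [add_zero, true_and] at this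
          rw [decide_eq_true_eq]
          omega)
      simp at this
      omega

theorem mem_next (hcc : ∀ j, c j ≤ 1) (hi : 0 ≤ i) {j : ℤ} {k : ℕ} : (j, k) ∈ stt c (i + 1) (inS (i + 1)) ↔
    (j, k) ∈ stt c i (full c i) ∨ (j = i + 1 ∧ inS (i + 1) k) := by
  rw [mem_stt hcc, mem_stt hcc]
  have e1 : inS (i + 1) k → k < 58 := by unfold inS; omega
  have e2 : full c i k → k < 58 := by have := hcc i; unfold full inS; omega
  by_cases hj : j = i
  · subst hj
    constructor
    · rintro (h | h)
      · tauto
      · omega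
    · rintro (h | h)
      · rcases h with h | h
        · omega
        · exact Or.inl ⟨hi, by omega, h.2.2⟩
      · omega
  · constructor
    · rintro (h | h)
      · exact Or.inl (Or.inl ⟨h.1, by omega, h.2.2⟩)
      · tauto
    · rintro (h | h)
      · rcases h with h | h
        · exact Or.inl ⟨h.1, by omega, h.2.2⟩
        · omega
      · tauto

/-- phase `4 i + 3` -/
theorem phase6 (H : Hyp sv) (hcc : ∀ j, c j ≤ 1) (hi : 0 ≤ i) :
    PhOK sv (sv 6) (stt c i (Q2 c i)) (stt c (i + 1) (inS (i + 1))) := by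
  have a23 := H.a23
  have a34 := H.a34
  have a46 := H.a46
  have a67 := H.a67
  have b1 := H.b1
  have b2 := H.b2
  have b4 := H.b4
  have hci := hcc i
  have hN : Nice (stt c (i + 1) (inS (i + 1))) := niceS hcc
  have hN2 : Nice (stt c i (Q2 c i)) := nice2 hcc
  obtain ⟨t1, t2, t3, t4⟩ := stabs H hcc hi
  have hin2 : ∀ k, Q2 c i k → (i, k) ∈ stt c i (Q2 c i) := fun k hk =>
    (mem_stt hcc).2 (Or.inr ⟨rfl, by unfold Q2 full inS at hk; omega, hk⟩)
  have hinf : ∀ k, full c i k → (i, k) ∈ stt c i (full c i) := fun k hk =>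
    (mem_stt hcc).2 (Or.inr ⟨rfl, by unfold full inS at hk; omega, hk⟩)
  have hinS : ∀ k, inS (i + 1) k → (i + 1, k) ∈ stt c (i + 1) (inS (i + 1)) := fun k hk =>
    (mem_stt hcc).2 (Or.inr ⟨rfl, by unfold inS at hk; omega, hk⟩)
  refine grow H (by omega) (lo := stt c i (full c i)) (P := fun S => ∀ k, (i + 1, k) ∈ S → (i + 1, 0) ∈ S)
    hN ?_ ?_ (Or.inr ⟨hN2, ?_, ?_, ?_⟩)
  · rintro S j U ⟨h1, h2, h3, h4, h5⟩ hA hd hc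
    obtain ⟨rfl, g2, g3⟩ := att6 H hcc hi le_rfl hA h1 h3 h2 h5 hd hc
    constructor
    · rintro ⟨a, k⟩ hx
      obtain ⟨rfl, hk⟩ := mem_blk.1 hx
      exact hinS k (g2 k hk)
    · intro y hy
      rcases g3 with h | h
      · exact Finset.mem_union_right _ (mem_blk.2 ⟨rfl, h⟩)
      · exact Finset.mem_union_left _ h
  · rintro S ⟨h1, h2, h3, h4, h5⟩ hne
    by_contra hno
    apply hne
    have h0 : (i + 1, 0) ∈ S := by
      by_contra hn
      have hnn : ∀ k, (i + 1, k) ∉ S := fun k hk => hn (h5 k hk)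
      have g54 := h1 (hinf 54 (by unfold full; omega))
      have g55 := h1 (hinf 55 (by unfold full; omega))
      have gde := h1 (hinf (40 + 7 * c i) (by unfold full; omega))
      refine hno (can_attach (by omega) (hN.sub h2) (i + 1) [33, 32, 0, 2, 4, 7, 12, 18] (by simp) (by decide +kernel) ?_ ?_)
      · intro x hx k hk
        have hk' : inS (i + 1) k := by
          simp only [List.mem_cons, List.not_mem_nil, or_false] at hk
          unfold inS
          omega
        exact free hN h2 (hinS k hk') (hnn k) x hx
      · have hcc2 : c i = 0 ∨ c i = 1 := by omega
        rcases hcc2 with h | h <;> rw [h] at gde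
        · have := cutF sv (blk (i + 1) [33, 32, 0, 2, 4, 7, 12, 18].toFinset) S i [(1, -1, 32, 54, 2), (1, -1, 33, 55, 2), (1, -1, 18, 40, 2)]
            (by decide +kernel) (by decide +kernel)
          simp only [mem_blk, List.map_cons, List.map_nil, List.mem_toFinset] at this
          simp [g54, g55] at this gde
          simp [gde] at this
          simp
          omega
        · have := cutF sv (blk (i + 1) [33, 32, 0, 2, 4, 7, 12, 18].toFinset) S i [(1, -1, 32, 54, 2), (1, -1, 33, 55, 2), (1, -1, 18, 47, 2)]
            (by decide +kernel) (by decide +kernel)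
          simp only [mem_blk, List.map_cons, List.map_nil, List.mem_toFinset] at this
          simp [g54, g55] at this gde
          simp [gde] at this
          simp
          omega
    have hr : root (i + 1) = 0 := if_neg (by omega)
    have hsk := skel_prog (by omega) hN h2 (by omega) hinS (by rwa [hr]) hno
    refine Finset.Subset.antisymm h2 ?_
    rintro ⟨j, k⟩ hx
    rcases (mem_next hcc hi).1 hx with h | ⟨rfl, h⟩
    · exact h1 h
    · exact hsk k h
  · intro j U hA hd hc
    obtain ⟨rfl, g2, g3⟩ := att3 H hcc hi (by omega) hA (stt_mono hcc (Q := Q1 c i) (Q' := Q2 c i) (fun k h => by unfold Q1 inS at h; unfold Q2 full inS; omega))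
      (seed_stt hcc hi (fun k h => Or.inl (Or.inl h))) le_rfl (fun y _ _ => hin2 53 (by unfold Q2; omega)) hd hc
    obtain ⟨k, hk⟩ := hA.ne
    have e1 := hA.lt k hk
    have e2 := g2 k hk
    exact hd _ (hin2 k (by unfold Q2 full; omega)) _ (mem_blk.2 ⟨rfl, hk⟩) rfl
  · intro V hV hne h0 hc
    have hQ : ∀ k, full c i k → Q2 c i k := fun k h => Or.inl h
    have h1 := det_layer hcc t4 hQ hV h0 hc
    have hch := s7_iff (by omega) hc (j := i) (k := 52) (k' := 53) (by decide +kernel) (by decide +kernel) (hin2 52 (by unfold Q2; omega))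
      (hin2 53 (by unfold Q2; omega))
    have h52 : (i, 52) ∈ V := by
      obtain ⟨⟨j, k⟩, hx⟩ := hne
      obtain ⟨e1, e2, e3⟩ := h1 _ hx
      dsimp only at e1 e2 e3
      subst e1
      rcases e3.resolve_left e2 with rfl | rfl
      · exact hx
      · exact hch.2 hx
    rw [sdiff_stt hcc hQ h1 (fun k k1 k2 => by
      rcases k1.resolve_left k2 with rfl | rfl
      · exact h52
      · exact hch.1 h52)]
    refine ⟨le_rfl, ?_, seed_stt hcc hi (fun k h => Or.inl h), t4, ?_⟩
    · rintro ⟨j, k⟩ hx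
      exact (mem_next hcc hi).2 (Or.inl hx)
    · intro k hk
      have := (mem_stt hcc).1 hk
      omega
  · refine can_detach hN2 (V := blk i {52, 53}) ?_ ?_ ?_ ?_
    · rintro ⟨a, k⟩ hx
      obtain ⟨rfl, hk⟩ := mem_blk.1 hx
      simp only [Finset.mem_insert, Finset.mem_singleton] at hk
      exact hin2 k (Or.inr hk)
    · exact ⟨(i, 52), mem_blk.2 ⟨rfl, by simp⟩⟩
    · rintro ⟨a, k⟩ hx e
      obtain ⟨rfl, hk⟩ := mem_blk.1 hx
      simp only [Finset.mem_insert, Finset.mem_singleton] at hk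
      rw [← ps_seed] at e
      have := ps_eq (by omega) (by omega) e
      omega
    · have := con_rr (sv := sv) (U := {52, 53}) (S := stt c i (Q2 c i) \ blk i {52, 53}) (j := i) H.z0
        (fun k hk => by simp only [Finset.mem_insert, Finset.mem_singleton] at hk; omega)
        (fun x hx => hN2.1 x (Finset.mem_sdiff.1 hx).1) 0 _ _ _ ck6
        (fun k hk => by simpa using hk) (fun a k hx => by
          have := (mem_stt hcc).1 (Finset.mem_sdiff.1 hx).1; omega) (fun k hx => by
          have := (Finset.mem_sdiff.1 hx).2
          rw [mem_blk] at this
          simp only [add_zero, true_and, Finset.mem_insert, Finset.mem_singleton] at this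
          rw [decide_eq_true_eq]
          omega)
      simp at this
      omega
end
end TA

namespace TA
open Finset

theorem ck_cells : ∀ x : Fin 4, ∀ y : Fin 12, ∃ k : Fin 58, hx k.1 = x.1 + 1 ∧ hy k.1 = y.1 ∧
    ((2 ≤ k.1 ∧ k.1 < 32) ∨ k.1 = 1 ∨ (48 ≤ k.1 ∧ k.1 < 58) ∨ (34 ≤ k.1 ∧ k.1 < 41)) := by decide +kernel

theorem ck_bd : ∀ k : Fin 58, hx k.1 ≤ 4 ∧ hy k.1 ≤ 11 ∧ (1 ≤ hx k.1 ∨ k.1 = 32 ∨ k.1 = 33) := by decide +kernel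

theorem final_shape {c : ℤ → ℕ} {i : ℤ} (hcc : ∀ j, c j ≤ 1) (hi : 0 ≤ i) (a b : ℤ) :
    (∃ x ∈ stt c i (Q2 c i), ps x = (a, b)) ↔ 0 ≤ a ∧ a < 4 * (i + 1) ∧ -3 ≤ b ∧ b < 9 := by
  constructor
  · rintro ⟨⟨j, k⟩, hx', e⟩
    have hj : 0 ≤ j ∧ j ≤ i ∧ k < 58 ∧ (k = 32 ∨ k = 33 → 0 < j) := by
      have := hcc j
      rcases (mem_stt hcc).1 hx' with h | ⟨rfl, h1, h⟩
      · have h3 := h.2.2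
        unfold full inS at h3
        omega
      · unfold Q2 full inS at h
        omega
    have h1 := ck_bd ⟨k, hj.2.2.1⟩
    dsimp only at h1
    simp only [ps, Prod.mk.injEq] at e
    omega
  · rintro ⟨h1, h2, h3, h4⟩
    obtain ⟨x, hx0⟩ : ∃ x : Fin 4, (x.1 : ℤ) = a % 4 := ⟨⟨(a % 4).toNat, by omega⟩, by dsimp only; omega⟩
    obtain ⟨y, hy0⟩ : ∃ y : Fin 12, (y.1 : ℤ) = b + 3 := ⟨⟨(b + 3).toNat, by omega⟩, by dsimp only; omega⟩
    obtain ⟨⟨k, hk⟩, e1, e2, e3⟩ := ck_cells x y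
    dsimp only at e1 e2 e3
    obtain ⟨j, hj⟩ : ∃ j, j = a / 4 := ⟨_, rfl⟩
    have hjj : 0 ≤ j ∧ j ≤ i := by omega
    have hps : ps (j, k) = (a, b) := by
      simp only [ps, Prod.mk.injEq]
      omega
    have cj := hcc j
    have key : ∀ k', k' < 58 → full c j k' → (j, k') ∈ stt c i (Q2 c i) := by
      intro k' hk' h
      rw [mem_stt hcc]
      rcases eq_or_lt_of_le hjj.2 with h' | h'
      · subst h'
        exact Or.inr ⟨rfl, hk', Or.inl h⟩
      · exact Or.inl ⟨hjj.1, h', h⟩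
    by_cases k1 : k = 1
    · subst k1
      by_cases j0 : j = 0
      · exact ⟨_, key 1 (by omega) (by unfold full inS; omega), hps⟩
      · refine ⟨_, key 0 (by omega) (by unfold full inS; omega), ?_⟩
        rw [← hps]
        have : hx 0 = hx 1 ∧ hy 0 = hy 1 := by decide +kernel
        simp only [ps, this]
    by_cases kd : 34 ≤ k ∧ k < 41
    · by_cases hc : c j = 0
      · exact ⟨_, key k (by omega) (by unfold full; omega), hps⟩
      · exact ⟨_, key (k + 7) (by omega) (by unfold full; omega), by rw [← psDE kd.1 kd.2, hps]⟩
    by_cases kb : k = 52 ∨ k = 53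
    · rcases eq_or_lt_of_le hjj.2 with h' | h'
      · refine ⟨(j, k), (mem_stt hcc).2 (Or.inr ⟨h', hk, Or.inr kb⟩), hps⟩
      · have hm : ∀ k', k' = 32 ∨ k' = 33 → (j + 1, k') ∈ stt c i (Q2 c i) := by
          intro k' hk'
          have : full c (j + 1) k' := by unfold full inS; omega
          rw [mem_stt hcc]
          rcases eq_or_lt_of_le (show j + 1 ≤ i by omega) with h'' | h''
          · exact Or.inr ⟨h'', by omega, Or.inl (h'' ▸ this)⟩
          · exact Or.inl ⟨by omega, h'', this⟩
        rcases kb with rfl | rfl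
        · refine ⟨_, hm 33 (by omega), ?_⟩
          rw [← hps]
          have : hx 33 = 0 ∧ hy 33 = 4 ∧ hx 52 = 4 ∧ hy 52 = 4 := by decide +kernel
          simp only [ps, this, Prod.mk.injEq, and_true]
          push_cast
          ring
        · refine ⟨_, hm 32 (by omega), ?_⟩
          rw [← hps]
          have : hx 32 = 0 ∧ hy 32 = 3 ∧ hx 53 = 4 ∧ hy 53 = 3 := by decide +kernel
          simp only [ps, this, Prod.mk.injEq, and_true]
          push_cast
          ring
    · exact ⟨_, key k hk (by unfold full inS; omega), hps⟩

def cb (b : ℕ → Bool) (j : ℤ) : ℕ := if b j.toNat then 1 else 0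

theorem cb_le (b : ℕ → Bool) (j : ℤ) : cb b j ≤ 1 := by unfold cb; split_ifs <;> omega

noncomputable def sts (b : ℕ → Bool) (n : ℕ) : Finset (ℤ × ℕ) :=
  if n = 0 then {((0 : ℤ), 1)}
  else if n % 4 = 0 then stt (cb b) (n / 4 : ℕ) (inS (n / 4 : ℕ))
  else if n % 4 = 1 then stt (cb b) (n / 4 : ℕ) (Q4 (n / 4 : ℕ))
  else if n % 4 = 2 then stt (cb b) (n / 4 : ℕ) (Q1 (cb b) (n / 4 : ℕ))
  else stt (cb b) (n / 4 : ℕ) (Q2 (cb b) (n / 4 : ℕ))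

def svf (s₂ s₃ s₄ s₆ s₇ : ℕ) (l : ℕ) : ℕ :=
  if l = 2 then s₂ else if l = 3 then s₃ else if l = 4 then s₄ else if l = 6 then s₆ else if l = 7 then s₇ else 0

theorem stt_congr {c : ℤ → ℕ} {i : ℤ} {Q Q' : ℕ → Prop} (hcc : ∀ j, c j ≤ 1) (h : ∀ k, Q k ↔ Q' k) :
    stt c i Q = stt c i Q' :=
  Finset.Subset.antisymm (stt_mono hcc fun k => (h k).1) (stt_mono hcc fun k => (h k).2)

theorem ph_all {sv : ℕ → ℕ} (H : Hyp sv) (b : ℕ → Bool) (n : ℕ) :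
    PhOK sv (if n % 4 = 0 then sv 4 else if n % 4 = 1 then (if b (n / 4) then sv 7 else sv 4)
      else if n % 4 = 2 then sv 3 else sv 6) (sts b n) (sts b (n + 1)) := by
  obtain ⟨q, hq⟩ : ∃ q, q = n / 4 := ⟨_, rfl⟩
  have hi : (0 : ℤ) ≤ (q : ℤ) := by omega
  have hcc := cb_le b
  have hlt : n % 4 < 4 := Nat.mod_lt _ (by omega)
  obtain h | h | h | h : n % 4 = 0 ∨ n % 4 = 1 ∨ n % 4 = 2 ∨ n % 4 = 3 := by omega
  · have e2 : sts b (n + 1) = stt (cb b) q (Q4 q) := by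
      unfold sts
      rw [if_neg (by omega), if_neg (by omega), if_pos (by omega), show (n + 1) / 4 = q by omega]
    rw [if_pos h, e2]
    refine phase4 H hcc hi ?_
    by_cases h0 : n = 0
    · left
      refine ⟨by omega, ?_⟩
      unfold sts
      rw [if_pos h0]
    · right; left
      unfold sts
      rw [if_neg h0, if_pos h, ← hq]
  · have e1 : sts b n = stt (cb b) q (Q4 q) := by
      unfold sts
      rw [if_neg (by omega), if_neg (by omega), if_pos (by omega), ← hq]
    have e2 : sts b (n + 1) = stt (cb b) q (Q1 (cb b) q) := by
      unfold sts
      rw [if_neg (by omega), if_neg (by omega), if_neg (by omega), if_pos (by omega), show (n + 1) / 4 = q by omega]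
    rw [if_neg (by omega), if_pos h, e1, e2, ← hq]
    by_cases hb : b q = true
    · have hc : cb b q = 1 := by unfold cb; rw [Int.toNat_natCast, if_pos hb]
      rw [if_pos hb, stt_congr hcc (Q := Q1 (cb b) q) (Q' := QE q) (fun k => by unfold Q1 QE inS; rw [hc]; omega)]
      exact phase7 H hcc hi
    · have hc : cb b q = 0 := by unfold cb; rw [Int.toNat_natCast, if_neg hb]
      rw [if_neg hb, stt_congr hcc (Q := Q1 (cb b) q) (Q' := Q4 q) (fun k => by unfold Q1 Q4 inS; rw [hc])]
      exact phase4 H hcc hi (Or.inr (Or.inr ⟨hc, rfl⟩))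
  · have e1 : sts b n = stt (cb b) q (Q1 (cb b) q) := by
      unfold sts
      rw [if_neg (by omega), if_neg (by omega), if_neg (by omega), if_pos (by omega), ← hq]
    have e2 : sts b (n + 1) = stt (cb b) q (Q2 (cb b) q) := by
      unfold sts
      rw [if_neg (by omega), if_neg (by omega), if_neg (by omega), if_neg (by omega), show (n + 1) / 4 = q by omega]
    rw [if_neg (by omega), if_neg (by omega), if_pos h, e1, e2]
    exact phase3 H hcc hi
  · have e1 : sts b n = stt (cb b) q (Q2 (cb b) q) := by
      unfold sts
      rw [if_neg (by omega), if_neg (by omega), if_neg (by omega), if_neg (by omega), ← hq]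
    have e2 : sts b (n + 1) = stt (cb b) ((q : ℤ) + 1) (inS ((q : ℤ) + 1)) := by
      unfold sts
      rw [if_neg (by omega), if_pos (by omega), show (n + 1) / 4 = q + 1 by omega]
      push_cast
      rfl
    rw [if_neg (by omega), if_neg (by omega), if_neg (by omega), e1, e2]
    exact phase6 H hcc hi

theorem rep_seed : Rep 0 {((0 : ℤ), 1)} (seedConfig (tl 1)) := by
  intro p t
  unfold seedConfig
  simp only [Finset.mem_singleton, exists_eq_left, ps_seed, zero_add]
  split_ifs with h
  · subst h
    simp
  · constructor
    · intro h'; cases h'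
    · rintro ⟨-, h'⟩
      exact absurd h'.symm h

theorem memTS {k : ℕ} (h : k < 58) : tl k ∈ TS := Finset.mem_image.2 ⟨k, Finset.mem_range.2 h, rfl⟩

theorem lv_vals (g : ℕ) : lv g = 0 ∨ lv g = 2 ∨ lv g = 3 ∨ lv g = 4 ∨ lv g = 7 := by
  unfold lv
  split_ifs <;> simp

end TA

/-- **Lemma 1.** For positive integers `s₁ < ⋯ < s₇` satisfying the stated
constraints, there are a fixed finite tile set `T` (independent of `m`), seed `s ∈ T`, glue
function `G` with values in `{0, s₁, …, s₇}`, and distinguished tiles `t₀, t₁ ∈ T`, such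
that for every `m ≥ 1` and binary string `b`, under the temperature sequence `τ^b` the
system uniquely assembles, in the multiple tile model, a `12 × 4m` rectangle whose top-row
tile at horizontal position `4i + 1` (counting from 1 at the west end) is `t₀` if `b i = 0`
and `t₁` if `b i = 1`. -/
theorem stmt4 (s₁ s₂ s₃ s₄ s₅ s₆ s₇ : ℕ)
    (h1 : 0 < s₁) (h12 : s₁ < s₂) (h23 : s₂ < s₃) (h34 : s₃ < s₄) (h45 : s₄ < s₅)
    (h56 : s₅ < s₆) (h67 : s₆ < s₇)
    (hc2a : 2 * s₄ < s₇) (hc2b : s₇ ≤ 2 * s₄ + s₁)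
    (hc3 : s₇ ≤ s₃ + s₅) (hc4 : s₇ ≤ 3 * s₂)
    (hc5a : 2 * s₃ < s₆) (hc5b : s₆ ≤ s₂ + s₄) (hc6 : s₄ ≤ 2 * s₂) :
    ∃ (T : Finset Tile) (s : Tile) (G : Glue → ℕ) (t₀ t₁ : Tile),
      s ∈ T ∧ t₀ ∈ T ∧ t₁ ∈ T ∧ G 0 = 0 ∧
      (∀ x, G x ∈ ({0, s₁, s₂, s₃, s₄, s₅, s₆, s₇} : Set ℕ)) ∧
      ∀ m : ℕ, 1 ≤ m → ∀ b : ℕ → Bool,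
        ∃ (S : Config) (d : ℤ × ℤ),
          UniquelyProduces (MStep T G) s (tempSeq4 s₃ s₄ s₆ s₇ b m) S ∧
          shape S = translateSet d (rect 12 (4 * m)) ∧
          ∀ i : ℕ, i < m →
            S (d.1 + 4 * (i : ℤ), d.2 + 11) = some (if b i then t₁ else t₀) := by
  have H : TA.Hyp (TA.svf s₂ s₃ s₄ s₆ s₇) := by
    constructor <;> simp only [TA.svf] <;> norm_num <;> omega
  refine ⟨TA.TS, TA.tl 1, TA.gl (TA.svf s₂ s₃ s₄ s₆ s₇), TA.tl 34, TA.tl 41, TA.memTS (by norm_num),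
    TA.memTS (by norm_num), TA.memTS (by norm_num), ?_, ?_, ?_⟩
  · exact H.z0
  · intro x
    unfold TA.gl
    rcases TA.lv_vals x with h | h | h | h | h <;> rw [h] <;> simp [TA.svf]
  · intro m hm b
    have hcc := TA.cb_le b
    have hrun := TA.run (sv := TA.svf s₂ s₃ s₄ s₆ s₇) (fun j => if j % 4 = 0 then s₄
      else if j % 4 = 1 then (if b (j / 4) then s₇ else s₄)
      else if j % 4 = 2 then s₃ else s₆) (TA.sts b) (4 * m - 1) 0
      (fun i _ => TA.ph_all H b (0 + i)) (seedConfig (TA.tl 1)) TA.rep_seed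
    rw [← List.range_eq_range'] at hrun
    obtain ⟨r1, ⟨S, r2⟩, r3⟩ := hrun
    have hS := r3 S r2
    have e : TA.sts b (0 + (4 * m - 1)) = TA.stt (TA.cb b) (m - 1 : ℕ) (TA.Q2 (TA.cb b) (m - 1 : ℕ)) := by
      unfold TA.sts
      rw [if_neg (by omega), if_neg (by omega), if_neg (by omega), if_neg (by omega),
        show (0 + (4 * m - 1)) / 4 = m - 1 by omega]
    refine ⟨S, (0, -3), ⟨r1, r2, fun C hC => (r3 C hC).unique hS⟩, ?_, ?_⟩
    · rw [e] at hS
      ext ⟨x, y⟩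
      rw [TA.shape_rep hS]
      simp only [zero_add]
      rw [TA.final_shape hcc (by omega)]
      unfold translateSet rect
      constructor
      · rintro ⟨g1, g2, g3, g4⟩
        refine ⟨(x, y + 3), ⟨g1, ?_, ?_, ?_⟩, ?_⟩
        · push_cast; omega
        · dsimp only; omega
        · push_cast; omega
        · simp
      · rintro ⟨⟨u, v⟩, ⟨g1, g2, g3, g4⟩, g5⟩
        simp only [Prod.mk_add_mk, Prod.mk.injEq] at g5
        dsimp only at g1 g2 g3 g4
        push_cast at g2 g4
        omega
    · intro i hi
      rw [e] at hS
      have c1 := hcc i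
      have hfull : TA.full (TA.cb b) i (34 + 7 * TA.cb b i) := by unfold TA.full; omega
      have hm' : ((i : ℤ), 34 + 7 * TA.cb b i) ∈ TA.stt (TA.cb b) (m - 1 : ℕ) (TA.Q2 (TA.cb b) (m - 1 : ℕ)) := by
        rw [TA.mem_stt hcc]
        by_cases h' : i = m - 1
        · subst h'
          exact Or.inr ⟨rfl, by omega, Or.inl hfull⟩
        · exact Or.inl ⟨by omega, by omega, hfull⟩
      have hat := hS.at hm'
      by_cases hb : b i = true
      · have hc : TA.cb b i = 1 := by unfold TA.cb; rw [Int.toNat_natCast, if_pos hb]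
        have hp : TA.hx 41 = 1 ∧ TA.hy 41 = 11 := by decide +kernel
        rw [hc] at hat
        rw [if_pos hb, ← hat]
        congr 1
        simp [TA.ps, hp]
      · have hc : TA.cb b i = 0 := by unfold TA.cb; rw [Int.toNat_natCast, if_neg hb]
        have hp : TA.hx 34 = 1 ∧ TA.hy 34 = 11 := by decide +kernel
        rw [hc] at hat
        rw [if_neg hb, ← hat]
        congr 1
        simp [TA.ps, hp]
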